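/- arXiv:1005.4194 — 2 statements merged into one kernel-verified Lean document; each statement's English description precedes it below -/
import Mathlib

section
/- Let m ≥ 0 and grade the polynomial ring R(A,𝔫,L)[S_1,…,S_m] by K × ℤ^m, where the T_{ij} carry their K-degrees Q(e_{ij}) (viewed in K × {0}) and deg S_i := e_i, the i-th standard basis vector of ℤ^m. Then this grading is effective, pointed (degree-zero component 𝕂·1), factorial (every homogeneous nonzero nonunit is a product of (K×ℤ^m)-primes), and of complexity one (the rank of K × ℤ^m equals the Krull dimension of R(A,𝔫,L)[S_1,…,S_m] minus one). -/
open MvPolynomial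

section Setup

variable (𝕂 : Type) [Field 𝕂] [IsAlgClosed 𝕂] [CharZero 𝕂]
variable (r : ℕ) (a : Fin (r+1) → 𝕂 × 𝕂) (n : Fin (r+1) → ℕ)
variable (l : ∀ i : Fin (r+1), Fin (n i) → ℕ)

/-- The index set of the variables `T_{ij}`, `0 ≤ i ≤ r`, `1 ≤ j ≤ n_i`. -/
abbrev Idx (r : ℕ) (n : Fin (r+1) → ℕ) := Σ i : Fin (r+1), Fin (n i)

/-- The monomial `T_i^{l_i} = T_{i1}^{l_{i1}} ⋯ T_{i n_i}^{l_{i n_i}}`. -/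
noncomputable def mono (i : Fin (r+1)) : MvPolynomial (Idx r n) 𝕂 :=
  ∏ j : Fin (n i), (X ⟨i, j⟩ : MvPolynomial (Idx r n) 𝕂) ^ l i j

/-- `α_{ij} = det(a_i, a_j)`. -/
def alpha (i k : Fin (r+1)) : 𝕂 := (a i).1 * (a k).2 - (a k).1 * (a i).2

/-- The trinomial `g_{i,j,k} = α_{jk} T_i^{l_i} + α_{ki} T_j^{l_j} + α_{ij} T_k^{l_k}`. -/
noncomputable def gPoly (i j k : Fin (r+1)) : MvPolynomial (Idx r n) 𝕂 :=
  C (alpha 𝕂 r a j k) * mono 𝕂 r n l i + C (alpha 𝕂 r a k i) * mono 𝕂 r n l j +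
    C (alpha 𝕂 r a i j) * mono 𝕂 r n l k

/-- The ideal `⟨g_{i,i+1,i+2} ; 0 ≤ i ≤ r-2⟩`. -/
noncomputable def relIdeal : Ideal (MvPolynomial (Idx r n) 𝕂) :=
  Ideal.span { p | ∃ i j k : Fin (r+1), (j : ℕ) = (i : ℕ) + 1 ∧ (k : ℕ) = (i : ℕ) + 2 ∧
    p = gPoly 𝕂 r a n l i j k }

/-- The ring `R(A, 𝔫, L)`. -/
abbrev RAnL := MvPolynomial (Idx r n) 𝕂 ⧸ relIdeal 𝕂 r a n l

/-- Row `i` (for `1 ≤ i ≤ r`) of the `r × n` matrix `P`. -/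
def Prow (i : Fin r) : Idx r n → ℤ :=
  fun x => if x.1 = 0 then -(l x.1 x.2 : ℤ) else if x.1 = i.succ then (l x.1 x.2 : ℤ) else 0

/-- The subgroup of `ℤ^n` generated by the rows of `P`. -/
def rowSpan : AddSubgroup (Idx r n → ℤ) := AddSubgroup.closure (Set.range (Prow r n l))

/-- The grading group `K = ℤ^n / P^*(M)`. -/
abbrev Kgrp := (Idx r n → ℤ) ⧸ rowSpan r n l

/-- The projection `Q : ℤ^n → K`. -/
noncomputable def Qmap : (Idx r n → ℤ) →+ Kgrp r n l := QuotientAddGroup.mk' (rowSpan r n l)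

/-- The weight `deg T_{ij} := Q(e_{ij})` defining the `K`-grading of `S`. -/
noncomputable def wK : Idx r n → Kgrp r n l := fun x => Qmap r n l (Pi.single x (1 : ℤ))

/-- An element of `R(A,𝔫,L)` is homogeneous of degree `d` if it is the image of a
`K`-homogeneous polynomial of degree `d`. -/
def IsHomog (d : Kgrp r n l) (y : RAnL 𝕂 r a n l) : Prop :=
  ∃ p : MvPolynomial (Idx r n) 𝕂, p.IsWeightedHomogeneous (wK r n l) d ∧
    Ideal.Quotient.mk (relIdeal 𝕂 r a n l) p = y

/-- `K`-prime elements of `R(A,𝔫,L)`. -/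
def KPrime (f : RAnL 𝕂 r a n l) : Prop :=
  (∃ d, IsHomog 𝕂 r a n l d f) ∧ f ≠ 0 ∧ ¬ IsUnit f ∧
    ∀ x y : RAnL 𝕂 r a n l, (∃ d, IsHomog 𝕂 r a n l d x) → (∃ d, IsHomog 𝕂 r a n l d y) →
      f ∣ x * y → f ∣ x ∨ f ∣ y

end Setup

section ExtSetup

variable (𝕂 : Type) [Field 𝕂] [IsAlgClosed 𝕂] [CharZero 𝕂]
variable (r : ℕ) (a : Fin (r+1) → 𝕂 × 𝕂) (n : Fin (r+1) → ℕ)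
variable (l : ∀ i : Fin (r+1), Fin (n i) → ℕ) (m : ℕ)

/-- The index set of the variables `T_{ij}` and `S_1, …, S_m`. -/
abbrev IdxE (r : ℕ) (n : Fin (r+1) → ℕ) (m : ℕ) := Idx r n ⊕ Fin m

/-- The ideal `⟨g_{i,i+1,i+2} ; 0 ≤ i ≤ r-2⟩` in `𝕂[T_{ij}, S_1, …, S_m]`. -/
noncomputable def relIdealE : Ideal (MvPolynomial (IdxE r n m) 𝕂) :=
  Ideal.span { p | ∃ i j k : Fin (r+1), (j : ℕ) = (i : ℕ) + 1 ∧ (k : ℕ) = (i : ℕ) + 2 ∧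
    p = rename Sum.inl (gPoly 𝕂 r a n l i j k) }

/-- The ring `R(A,𝔫,L)[S_1, …, S_m]`. -/
abbrev RAnLE := MvPolynomial (IdxE r n m) 𝕂 ⧸ relIdealE 𝕂 r a n l m

/-- The grading group `K × ℤ^m`. -/
abbrev KgrpE := Kgrp r n l × (Fin m → ℤ)

/-- The `K × ℤ^m`-grading: `deg T_{ij} = (Q(e_{ij}), 0)` and `deg S_k = (0, e_k)`. -/
noncomputable def wKE : IdxE r n m → KgrpE r n l m := fun x =>
  match x with
  | Sum.inl x => (wK r n l x, 0)
  | Sum.inr k => (0, Pi.single k (1 : ℤ))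

/-- Homogeneity of degree `d ∈ K × ℤ^m` in `R(A,𝔫,L)[S_1, …, S_m]`. -/
def IsHomogE (d : KgrpE r n l m) (y : RAnLE 𝕂 r a n l m) : Prop :=
  ∃ p : MvPolynomial (IdxE r n m) 𝕂, p.IsWeightedHomogeneous (wKE r n l m) d ∧
    Ideal.Quotient.mk (relIdealE 𝕂 r a n l m) p = y

/-- `K × ℤ^m`-prime elements of `R(A,𝔫,L)[S_1, …, S_m]`. -/
def KPrimeE (f : RAnLE 𝕂 r a n l m) : Prop :=
  (∃ d, IsHomogE 𝕂 r a n l m d f) ∧ f ≠ 0 ∧ ¬ IsUnit f ∧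
    ∀ x y : RAnLE 𝕂 r a n l m, (∃ d, IsHomogE 𝕂 r a n l m d x) →
      (∃ d, IsHomogE 𝕂 r a n l m d y) → f ∣ x * y → f ∣ x ∨ f ∣ y

end ExtSetup

section LinearForms

/-- The value at `(x, y)` of the linear form with coefficients `v`. -/
def linForm {𝕂 B : Type} [Field 𝕂] [CommRing B] [Algebra 𝕂 B] (x y : B) (v : 𝕂 × 𝕂) : B :=
  algebraMap 𝕂 B v.1 * x + algebraMap 𝕂 B v.2 * y

/-- The determinant of two vectors in the plane. -/
def det2 {𝕂 : Type} [Field 𝕂] (v w : 𝕂 × 𝕂) : 𝕂 := v.1 * w.2 - w.1 * v.2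

lemma det2_ne_zero {𝕂 : Type} [Field 𝕂] {v w : 𝕂 × 𝕂} (h : LinearIndependent 𝕂 ![v, w]) :
    det2 v w ≠ 0 := by
  rw [LinearIndependent.pair_iff] at h
  intro h0
  unfold det2 at h0
  have h1 := h w.2 (-v.2) (Prod.ext (by simp; linear_combination h0) (by simp; ring))
  have h2 := h w.1 (-v.1) (Prod.ext (by simp; ring) (by simp; linear_combination -h0))
  have h3 := h 0 1 (by ext <;> simp [h1.1, h2.1])
  exact one_ne_zero h3.2

/-- Vectors with vanishing determinant are proportional. -/
lemma exists_smul_of_det2_eq_zero {𝕂 : Type} [Field 𝕂] {v w : 𝕂 × 𝕂} (hv : v ≠ 0)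
    (h : det2 v w = 0) : ∃ c : 𝕂, w = c • v := by
  unfold det2 at h
  by_cases h1 : v.1 = 0
  · have h2 : v.2 ≠ 0 := fun h2 => hv (Prod.ext h1 h2)
    refine ⟨w.2 / v.2, Prod.ext ?_ ?_⟩
    · simp only [Prod.smul_fst, smul_eq_mul]
      field_simp
      linear_combination -h
    · simp only [Prod.smul_snd, smul_eq_mul]
      field_simp
  · refine ⟨w.1 / v.1, Prod.ext ?_ ?_⟩
    · simp only [Prod.smul_fst, smul_eq_mul]
      field_simp
    · simp only [Prod.smul_snd, smul_eq_mul]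
      field_simp
      linear_combination h

lemma linForm_smul {𝕂 B : Type} [Field 𝕂] [CommRing B] [Algebra 𝕂 B] (x y : B) (c : 𝕂)
    (v : 𝕂 × 𝕂) : linForm x y (c • v) = algebraMap 𝕂 B c * linForm x y v := by
  simp only [linForm, Prod.smul_fst, Prod.smul_snd, smul_eq_mul, map_mul]
  ring

lemma map_linForm {𝕂 B D : Type} [Field 𝕂] [CommRing B] [Algebra 𝕂 B] [CommRing D] [Algebra 𝕂 D]
    (φ : B →ₐ[𝕂] D) (x y : B) (v : 𝕂 × 𝕂) :
    φ (linForm x y v) = linForm (φ x) (φ y) v := by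
  simp [linForm]

/-- A binary form over an algebraically closed field is a product of linear forms. -/
lemma exists_prod_linForm {𝕂 : Type} [Field 𝕂] [IsAlgClosed 𝕂] {N : ℕ}
    {q : MvPolynomial (Fin 2) 𝕂} (hq : q.IsHomogeneous N) (h0 : q ≠ 0) :
    ∃ c : 𝕂, c ≠ 0 ∧ ∃ vs : Multiset (𝕂 × 𝕂), (∀ v ∈ vs, v ≠ 0) ∧
      q = C c * (vs.map (linForm (X 0 : MvPolynomial (Fin 2) 𝕂) (X 1))).prod := by
  set p : Polynomial 𝕂 := aeval ![Polynomial.X, 1] q with hp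
  have hpq : p.homogenize N = q := Polynomial.homogenize_eq_of_isHomogeneous hq rfl
  have hdeg : p.natDegree ≤ N := by
    have := aeval_natDegree_le (m := N) (n := 1) q hq.totalDegree_le
      ![(Polynomial.X : Polynomial 𝕂), 1] (by intro i; fin_cases i <;> simp)
    simpa using this
  have hp0 : p ≠ 0 := by
    intro h
    rw [h, Polynomial.homogenize_zero] at hpq
    exact h0 hpq.symm
  have hs : p.Splits := IsAlgClosed.splits p
  have hcard : p.roots.card = p.natDegree := hs.natDegree_eq_card_roots.symm
  have key : ∀ s : Multiset 𝕂, ((s.map (fun ρ => Polynomial.X - Polynomial.C ρ)).prod).homogenize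
      s.card = (s.map (fun ρ => linForm (X 0 : MvPolynomial (Fin 2) 𝕂) (X 1) ((1 : 𝕂), -ρ))).prod := by
    intro s
    induction s using Multiset.induction_on with
    | empty => simp
    | cons ρ s ih =>
      rw [Multiset.map_cons, Multiset.prod_cons, Multiset.card_cons, add_comm,
        Polynomial.homogenize_mul _ _ (by simp) (by simp), ih, Multiset.map_cons,
        Multiset.prod_cons]
      congr 1
      simp [linForm, MvPolynomial.algebraMap_eq, sub_eq_add_neg]
  refine ⟨p.leadingCoeff, by simpa using hp0,
    p.roots.map (fun ρ => ((1 : 𝕂), -ρ)) + Multiset.replicate (N - p.natDegree) (0, 1), ?_, ?_⟩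
  · intro v hv
    rw [Multiset.mem_add] at hv
    rcases hv with hv | hv
    · obtain ⟨ρ, -, rfl⟩ := Multiset.mem_map.1 hv
      simp [Prod.ext_iff]
    · rw [Multiset.eq_of_mem_replicate hv]
      simp [Prod.ext_iff]
  · rw [← hpq]
    have h1 : p = Polynomial.C p.leadingCoeff *
        ((p.roots.map (fun ρ => Polynomial.X - Polynomial.C ρ)).prod * 1) := by
      rw [mul_one]
      exact hs.eq_prod_roots
    conv_lhs => rw [h1]
    rw [Polynomial.homogenize_C_mul]
    congr 1
    have h2 : N = p.roots.card + (N - p.natDegree) := by omega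
    conv_lhs => rw [h2]
    rw [Polynomial.homogenize_mul _ _ (by simp) (by simp), key]
    simp [linForm, Function.comp_def, MvPolynomial.algebraMap_eq]

end LinearForms

section Points

/-- A monomial with positive exponents attains every value, and nonzero values only at points
with nonzero coordinates. -/
lemma exists_prod_pow_eq {𝕂 : Type} [Field 𝕂] [IsAlgClosed 𝕂] {k : ℕ} (hk : 0 < k)
    {e : Fin k → ℕ} (he : ∀ j, 0 < e j) (c : 𝕂) :
    ∃ t : Fin k → 𝕂, ∏ j, t j ^ e j = c ∧ (c ≠ 0 → ∀ j, t j ≠ 0) := by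
  obtain ⟨z, hz⟩ := IsAlgClosed.exists_pow_nat_eq c (he ⟨0, hk⟩)
  have h : ∏ j, (Function.update (fun _ => (1 : 𝕂)) ⟨0, hk⟩ z) j ^ e j = c := by
    rw [Finset.prod_eq_single ⟨0, hk⟩]
    · simpa using hz
    · intro j _ hj
      simp [Function.update_of_ne hj]
    · simp
  refine ⟨_, h, ?_⟩
  rintro hc j hj
  exact hc (h ▸ Finset.prod_eq_zero (Finset.mem_univ j) (by rw [hj, zero_pow (he j).ne']))

/-- Finitely many nonzero linear forms have a common nonvanishing point. -/
lemma exists_forall_linForm_ne_zero {𝕂 : Type} [Field 𝕂] [Infinite 𝕂] {s : Set (𝕂 × 𝕂)}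
    (hs : s.Finite) (h0 : ∀ v ∈ s, v ≠ 0) :
    ∃ x y : 𝕂, ∀ v ∈ s, linForm x y v ≠ 0 := by
  have hfin : (⋃ v ∈ s, {x : 𝕂 | linForm x 1 v = 0}).Finite := by
    refine hs.biUnion fun v hv => Set.Subsingleton.finite ?_
    intro x hx x' hx'
    simp only [linForm, Set.mem_ofPred_eq, Algebra.algebraMap_self, RingHom.id_apply, mul_one]
      at hx hx'
    have h1 : v.1 ≠ 0 := by
      intro h1
      refine h0 v hv (Prod.ext h1 ?_)
      simpa [h1] using hx
    exact mul_left_cancel₀ h1 (by linear_combination hx - hx')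
  obtain ⟨x, hx⟩ := hfin.exists_notMem
  exact ⟨x, 1, fun v hv h => hx (Set.mem_biUnion hv h)⟩

end Points

section Presentation

/-- Generators `T_{ij}`, `S_k` of an algebra together with elements `x`, `y` such that
`T_i^{l_i}` is the linear form `a_i` in `x`, `y`, and such that every solution of these equations
in the ground field is the value of an algebra homomorphism. -/
structure TrinomialPresentation (𝕂 B : Type) [Field 𝕂] [CommRing B] [Algebra 𝕂 B] (r : ℕ)
    (a : Fin (r+1) → 𝕂 × 𝕂) (n : Fin (r+1) → ℕ) (l : ∀ i : Fin (r+1), Fin (n i) → ℕ)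
    (m : ℕ) where
  /-- The generators `T_{ij}`. -/
  T : Idx r n → B
  /-- The generators `S_k`. -/
  S : Fin m → B
  /-- The first coordinate of the pencil. -/
  x : B
  /-- The second coordinate of the pencil. -/
  y : B
  prod_pow : ∀ i, ∏ j, T ⟨i, j⟩ ^ l i j = linForm x y (a i)
  exists_point : ∀ (t : Idx r n → 𝕂) (s : Fin m → 𝕂) (x₀ y₀ : 𝕂),
    (∀ i, ∏ j, t ⟨i, j⟩ ^ l i j = linForm x₀ y₀ (a i)) →
    ∃ φ : B →ₐ[𝕂] 𝕂, (∀ p, φ (T p) = t p) ∧ (∀ k, φ (S k) = s k) ∧ φ x = x₀ ∧ φ y = y₀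

namespace TrinomialPresentation

variable {𝕂 B : Type} [Field 𝕂] [CommRing B] [Algebra 𝕂 B] {r : ℕ}
  {a : Fin (r+1) → 𝕂 × 𝕂} {n : Fin (r+1) → ℕ} {l : ∀ i : Fin (r+1), Fin (n i) → ℕ} {m : ℕ}

/-- Labels of the graded prime elements: the variables and the linear forms not proportional to
any of the `a_i`. -/
abbrev PrimeLabel (a : Fin (r+1) → 𝕂 × 𝕂) (n : Fin (r+1) → ℕ) (m : ℕ) :=
  (Idx r n ⊕ Fin m) ⊕ {v : 𝕂 × 𝕂 // ∀ i, det2 (a i) v ≠ 0}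

/-- The element of the algebra with a given label. -/
def primeElem (D : TrinomialPresentation 𝕂 B r a n l m) : PrimeLabel a n m → B
  | Sum.inl (Sum.inl p) => D.T p
  | Sum.inl (Sum.inr k) => D.S k
  | Sum.inr v => linForm D.x D.y v.1

/-- There is a point with prescribed `S`-coordinates at which no variable `T_{ij}` and none of
finitely many linear forms vanish. -/
lemma exists_generic_point [IsAlgClosed 𝕂] (D : TrinomialPresentation 𝕂 B r a n l m)
    (hn : ∀ i, 0 < n i) (hl : ∀ i j, 0 < l i j) (ha : ∀ i, a i ≠ 0)
    (s : Fin m → 𝕂) (ms : Multiset (PrimeLabel a n m)) :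
    ∃ φ : B →ₐ[𝕂] 𝕂, (∀ p, φ (D.T p) ≠ 0) ∧ (∀ k, φ (D.S k) = s k) ∧
      ∀ v, Sum.inr v ∈ ms → φ (linForm D.x D.y v.1) ≠ 0 := by
  classical
  have hfin : (Set.range a ∪ {v : 𝕂 × 𝕂 | ∃ w, Sum.inr w ∈ ms ∧ w.1 = v}).Finite := by
    refine (Set.finite_range a).union ?_
    refine ((ms.toFinset.finite_toSet).image
      (fun g : PrimeLabel a n m => Sum.elim (fun _ => (0 : 𝕂 × 𝕂)) Subtype.val g)).subset ?_
    rintro v ⟨w, hw, rfl⟩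
    exact ⟨Sum.inr w, by simpa using hw, rfl⟩
  obtain ⟨x, y, hxy⟩ := exists_forall_linForm_ne_zero hfin (by
    rintro v (⟨i, rfl⟩ | ⟨w, -, rfl⟩)
    · exact ha i
    · intro h
      apply w.2 0
      simp [det2, h])
  choose t ht ht0 using fun i => exists_prod_pow_eq (hn i) (hl i) (linForm x y (a i))
  obtain ⟨φ, h1, h2, h3, h4⟩ := D.exists_point (fun p => t p.1 p.2) s x y ht
  refine ⟨φ, fun p => ?_, h2, fun v hv => ?_⟩
  · rw [h1]
    exact ht0 p.1 (hxy _ (Or.inl ⟨p.1, rfl⟩)) p.2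
  · rw [map_linForm, h3, h4]
    exact hxy _ (Or.inr ⟨v, hv, rfl⟩)

lemma exists_point_primeElem_ne_zero [IsAlgClosed 𝕂] (D : TrinomialPresentation 𝕂 B r a n l m)
    (hn : ∀ i, 0 < n i) (hl : ∀ i j, 0 < l i j) (ha : ∀ i, a i ≠ 0) (g : PrimeLabel a n m) :
    ∃ φ : B →ₐ[𝕂] 𝕂, φ (D.primeElem g) ≠ 0 := by
  obtain ⟨φ, h1, h2, h3⟩ := D.exists_generic_point hn hl ha (fun _ => 1) {g}
  refine ⟨φ, ?_⟩
  rcases g with (p | k) | v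
  · exact h1 p
  · simp [primeElem, h2]
  · exact h3 v (by simp)

/-- The zero set of a labelled element is not covered by the zero sets of finitely many
labelled elements it does not divide. -/
lemma exists_point_of_not_dvd [IsAlgClosed 𝕂] (D : TrinomialPresentation 𝕂 B r a n l m)
    (hn : ∀ i, 0 < n i) (hl : ∀ i j, 0 < l i j)
    (ha : ∀ i k, i ≠ k → det2 (a i) (a k) ≠ 0) (ha0 : ∀ i, a i ≠ 0)
    (g : PrimeLabel a n m) (ms : Multiset (PrimeLabel a n m))
    (h : ∀ g' ∈ ms, ¬ D.primeElem g ∣ D.primeElem g') :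
    ∃ φ : B →ₐ[𝕂] 𝕂, φ (D.primeElem g) = 0 ∧ ∀ g' ∈ ms, φ (D.primeElem g') ≠ 0 := by
  classical
  rcases g with (⟨i, j⟩ | k) | v
  · choose t ht ht0 using fun k =>
      exists_prod_pow_eq (hn k) (hl k) (linForm (-(a i).2) (a i).1 (a k))
    have hv : ∀ v : 𝕂 × 𝕂, linForm (-(a i).2) (a i).1 v = det2 (a i) v := by
      intro v
      simp only [linForm, det2, Algebra.algebraMap_self, RingHom.id_apply]
      ring
    obtain ⟨φ, h1, h2, h3, h4⟩ := D.exists_point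
      (fun p => if p = ⟨i, j⟩ then 0 else if p.1 = i then 1 else t p.1 p.2) (fun _ => 1)
      (-(a i).2) (a i).1 (by
        intro k
        by_cases hk : k = i
        · subst hk
          rw [Finset.prod_eq_zero (Finset.mem_univ j) (by simp [(hl k j).ne']), hv]
          simp [det2]
        · rw [← ht k]
          refine Finset.prod_congr rfl fun j' _ => ?_
          have : (⟨k, j'⟩ : Idx r n) ≠ ⟨i, j⟩ := fun h => hk (congrArg Sigma.fst h)
          simp [this, hk])
    refine ⟨φ, by simp [primeElem, h1], ?_⟩
    rintro ((p | k) | v) hg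
    · have hp : p ≠ ⟨i, j⟩ := by
        rintro rfl
        exact h _ hg dvd_rfl
      simp only [primeElem, h1, if_neg hp]
      split_ifs with hpi
      · exact one_ne_zero
      · refine ht0 p.1 ?_ p.2
        rw [hv]
        exact ha _ _ (Ne.symm hpi)
    · simp [primeElem, h2]
    · simp only [primeElem, map_linForm, h3, h4, hv]
      exact v.2 i
  · obtain ⟨φ, h1, h2, h3⟩ := D.exists_generic_point hn hl ha0
      (fun k' => if k' = k then 0 else 1) ms
    refine ⟨φ, by simp [primeElem, h2], ?_⟩
    rintro ((p | k') | v) hg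
    · exact h1 p
    · have hk : k' ≠ k := by
        rintro rfl
        exact h _ hg dvd_rfl
      simp [primeElem, h2, hk]
    · exact h3 v hg
  · have hv : ∀ w : 𝕂 × 𝕂, linForm (-v.1.2) v.1.1 w = det2 v.1 w := by
      intro w
      simp only [linForm, det2, Algebra.algebraMap_self, RingHom.id_apply]
      ring
    have hv0 : v.1 ≠ 0 := by
      intro h0
      apply v.2 0
      simp [det2, h0]
    choose t ht ht0 using fun k =>
      exists_prod_pow_eq (hn k) (hl k) (linForm (-v.1.2) v.1.1 (a k))
    obtain ⟨φ, h1, h2, h3, h4⟩ := D.exists_point (fun p => t p.1 p.2) (fun _ => 1) _ _ ht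
    refine ⟨φ, ?_, ?_⟩
    · simp only [primeElem, map_linForm, h3, h4, hv]
      simp [det2]
    rintro ((p | k') | w) hg
    · simp only [primeElem, h1]
      refine ht0 p.1 ?_ p.2
      rw [hv]
      intro h0
      apply v.2 p.1
      unfold det2 at h0 ⊢
      linear_combination -h0
    · simp [primeElem, h2]
    · simp only [primeElem, map_linForm, h3, h4, hv]
      intro h0
      obtain ⟨c, hc⟩ := exists_smul_of_det2_eq_zero hv0 h0
      refine h _ hg ?_
      simp only [primeElem, hc, linForm_smul]
      exact dvd_mul_left _ _

/-- The elements which are nonzero scalars times products of labelled elements. -/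
def factored (D : TrinomialPresentation 𝕂 B r a n l m) : Submonoid B where
  carrier := {z | ∃ c : 𝕂, c ≠ 0 ∧ ∃ ms : Multiset (PrimeLabel a n m),
    z = algebraMap 𝕂 B c * (ms.map D.primeElem).prod}
  one_mem' := ⟨1, one_ne_zero, 0, by simp⟩
  mul_mem' := by
    rintro _ _ ⟨c, hc, ms, rfl⟩ ⟨c', hc', ms', rfl⟩
    refine ⟨c * c', mul_ne_zero hc hc', ms + ms', ?_⟩
    rw [Multiset.map_add, Multiset.prod_add, map_mul]
    ring

lemma algebraMap_mem_factored (D : TrinomialPresentation 𝕂 B r a n l m) {c : 𝕂} (hc : c ≠ 0) :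
    algebraMap 𝕂 B c ∈ D.factored :=
  ⟨c, hc, 0, by simp⟩

lemma primeElem_mem_factored (D : TrinomialPresentation 𝕂 B r a n l m) (g : PrimeLabel a n m) :
    D.primeElem g ∈ D.factored :=
  ⟨1, one_ne_zero, {g}, by simp⟩

lemma linForm_mem_factored (D : TrinomialPresentation 𝕂 B r a n l m) (ha0 : ∀ i, a i ≠ 0)
    {v : 𝕂 × 𝕂} (hv : v ≠ 0) : linForm D.x D.y v ∈ D.factored := by
  by_cases h : ∀ i, det2 (a i) v ≠ 0
  · exact D.primeElem_mem_factored (Sum.inr ⟨v, h⟩)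
  · push Not at h
    obtain ⟨i, hi⟩ := h
    obtain ⟨c, rfl⟩ := exists_smul_of_det2_eq_zero (ha0 i) hi
    have hc : c ≠ 0 := by
      rintro rfl
      simp at hv
    rw [linForm_smul, ← D.prod_pow]
    refine mul_mem (D.algebraMap_mem_factored hc) (prod_mem fun j _ => pow_mem ?_ _)
    exact D.primeElem_mem_factored (Sum.inl (Sum.inl ⟨i, j⟩))

lemma aeval_mem_factored [IsAlgClosed 𝕂] (D : TrinomialPresentation 𝕂 B r a n l m)
    (ha0 : ∀ i, a i ≠ 0) {N : ℕ} {q : MvPolynomial (Fin 2) 𝕂} (hq : q.IsHomogeneous N)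
    (h0 : q ≠ 0) : aeval ![D.x, D.y] q ∈ D.factored := by
  obtain ⟨c, hc, vs, hvs, rfl⟩ := exists_prod_linForm hq h0
  rw [map_mul, map_multiset_prod, Multiset.map_map, aeval_C]
  refine mul_mem (D.algebraMap_mem_factored hc) (Submonoid.multiset_prod_mem _ _ ?_)
  intro z hz
  obtain ⟨v, hv, rfl⟩ := Multiset.mem_map.1 hz
  simp only [Function.comp_apply, map_linForm, aeval_X, Matrix.cons_val_zero, Matrix.cons_val_one]
  exact D.linForm_mem_factored ha0 (hvs v hv)

end TrinomialPresentation

end Presentation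

section Grading

variable {r : ℕ} {n : Fin (r+1) → ℕ} {l : ∀ i : Fin (r+1), Fin (n i) → ℕ} {m : ℕ}

lemma exists_coeff_of_mem_rowSpan {v : Idx r n → ℤ} (hv : v ∈ rowSpan r n l) :
    ∃ k : Fin (r+1) → ℤ, ∑ i, k i = 0 ∧ ∀ i j, v ⟨i, j⟩ = k i * l i j := by
  induction hv using AddSubgroup.closure_induction with
  | mem v hv =>
    obtain ⟨i, rfl⟩ := hv
    refine ⟨Pi.single i.succ 1 - Pi.single 0 1, by simp, fun i' j => ?_⟩
    by_cases h0 : i' = 0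
    · subst h0
      simp [Prow, (Fin.succ_ne_zero i).symm]
    · by_cases h1 : i' = i.succ
      · subst h1
        simp [Prow]
      · simp [Prow, h0, h1]
  | zero => exact ⟨0, by simp, by simp⟩
  | add v w _ _ hv hw =>
    obtain ⟨k, hk, hv⟩ := hv
    obtain ⟨k', hk', hw⟩ := hw
    refine ⟨k + k', by simp [Finset.sum_add_distrib, hk, hk'], fun i j => ?_⟩
    simp [hv, hw, add_mul]
  | neg v _ hv =>
    obtain ⟨k, hk, hv⟩ := hv
    exact ⟨-k, by simp [hk], fun i j => by simp [hv]⟩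

lemma weight_wKE (e : IdxE r n m →₀ ℕ) :
    Finsupp.weight (wKE r n l m) e =
      (Qmap r n l (fun p => (e (Sum.inl p) : ℤ)), fun k => (e (Sum.inr k) : ℤ)) := by
  rw [Finsupp.weight_eq_sum, Fintype.sum_sum_type]
  have h1 : ∑ p, e (Sum.inl p) • wKE r n l m (Sum.inl p) =
      (Qmap r n l (fun p => (e (Sum.inl p) : ℤ)), 0) := by
    have h : (fun p => (e (Sum.inl p) : ℤ)) =
        ∑ p, e (Sum.inl p) • (Pi.single p (1 : ℤ) : Idx r n → ℤ) := by
      funext p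
      simp [Finset.sum_apply, Pi.single_apply]
    rw [h, map_sum]
    refine Prod.ext ?_ ?_
    · rw [Prod.fst_sum]
      refine Finset.sum_congr rfl fun p _ => ?_
      rw [map_nsmul]
      rfl
    · rw [Prod.snd_sum]
      exact Finset.sum_eq_zero fun p _ => by simp [wKE]
  have h2 : ∑ k, e (Sum.inr k) • wKE r n l m (Sum.inr k) =
      (0, fun k => (e (Sum.inr k) : ℤ)) := by
    refine Prod.ext ?_ ?_
    · rw [Prod.fst_sum]
      exact Finset.sum_eq_zero fun p _ => by simp [wKE]
    · rw [Prod.snd_sum]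
      funext k
      simp [wKE, Finset.sum_apply, Pi.single_apply]
  rw [h1, h2, Prod.mk_add_mk, add_zero, zero_add]

/-- Exponents of equal degree differ by a combination of the exponents `l_i` with total
coefficient zero. -/
lemma exists_coeff_of_weight_eq {e e' : IdxE r n m →₀ ℕ}
    (h : Finsupp.weight (wKE r n l m) e = Finsupp.weight (wKE r n l m) e') :
    (∀ k, e (Sum.inr k) = e' (Sum.inr k)) ∧
      ∃ k : Fin (r+1) → ℤ, ∑ i, k i = 0 ∧
        ∀ i j, (e (Sum.inl ⟨i, j⟩) : ℤ) = e' (Sum.inl ⟨i, j⟩) + k i * l i j := by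
  rw [weight_wKE, weight_wKE, Prod.ext_iff] at h
  obtain ⟨h1, h2⟩ := h
  refine ⟨fun k => by simpa using congrFun h2 k, ?_⟩
  obtain ⟨k, hk, hv⟩ := exists_coeff_of_mem_rowSpan (QuotientAddGroup.eq.1 h1.symm)
  refine ⟨k, hk, fun i j => ?_⟩
  have := hv i j
  simp only [Pi.add_apply, Pi.neg_apply] at this
  linarith

lemma eq_zero_of_weight_eq_zero (hn : ∀ i, 0 < n i) (hl : ∀ i j, 0 < l i j)
    {e : IdxE r n m →₀ ℕ} (h : Finsupp.weight (wKE r n l m) e = 0) : e = 0 := by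
  have h' : Finsupp.weight (wKE r n l m) e = Finsupp.weight (wKE r n l m) (0 : IdxE r n m →₀ ℕ) := by
    rw [h, map_zero]
  obtain ⟨h1, k, hk, h2⟩ := exists_coeff_of_weight_eq h'
  simp only [Finsupp.coe_zero, Pi.zero_apply, Nat.cast_zero, zero_add] at h1 h2
  have hk0 : ∀ i, 0 ≤ k i := by
    intro i
    have h3 := h2 i ⟨0, hn i⟩
    have h4 : (0 : ℤ) < l i ⟨0, hn i⟩ := by exact_mod_cast hl i _
    by_contra! h5
    have : k i * (l i ⟨0, hn i⟩ : ℤ) < 0 := mul_neg_of_neg_of_pos h5 h4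
    omega
  have hk1 : ∀ i, k i = 0 := fun i =>
    (Finset.sum_eq_zero_iff_of_nonneg fun i _ => hk0 i).1 hk i (Finset.mem_univ i)
  ext (⟨i, j⟩ | k')
  · have := h2 i j
    rw [hk1, zero_mul] at this
    exact_mod_cast this
  · exact h1 k'

/-- The largest power of `T_i^{l_i}` dividing a monomial. -/
def blockQuot (hn : ∀ i, 0 < n i) (l : ∀ i : Fin (r+1), Fin (n i) → ℕ)
    (e : IdxE r n m →₀ ℕ) (i : Fin (r+1)) : ℕ :=
  Finset.univ.inf' ⟨⟨0, hn i⟩, Finset.mem_univ _⟩ fun j => e (Sum.inl ⟨i, j⟩) / l i j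

lemma blockQuot_mul_le (hn : ∀ i, 0 < n i) (e : IdxE r n m →₀ ℕ) (i : Fin (r+1))
    (j : Fin (n i)) : blockQuot hn l e i * l i j ≤ e (Sum.inl ⟨i, j⟩) :=
  (Nat.mul_le_mul_right _ (Finset.inf'_le _ (Finset.mem_univ j))).trans (Nat.div_mul_le_self _ _)

lemma blockQuot_eq_add (hn : ∀ i, 0 < n i) (hl : ∀ i j, 0 < l i j)
    {e e' : IdxE r n m →₀ ℕ} {i : Fin (r+1)} {k : ℕ}
    (h : ∀ j, e (Sum.inl ⟨i, j⟩) = e' (Sum.inl ⟨i, j⟩) + k * l i j) :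
    blockQuot hn l e i = blockQuot hn l e' i + k := by
  have h1 : ∀ j, e (Sum.inl ⟨i, j⟩) / l i j = e' (Sum.inl ⟨i, j⟩) / l i j + k := fun j => by
    rw [h, Nat.add_mul_div_right _ _ (hl i j)]
  unfold blockQuot
  simp only [h1]
  refine le_antisymm ?_ ?_
  · obtain ⟨j, hj, hj'⟩ := Finset.exists_mem_eq_inf' (s := Finset.univ)
      ⟨⟨0, hn i⟩, Finset.mem_univ _⟩ fun j => e' (Sum.inl ⟨i, j⟩) / l i j
    rw [hj']
    exact Finset.inf'_le (fun j => e' (Sum.inl ⟨i, j⟩) / l i j + k) hj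
  · exact Finset.le_inf' _ _ fun j hj => Nat.add_le_add_right (Finset.inf'_le _ hj) k

lemma blockQuot_of_weight_eq (hn : ∀ i, 0 < n i) (hl : ∀ i j, 0 < l i j)
    {e e' : IdxE r n m →₀ ℕ}
    (h : Finsupp.weight (wKE r n l m) e = Finsupp.weight (wKE r n l m) e') :
    ∑ i, blockQuot hn l e i = ∑ i, blockQuot hn l e' i ∧
      ∀ i j, e (Sum.inl ⟨i, j⟩) =
        (e' (Sum.inl ⟨i, j⟩) - blockQuot hn l e' i * l i j) + blockQuot hn l e i * l i j := by
  obtain ⟨-, k, hk, h2⟩ := exists_coeff_of_weight_eq h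
  have h3 : ∀ i, (blockQuot hn l e i : ℤ) = blockQuot hn l e' i + k i := by
    intro i
    obtain ⟨c, hc | hc⟩ := Int.eq_nat_or_neg (k i)
    · rw [hc, blockQuot_eq_add hn hl (k := c) (e' := e')]
      · push_cast; rfl
      · intro j
        have := h2 i j
        rw [hc] at this
        exact_mod_cast this
    · rw [hc, blockQuot_eq_add hn hl (k := c) (e := e') (e' := e)]
      · push_cast; ring
      · intro j
        have := h2 i j
        rw [hc] at this
        zify
        linarith
  constructor
  · zify
    simp only [h3, Finset.sum_add_distrib, hk, add_zero]
  · intro i j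
    have h4 := h2 i j
    have h5 := blockQuot_mul_le (l := l) hn e' i j
    zify [h5]
    rw [h4, h3]
    ring

namespace TrinomialPresentation

variable {𝕂 B : Type} [Field 𝕂] [CommRing B] [Algebra 𝕂 B] {a : Fin (r+1) → 𝕂 × 𝕂}

/-- The evaluation of polynomials in the variables at the generators. -/
noncomputable def eval (D : TrinomialPresentation 𝕂 B r a n l m) :
    MvPolynomial (IdxE r n m) 𝕂 →ₐ[𝕂] B := aeval (Sum.elim D.T D.S)

/-- Nonzero homogeneous elements are scalars times products of labelled elements. -/
lemma eval_mem_factored [IsAlgClosed 𝕂] (D : TrinomialPresentation 𝕂 B r a n l m)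
    (hn : ∀ i, 0 < n i) (hl : ∀ i j, 0 < l i j) (ha0 : ∀ i, a i ≠ 0)
    {p : MvPolynomial (IdxE r n m) 𝕂} {d : KgrpE r n l m}
    (hp : p.IsWeightedHomogeneous (wKE r n l m) d) (h0 : D.eval p ≠ 0) :
    D.eval p ∈ D.factored := by
  have hp0 : p ≠ 0 := by
    rintro rfl
    simp at h0
  obtain ⟨e₀, he₀⟩ := ne_zero_iff.1 hp0
  set N := ∑ i, blockQuot hn l e₀ i with hN
  have hw : ∀ e ∈ p.support,
      Finsupp.weight (wKE r n l m) e = Finsupp.weight (wKE r n l m) e₀ := fun e he =>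
    (hp (mem_support_iff.1 he)).trans (hp he₀).symm
  let M : B := (∏ i, ∏ j, D.T ⟨i, j⟩ ^ (e₀ (Sum.inl ⟨i, j⟩) - blockQuot hn l e₀ i * l i j)) *
    ∏ k, D.S k ^ e₀ (Sum.inr k)
  let q : MvPolynomial (Fin 2) 𝕂 := ∑ e ∈ p.support,
    C (p.coeff e) * ∏ i, linForm (X 0) (X 1) (a i) ^ blockQuot hn l e i
  have hlin : ∀ v : 𝕂 × 𝕂, (linForm (X 0 : MvPolynomial (Fin 2) 𝕂) (X 1) v).IsHomogeneous 1 :=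
    fun v => ((isHomogeneous_X _ _).C_mul _).add ((isHomogeneous_X _ _).C_mul _)
  have hq : q.IsHomogeneous N := by
    refine IsHomogeneous.sum _ _ _ fun e he => IsHomogeneous.C_mul ?_ _
    rw [hN, ← (blockQuot_of_weight_eq hn hl (hw e he)).1]
    exact IsHomogeneous.prod _ _ _ fun i _ => by simpa using (hlin (a i)).pow (blockQuot hn l e i)
  have hM : M ∈ D.factored :=
    mul_mem (prod_mem fun i _ => prod_mem fun j _ => pow_mem
      (D.primeElem_mem_factored (Sum.inl (Sum.inl ⟨i, j⟩))) _)
      (prod_mem fun k _ => pow_mem (D.primeElem_mem_factored (Sum.inl (Sum.inr k))) _)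
  have hpq : D.eval p = M * aeval ![D.x, D.y] q := by
    conv_lhs => rw [p.as_sum]
    simp only [q, map_sum, map_mul, map_prod, map_pow, Finset.mul_sum]
    refine Finset.sum_congr rfl fun e he => ?_
    have h1 := (blockQuot_of_weight_eq hn hl (hw e he)).2
    have h2 := (exists_coeff_of_weight_eq (hw e he)).1
    have h3 : ∏ i, ∏ j, D.T ⟨i, j⟩ ^ e (Sum.inl ⟨i, j⟩) =
        (∏ i, ∏ j, D.T ⟨i, j⟩ ^ (e₀ (Sum.inl ⟨i, j⟩) - blockQuot hn l e₀ i * l i j)) *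
          ∏ i, linForm D.x D.y (a i) ^ blockQuot hn l e i := by
      rw [← Finset.prod_mul_distrib]
      refine Finset.prod_congr rfl fun i _ => ?_
      rw [← D.prod_pow, ← Finset.prod_pow, ← Finset.prod_mul_distrib]
      refine Finset.prod_congr rfl fun j _ => ?_
      rw [h1, pow_add, mul_comm (blockQuot hn l e i), pow_mul]
    have h4 : D.eval (monomial e (p.coeff e)) = algebraMap 𝕂 B (p.coeff e) *
        ((∏ i, ∏ j, D.T ⟨i, j⟩ ^ e (Sum.inl ⟨i, j⟩)) * ∏ k, D.S k ^ e (Sum.inr k)) := by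
      rw [eval, aeval_monomial, Finsupp.prod_fintype _ _ (fun _ => pow_zero _),
        Fintype.prod_sum_type, Fintype.prod_sigma]
      rfl
    rw [h4, h3]
    simp only [M, h2, map_linForm, aeval_X, aeval_C, Matrix.cons_val_zero, Matrix.cons_val_one]
    ring
  rw [hpq] at h0 ⊢
  refine mul_mem hM (D.aeval_mem_factored ha0 hq ?_)
  intro hq0
  simp [hq0] at h0

end TrinomialPresentation

end Grading

section Dimension

/-- The Krull dimension is invariant under injective integral extensions. -/
lemma ringKrullDim_eq_of_isIntegral_of_injective {R S : Type} [CommRing R] [CommRing S]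
    [Algebra R S] [Algebra.IsIntegral R S] (h : Function.Injective (algebraMap R S)) :
    ringKrullDim S = ringKrullDim R := by
  refine le_antisymm ?_ ?_
  · refine Order.krullDim_le_of_strictMono (PrimeSpectrum.comap (algebraMap R S)) ?_
    intro P Q hPQ
    exact Ideal.IsIntegral.comap_lt_comap (R := R) (I := P.asIdeal) (J := Q.asIdeal) hPQ
  · refine iSup_le fun s => ?_
    obtain ⟨P, -, hP, hPs⟩ := Ideal.exists_ideal_over_prime_of_isIntegral (S := S)
      s.head.asIdeal ⊥ (by
        rw [← RingHom.ker_eq_comap_bot, (RingHom.injective_iff_ker_eq_bot _).1 h]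
        exact bot_le)
    have : P.LiesOver s.head.asIdeal := ⟨hPs.symm⟩
    obtain ⟨L, hL, -⟩ := Ideal.exists_ltSeries_of_hasGoingUp s P
    rw [← hL]
    exact Order.LTSeries.length_le_krullDim L

/-- The polynomial `∏ (Z + v_j)^{e_j} - c` in one variable `Z`. -/
noncomputable def shiftPoly {A : Type} [CommRing A] {k : ℕ} (e : Fin k → ℕ) (v : Fin k → A)
    (c : A) : Polynomial A :=
  ∏ j, (Polynomial.X + Polynomial.C (v j)) ^ e j - Polynomial.C c

lemma degree_prod_pos {A : Type} [CommRing A] [Nontrivial A] {k : ℕ} (hk : 0 < k)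
    {e : Fin k → ℕ} (he : ∀ j, 0 < e j) (v : Fin k → A) :
    0 < (∏ j, (Polynomial.X + Polynomial.C (v j)) ^ e j).degree := by
  have hm : ∀ j ∈ (Finset.univ : Finset (Fin k)),
      ((Polynomial.X + Polynomial.C (v j)) ^ e j).Monic := fun j _ =>
    (Polynomial.monic_X_add_C _).pow _
  rw [← Polynomial.natDegree_pos_iff_degree_pos, Polynomial.natDegree_prod_of_monic _ _ hm]
  refine Finset.sum_pos (fun j _ => ?_) ⟨⟨0, hk⟩, Finset.mem_univ _⟩
  rw [(Polynomial.monic_X_add_C (v j)).natDegree_pow, Polynomial.natDegree_X_add_C, mul_one]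
  exact he j

lemma monic_shiftPoly {A : Type} [CommRing A] [Nontrivial A] {k : ℕ} (hk : 0 < k)
    {e : Fin k → ℕ} (he : ∀ j, 0 < e j) (v : Fin k → A) (c : A) : (shiftPoly e v c).Monic :=
  (Polynomial.monic_prod_of_monic _ _ fun _ _ => (Polynomial.monic_X_add_C _).pow _).sub_of_left
    (Polynomial.degree_C_le.trans_lt (degree_prod_pos hk he v))

lemma degree_shiftPoly_pos {A : Type} [CommRing A] [Nontrivial A] {k : ℕ} (hk : 0 < k)
    {e : Fin k → ℕ} (he : ∀ j, 0 < e j) (v : Fin k → A) (c : A) :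
    0 < (shiftPoly e v c).degree := by
  unfold shiftPoly
  rw [Polynomial.degree_sub_eq_left_of_degree_lt
    (Polynomial.degree_C_le.trans_lt (degree_prod_pos hk he v))]
  exact degree_prod_pos hk he v

lemma eval₂_shiftPoly {A B : Type} [CommRing A] [CommRing B] (f : A →+* B) {k : ℕ} (e : Fin k → ℕ)
    (v : Fin k → A) (c : A) (z : B) :
    (shiftPoly e v c).eval₂ f z = ∏ j, (z + f (v j)) ^ e j - f c := by
  simp [shiftPoly, Polynomial.eval₂_sub, Polynomial.eval₂_finsetProd, Polynomial.eval₂_pow]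

/-- The indices `(i, j)` with `j` different from the first index. -/
abbrev FreeIdx (r : ℕ) (n : Fin (r+1) → ℕ) := {p : Idx r n // (p.2 : ℕ) ≠ 0}

lemma card_freeIdx_add {r : ℕ} {n : Fin (r+1) → ℕ} (hn : ∀ i, 0 < n i) :
    Fintype.card (FreeIdx r n) + (r + 1) = Fintype.card (Idx r n) := by
  have e : {p : Idx r n // (p.2 : ℕ) = 0} ≃ Fin (r+1) :=
    { toFun := fun p => p.1.1
      invFun := fun i => ⟨⟨i, ⟨0, hn i⟩⟩, rfl⟩
      left_inv := by
        rintro ⟨⟨i, j⟩, hj⟩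
        have : j = ⟨0, hn i⟩ := Fin.ext hj
        subst this
        rfl
      right_inv := fun i => rfl }
  have h := Fintype.card_subtype_compl (fun p : Idx r n => (p.2 : ℕ) = 0)
  have h2 := Fintype.card_congr e
  have h3 := Fintype.card_subtype_le (fun p : Idx r n => (p.2 : ℕ) = 0)
  rw [Fintype.card_fin] at h2
  have h4 : Fintype.card (FreeIdx r n) =
      Fintype.card {p : Idx r n // ¬ (p.2 : ℕ) = 0} := rfl
  omega

namespace TrinomialPresentation

variable {r : ℕ} {n : Fin (r+1) → ℕ} {l : ∀ i : Fin (r+1), Fin (n i) → ℕ} {m : ℕ}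
  {𝕂 B : Type} [Field 𝕂] [CommRing B] [Algebra 𝕂 B] {a : Fin (r+1) → 𝕂 × 𝕂}

/-- Noether normalization: the variables go to `x`, `y`, to the differences `T_{ij} - T_{i1}`
and to the `S_k`. -/
noncomputable def noether (D : TrinomialPresentation 𝕂 B r a n l m) (hn : ∀ i, 0 < n i) :
    MvPolynomial (Fin 2 ⊕ FreeIdx r n ⊕ Fin m) 𝕂 →ₐ[𝕂] B :=
  aeval (Sum.elim ![D.x, D.y]
    (Sum.elim (fun p => D.T p.1 - D.T ⟨p.1.1, ⟨0, hn _⟩⟩) D.S))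

/-- The variable belonging to the difference `T_{ij} - T_{i1}`. -/
noncomputable def shiftVar (𝕂 : Type) [Field 𝕂] (r : ℕ) (n : Fin (r+1) → ℕ) (m : ℕ)
    (i : Fin (r+1)) (j : Fin (n i)) : MvPolynomial (Fin 2 ⊕ FreeIdx r n ⊕ Fin m) 𝕂 :=
  if h : (j : ℕ) ≠ 0 then X (Sum.inr (Sum.inl ⟨⟨i, j⟩, h⟩)) else 0

lemma noether_shiftVar (D : TrinomialPresentation 𝕂 B r a n l m) (hn : ∀ i, 0 < n i)
    (i : Fin (r+1)) (j : Fin (n i)) :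
    D.noether hn (shiftVar 𝕂 r n m i j) = D.T ⟨i, j⟩ - D.T ⟨i, ⟨0, hn i⟩⟩ := by
  unfold shiftVar
  split_ifs with h
  · simp [noether]
  · have : j = ⟨0, hn i⟩ := Fin.ext (by simpa using h)
    subst this
    simp

lemma injective_noether [IsAlgClosed 𝕂] (D : TrinomialPresentation 𝕂 B r a n l m)
    (hn : ∀ i, 0 < n i) (hl : ∀ i j, 0 < l i j) : Function.Injective (D.noether hn) := by
  rw [injective_iff_map_eq_zero]
  intro F hF
  refine MvPolynomial.funext fun v => ?_
  rw [map_zero]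
  set x₀ := v (Sum.inl 0)
  set y₀ := v (Sum.inl 1)
  have hroot : ∀ i, ∃ z : 𝕂,
      ∏ j, (z + aeval v (shiftVar 𝕂 r n m i j)) ^ l i j = linForm x₀ y₀ (a i) := by
    intro i
    obtain ⟨z, hz⟩ := IsAlgClosed.exists_root
      (shiftPoly (l i) (fun j => aeval v (shiftVar 𝕂 r n m i j)) (linForm x₀ y₀ (a i)))
      (degree_shiftPoly_pos (hn i) (hl i) _ _).ne'
    refine ⟨z, ?_⟩
    rw [Polynomial.IsRoot, Polynomial.eval, eval₂_shiftPoly] at hz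
    exact sub_eq_zero.1 hz
  choose z hz using hroot
  obtain ⟨φ, h1, h2, h3, h4⟩ := D.exists_point
    (fun p => z p.1 + aeval v (shiftVar 𝕂 r n m p.1 p.2)) (fun k => v (Sum.inr (Sum.inr k)))
    x₀ y₀ hz
  have hcomp : φ.comp (D.noether hn) = aeval v := by
    refine MvPolynomial.algHom_ext fun g => ?_
    rcases g with g | p | k
    · fin_cases g
      · simp [noether, h3, x₀]
      · simp [noether, h4, y₀]
    · simp [noether, h1, shiftVar, p.2]
    · simp [noether, h2]
  have h := congrArg φ hF
  rw [map_zero, ← AlgHom.comp_apply, hcomp] at h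
  simpa [aeval_def] using h

lemma isIntegral_noether (D : TrinomialPresentation 𝕂 B r a n l m)
    (hn : ∀ i, 0 < n i) (hl : ∀ i j, 0 < l i j)
    (hgen : Function.Surjective (D.eval)) :
    (D.noether hn).toRingHom.IsIntegral := by
  have hT0 : ∀ i, (D.noether hn).toRingHom.IsIntegralElem (D.T ⟨i, ⟨0, hn i⟩⟩) := by
    intro i
    refine ⟨_, monic_shiftPoly (hn i) (hl i) (shiftVar 𝕂 r n m i)
      (linForm (X (Sum.inl 0)) (X (Sum.inl 1)) (a i)), ?_⟩
    rw [eval₂_shiftPoly]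
    have h : ∀ j, D.T ⟨i, ⟨0, hn i⟩⟩ + (D.noether hn).toRingHom (shiftVar 𝕂 r n m i j) =
        D.T ⟨i, j⟩ := fun j => by
      have := D.noether_shiftVar hn i j
      rw [AlgHom.toRingHom_eq_coe, RingHom.coe_coe, this]
      ring
    simp only [h, D.prod_pow]
    rw [AlgHom.toRingHom_eq_coe, RingHom.coe_coe, map_linForm]
    simp [noether]
  have hT : ∀ p, (D.noether hn).toRingHom.IsIntegralElem (D.T p) := by
    rintro ⟨i, j⟩
    have h : D.T ⟨i, j⟩ = D.noether hn (shiftVar 𝕂 r n m i j) + D.T ⟨i, ⟨0, hn i⟩⟩ := by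
      rw [noether_shiftVar]
      ring
    rw [h]
    exact RingHom.IsIntegralElem.add _ (RingHom.isIntegralElem_map _) (hT0 i)
  have hS : ∀ k, (D.noether hn).toRingHom.IsIntegralElem (D.S k) := by
    intro k
    have h : D.S k = (D.noether hn).toRingHom (X (Sum.inr (Sum.inr k))) := by simp [noether]
    rw [h]
    exact RingHom.isIntegralElem_map _
  intro b
  obtain ⟨p, rfl⟩ := hgen b
  induction p using MvPolynomial.induction_on with
  | C c =>
    have h : D.eval (C c) = (D.noether hn).toRingHom (C c) := by simp [eval, noether]
    rw [h]
    exact RingHom.isIntegralElem_map _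
  | add p q hp hq =>
    rw [map_add]
    exact RingHom.IsIntegralElem.add _ hp hq
  | mul_X p g hp =>
    rw [map_mul]
    refine RingHom.IsIntegralElem.mul _ hp ?_
    rcases g with g | g
    · simpa [eval] using hT g
    · simpa [eval] using hS g

lemma ringKrullDim_eq [IsAlgClosed 𝕂] (D : TrinomialPresentation 𝕂 B r a n l m)
    (hn : ∀ i, 0 < n i) (hl : ∀ i j, 0 < l i j) (hgen : Function.Surjective (D.eval)) :
    ringKrullDim B = ((Fintype.card (FreeIdx r n) + 1 + m + 1 : ℕ) : WithBot ℕ∞) := by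
  let _ := (D.noether hn).toRingHom.toAlgebra
  have : Algebra.IsIntegral (MvPolynomial (Fin 2 ⊕ FreeIdx r n ⊕ Fin m) 𝕂) B :=
    ⟨D.isIntegral_noether hn hl hgen⟩
  rw [ringKrullDim_eq_of_isIntegral_of_injective
    (R := MvPolynomial (Fin 2 ⊕ FreeIdx r n ⊕ Fin m) 𝕂) (D.injective_noether hn hl),
    MvPolynomial.ringKrullDim_of_isNoetherianRing, ringKrullDim_eq_zero_of_field, zero_add,
    Nat.card_eq_fintype_card, Fintype.card_sum, Fintype.card_sum, Fintype.card_fin,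
    Fintype.card_fin]
  have h : Fintype.card (FreeIdx r n) + 1 + m + 1 = 2 + (Fintype.card (FreeIdx r n) + m) := by
    omega
  rw [h]

end TrinomialPresentation

end Dimension

section GradingGroup

variable {r : ℕ} {n : Fin (r+1) → ℕ} {l : ∀ i : Fin (r+1), Fin (n i) → ℕ} {m : ℕ}

lemma Qmap_surjective : Function.Surjective (Qmap r n l) :=
  QuotientAddGroup.mk'_surjective _

/-- The degrees of the variables generate the grading group. -/
lemma closure_range_wKE : AddSubgroup.closure (Set.range (wKE r n l m)) = ⊤ := by
  rw [eq_top_iff]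
  rintro ⟨q, w⟩ -
  obtain ⟨v, rfl⟩ := Qmap_surjective q
  have h1 : ((Qmap r n l v, w) : KgrpE r n l m) =
      ∑ p, v p • wKE r n l m (Sum.inl p) + ∑ k, w k • wKE r n l m (Sum.inr k) := by
    refine Prod.ext ?_ ?_
    · rw [Prod.fst_add, Prod.fst_sum, Prod.fst_sum]
      simp only [wKE, wK, Prod.smul_fst, smul_zero, Finset.sum_const_zero, add_zero]
      rw [← Finset.univ_sum_single v, map_sum, Finset.univ_sum_single]
      refine Finset.sum_congr rfl fun p _ => ?_
      rw [← map_zsmul, ← Pi.single_smul]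
      simp
    · rw [Prod.snd_add, Prod.snd_sum, Prod.snd_sum]
      simp only [wKE, Prod.smul_snd, smul_zero, Finset.sum_const_zero, zero_add]
      conv_lhs => rw [← Finset.univ_sum_single w]
      refine Finset.sum_congr rfl fun p _ => ?_
      rw [← Pi.single_smul]
      simp
  rw [h1]
  exact add_mem
    (sum_mem fun p _ => zsmul_mem (AddSubgroup.subset_closure (Set.mem_range_self _)) _)
    (sum_mem fun p _ => zsmul_mem (AddSubgroup.subset_closure (Set.mem_range_self _)) _)

lemma linearIndependent_Prow (hn : ∀ i, 0 < n i) (hl : ∀ i j, 0 < l i j) :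
    LinearIndependent ℤ (Prow r n l) := by
  rw [Fintype.linearIndependent_iff]
  intro g hg i
  have h := congrFun hg ⟨i.succ, ⟨0, hn _⟩⟩
  rw [Finset.sum_apply, Finset.sum_eq_single i] at h
  · simpa [Prow, (hl _ _).ne'] using h
  · intro k _ hk
    simp [Prow, hk.symm]
  · simp

lemma finrank_Kgrp_add (hn : ∀ i, 0 < n i) (hl : ∀ i j, 0 < l i j) :
    Module.finrank ℤ (Kgrp r n l) + r = Fintype.card (Idx r n) := by
  have hsurj : Function.Surjective (Qmap r n l).toIntLinearMap := Qmap_surjective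
  have hfin : Module.Finite ℤ (Kgrp r n l) := Module.Finite.of_surjective _ hsurj
  have hker : LinearMap.ker (Qmap r n l).toIntLinearMap =
      Submodule.span ℤ (Set.range (Prow r n l)) := by
    apply Submodule.toAddSubgroup_injective
    rw [Submodule.span_int_eq_addSubgroupClosure]
    ext v
    simp only [Submodule.mem_toAddSubgroup, LinearMap.mem_ker, AddMonoidHom.coe_toIntLinearMap]
    exact QuotientAddGroup.eq_zero_iff v
  have h := LinearMap.rank_eq_of_surjective hsurj
  rw [hker, rank_span (linearIndependent_Prow hn hl),
    Cardinal.mk_range_eq _ (linearIndependent_Prow hn hl).injective, Cardinal.mk_fin,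
    ← Module.finrank_eq_rank ℤ (Kgrp r n l), rank_fun'] at h
  exact_mod_cast h.symm

/-- The rank of the grading group. -/
lemma rank_KgrpE (hn : ∀ i, 0 < n i) (hl : ∀ i j, 0 < l i j) :
    Module.rank ℤ (KgrpE r n l m) =
      ((Fintype.card (FreeIdx r n) + 1 + m : ℕ) : Cardinal) := by
  have hfin : Module.Finite ℤ (Kgrp r n l) :=
    Module.Finite.of_surjective (Qmap r n l).toIntLinearMap Qmap_surjective
  have h := LinearMap.rank_eq_of_surjective
    (f := LinearMap.fst ℤ (Kgrp r n l) (Fin m → ℤ)) LinearMap.fst_surjective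
  rw [LinearMap.ker_fst, rank_range_of_injective _ LinearMap.inr_injective,
    ← Module.finrank_eq_rank ℤ (Kgrp r n l), rank_fun', Fintype.card_fin] at h
  have h1 := finrank_Kgrp_add hn hl
  have h2 := card_freeIdx_add hn
  have h3 : Module.finrank ℤ (Kgrp r n l) = Fintype.card (FreeIdx r n) + 1 := by omega
  rw [h, h3]
  push_cast
  rfl

end GradingGroup

section Concrete

/-- Elements satisfying the trinomial relations are linear forms in two elements. -/
lemma eq_linForm_of_trinomial {𝕂 B : Type} [Field 𝕂] [CommRing B] [Algebra 𝕂 B] {r : ℕ}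
    {a : Fin (r+1) → 𝕂 × 𝕂} (ha : ∀ i k, i ≠ k → det2 (a i) (a k) ≠ 0) {i₀ i₁ : Fin (r+1)}
    (h0 : (i₀ : ℕ) = 0) (h1 : (i₁ : ℕ) = 1) (U : Fin (r+1) → B)
    (hU : ∀ i j k : Fin (r+1), (j : ℕ) = i + 1 → (k : ℕ) = i + 2 →
      algebraMap 𝕂 B (det2 (a j) (a k)) * U i + algebraMap 𝕂 B (det2 (a k) (a i)) * U j +
        algebraMap 𝕂 B (det2 (a i) (a j)) * U k = 0) (i : Fin (r+1)) :
    U i = linForm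
      (algebraMap 𝕂 B ((det2 (a i₀) (a i₁))⁻¹ * (a i₁).2) * U i₀ -
        algebraMap 𝕂 B ((det2 (a i₀) (a i₁))⁻¹ * (a i₀).2) * U i₁)
      (algebraMap 𝕂 B ((det2 (a i₀) (a i₁))⁻¹ * (a i₀).1) * U i₁ -
        algebraMap 𝕂 B ((det2 (a i₀) (a i₁))⁻¹ * (a i₁).1) * U i₀) (a i) := by
  have h01 : i₀ ≠ i₁ := fun h => by
    rw [h, h1] at h0
    omega
  have hd : algebraMap 𝕂 B (det2 (a i₀) (a i₁))⁻¹ * algebraMap 𝕂 B (det2 (a i₀) (a i₁)) = 1 := by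
    rw [← map_mul, inv_mul_cancel₀ (ha _ _ h01), map_one]
  generalize (det2 (a i₀) (a i₁))⁻¹ = d at hd ⊢
  induction hi : (i : ℕ) using Nat.strong_induction_on generalizing i with
  | _ N ih =>
    simp only [linForm, map_mul, det2, map_sub] at hd hU ih ⊢
    rcases N with _ | _ | N
    · obtain rfl : i = i₀ := Fin.ext (by omega)
      linear_combination -(U i) * hd
    · obtain rfl : i = i₁ := Fin.ext (by omega)
      linear_combination -(U i) * hd
    · have hlt := i.2
      set j : Fin (r+1) := ⟨N, by omega⟩
      set k : Fin (r+1) := ⟨N + 1, by omega⟩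
      have hj := ih N (by omega) j rfl
      have hk := ih (N + 1) (by omega) k rfl
      have h := hU j k i rfl hi
      have hu : IsUnit (algebraMap 𝕂 B (det2 (a j) (a k))) :=
        (IsUnit.mk0 _ (ha _ _ (by simp [j, k, Fin.ext_iff]))).map _
      rw [← hu.mul_right_inj]
      simp only [det2, map_sub, map_mul]
      rw [hj, hk] at h
      linear_combination h

variable (𝕂 : Type) [Field 𝕂] {r : ℕ} (a : Fin (r+1) → 𝕂 × 𝕂) (n : Fin (r+1) → ℕ)
  (l : ∀ i : Fin (r+1), Fin (n i) → ℕ) (m : ℕ)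

/-- The monomial `T_i^{l_i}` in the polynomial ring with the variables `S_k` adjoined. -/
noncomputable def monoE (i : Fin (r+1)) : MvPolynomial (IdxE r n m) 𝕂 :=
  rename Sum.inl (mono 𝕂 r n l i)

/-- The polynomial `c T_i^{l_i} - c' T_k^{l_k}`. -/
noncomputable def binomE (i k : Fin (r+1)) (c c' : 𝕂) : MvPolynomial (IdxE r n m) 𝕂 :=
  C c * monoE 𝕂 n l m i - C c' * monoE 𝕂 n l m k

variable {𝕂 a n l m}

lemma monoE_eq (i : Fin (r+1)) :
    monoE 𝕂 n l m i = ∏ j, (X (Sum.inl ⟨i, j⟩) : MvPolynomial (IdxE r n m) 𝕂) ^ l i j := by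
  simp [monoE, mono, map_prod]

lemma mk_monoE_eq (i : Fin (r+1)) :
    Ideal.Quotient.mk (relIdealE 𝕂 r a n l m) (monoE 𝕂 n l m i) =
      ∏ j, Ideal.Quotient.mk (relIdealE 𝕂 r a n l m) (X (Sum.inl ⟨i, j⟩)) ^ l i j := by
  simp [monoE_eq, map_prod]

/-- A point of the plane is determined by the values of two independent linear forms. -/
lemma det2_inv_mul_linForm {v w : 𝕂 × 𝕂} (h : det2 v w ≠ 0) (x y : 𝕂) :
    (det2 v w)⁻¹ * w.2 * linForm x y v - (det2 v w)⁻¹ * v.2 * linForm x y w = x ∧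
      (det2 v w)⁻¹ * v.1 * linForm x y w - (det2 v w)⁻¹ * w.1 * linForm x y v = y := by
  simp only [linForm, Algebra.algebraMap_self, RingHom.id_apply]
  constructor
  · rw [mul_assoc, mul_assoc, ← mul_sub, inv_mul_eq_iff_eq_mul₀ h]
    unfold det2
    ring
  · rw [mul_assoc, mul_assoc, ← mul_sub, inv_mul_eq_iff_eq_mul₀ h]
    unfold det2
    ring

/-- The presentation of `R(A, 𝔫, L)[S_1, …, S_m]`. -/
noncomputable def trinomialPresentation (ha : ∀ i k, i ≠ k → det2 (a i) (a k) ≠ 0)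
    {i₁ : Fin (r+1)} (h1 : (i₁ : ℕ) = 1) :
    TrinomialPresentation 𝕂 (RAnLE 𝕂 r a n l m) r a n l m where
  T p := Ideal.Quotient.mk _ (X (Sum.inl p))
  S k := Ideal.Quotient.mk _ (X (Sum.inr k))
  x := Ideal.Quotient.mk _ (binomE 𝕂 n l m 0 i₁
    ((det2 (a 0) (a i₁))⁻¹ * (a i₁).2) ((det2 (a 0) (a i₁))⁻¹ * (a 0).2))
  y := Ideal.Quotient.mk _ (binomE 𝕂 n l m i₁ 0
    ((det2 (a 0) (a i₁))⁻¹ * (a 0).1) ((det2 (a 0) (a i₁))⁻¹ * (a i₁).1))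
  prod_pow i := by
    rw [← mk_monoE_eq]
    refine (eq_linForm_of_trinomial ha (i₀ := 0) rfl h1
      (fun i => Ideal.Quotient.mk (relIdealE 𝕂 r a n l m) (monoE 𝕂 n l m i)) ?_ i).trans ?_
    · intro i j k hj hk
      have h : Ideal.Quotient.mk (relIdealE 𝕂 r a n l m)
          (rename Sum.inl (gPoly 𝕂 r a n l i j k)) = 0 :=
        Ideal.Quotient.eq_zero_iff_mem.2 (Ideal.subset_span ⟨i, j, k, hj, hk, rfl⟩)
      simp only [gPoly, map_add, map_mul, rename_C] at h
      exact h
    · simp only [binomE, map_sub, map_mul]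
      rfl
  exists_point t s x₀ y₀ h := by
    have hU : ∀ i, aeval (Sum.elim t s) (monoE 𝕂 n l m i) = linForm x₀ y₀ (a i) := fun i => by
      simp [monoE_eq, map_prod, ← h]
    have h01 : det2 (a 0) (a i₁) ≠ 0 := ha _ _ fun h => by simp [← h] at h1
    have hker : ∀ p ∈ relIdealE 𝕂 r a n l m, aeval (Sum.elim t s) p = 0 := by
      intro p hp
      refine (Ideal.span_le (I := RingHom.ker (aeval (R := 𝕂) (Sum.elim t s)))).2 ?_ hp
      rintro _ ⟨i, j, k, -, -, rfl⟩
      have h2 : rename Sum.inl (gPoly 𝕂 r a n l i j k) =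
          C (alpha 𝕂 r a j k) * monoE 𝕂 n l m i + C (alpha 𝕂 r a k i) * monoE 𝕂 n l m j +
            C (alpha 𝕂 r a i j) * monoE 𝕂 n l m k := by
        simp [gPoly, monoE]
      rw [SetLike.mem_coe, RingHom.mem_ker, h2]
      simp only [map_add, map_mul, hU, linForm, alpha, algHom_C, Algebra.algebraMap_self,
        RingHom.id_apply]
      ring
    obtain ⟨φ, hφ⟩ : ∃ φ : RAnLE 𝕂 r a n l m →ₐ[𝕂] 𝕂,
        ∀ p, φ (Ideal.Quotient.mk _ p) = aeval (Sum.elim t s) p :=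
      ⟨Ideal.Quotient.liftₐ _ (aeval (Sum.elim t s)) hker, fun p => rfl⟩
    refine ⟨φ, fun p => ?_, fun k => ?_, ?_, ?_⟩
    · simp [hφ]
    · simp [hφ]
    · simpa [hφ, binomE, hU] using (det2_inv_mul_linForm h01 x₀ y₀).1
    · simpa [hφ, binomE, hU] using (det2_inv_mul_linForm h01 x₀ y₀).2

lemma trinomialPresentation_eval (ha : ∀ i k, i ≠ k → det2 (a i) (a k) ≠ 0)
    {i₁ : Fin (r+1)} (h1 : (i₁ : ℕ) = 1) (p : MvPolynomial (IdxE r n m) 𝕂) :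
    (trinomialPresentation ha h1).eval p = Ideal.Quotient.mk (relIdealE 𝕂 r a n l m) p := by
  have h : (trinomialPresentation ha h1).eval =
      Ideal.Quotient.mkₐ 𝕂 (relIdealE 𝕂 r a n l m) := by
    refine MvPolynomial.algHom_ext fun g => ?_
    rcases g with g | g <;> simp [TrinomialPresentation.eval, trinomialPresentation]
  exact DFunLike.congr_fun h p

end Concrete

section Homogeneity

variable {𝕂 : Type} [Field 𝕂] {r : ℕ} {a : Fin (r+1) → 𝕂 × 𝕂} {n : Fin (r+1) → ℕ}
  {l : ∀ i : Fin (r+1), Fin (n i) → ℕ} {m : ℕ}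

lemma sum_smul_wKE_eq (i : Fin (r+1)) :
    ∑ j, l i j • wKE r n l m (Sum.inl ⟨i, j⟩) = ∑ j, l 0 j • wKE r n l m (Sum.inl ⟨0, j⟩) := by
  have key : ∀ i : Fin (r+1), ∑ j, l i j • wKE r n l m (Sum.inl ⟨i, j⟩) =
      (Qmap r n l (fun p => if p.1 = i then (l p.1 p.2 : ℤ) else 0), 0) := by
    intro i
    refine Prod.ext ?_ ?_
    · rw [Prod.fst_sum]
      simp only [wKE, wK, Prod.smul_fst]
      simp only [← map_nsmul, ← map_sum]
      congr 1
      funext ⟨i', j'⟩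
      rw [Finset.sum_apply]
      by_cases h : i' = i
      · subst h
        rw [Finset.sum_eq_single j']
        · simp
        · intro j _ hj
          simp [hj.symm]
        · simp
      · simp [h]
    · rw [Prod.snd_sum]
      simp [wKE]
  rw [key, key]
  refine Prod.ext ?_ rfl
  refine Fin.cases rfl (fun k => ?_) i
  refine ((QuotientAddGroup.eq (s := rowSpan r n l)).2 ?_).symm
  refine AddSubgroup.subset_closure ⟨k, ?_⟩
  funext p
  by_cases h : p.1 = 0
  · simp [Prow, h, (Fin.succ_ne_zero k).symm]
  · simp [Prow, h]

lemma isWeightedHomogeneous_monoE (i : Fin (r+1)) :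
    (monoE 𝕂 n l m i).IsWeightedHomogeneous (wKE r n l m)
      (∑ j, l 0 j • wKE r n l m (Sum.inl ⟨0, j⟩)) := by
  rw [← sum_smul_wKE_eq i, monoE_eq]
  exact IsWeightedHomogeneous.prod _ _ _ fun j _ => (isWeightedHomogeneous_X _ _ _).pow _

lemma isWeightedHomogeneous_C_mul {σ M : Type} [AddCommMonoid M] {w : σ → M}
    {p : MvPolynomial σ 𝕂} {d : M} (hp : p.IsWeightedHomogeneous w d) (c : 𝕂) :
    (C c * p).IsWeightedHomogeneous w d := by
  simpa using (isWeightedHomogeneous_C w c).mul hp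

lemma isWeightedHomogeneous_binomE (i k : Fin (r+1)) (c c' : 𝕂) :
    (binomE 𝕂 n l m i k c c').IsWeightedHomogeneous (wKE r n l m)
      (∑ j, l 0 j • wKE r n l m (Sum.inl ⟨0, j⟩)) := by
  rw [← mem_weightedHomogeneousSubmodule]
  exact sub_mem (isWeightedHomogeneous_C_mul (isWeightedHomogeneous_monoE i) c)
    (isWeightedHomogeneous_C_mul (isWeightedHomogeneous_monoE k) c')

lemma exists_isHomogE_primeElem (ha : ∀ i k, i ≠ k → det2 (a i) (a k) ≠ 0)
    {i₁ : Fin (r+1)} (h1 : (i₁ : ℕ) = 1) (g : TrinomialPresentation.PrimeLabel a n m) :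
    ∃ d, IsHomogE 𝕂 r a n l m d ((trinomialPresentation ha h1).primeElem g) := by
  rcases g with (p | k) | v
  · exact ⟨_, _, isWeightedHomogeneous_X _ _ (Sum.inl p), rfl⟩
  · exact ⟨_, _, isWeightedHomogeneous_X _ _ (Sum.inr k), rfl⟩
  · refine ⟨∑ j, l 0 j • wKE r n l m (Sum.inl ⟨0, j⟩), _, ?_, (map_add _ _ _).trans
      (congrArg₂ _ (map_mul _ (C v.1.1) _) (map_mul _ (C v.1.2) _))⟩
    exact (isWeightedHomogeneous_C_mul (isWeightedHomogeneous_binomE _ _ _ _) _).add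
      (isWeightedHomogeneous_C_mul (isWeightedHomogeneous_binomE _ _ _ _) _)

lemma IsHomogE.algebraMap_mul {d : KgrpE r n l m} {y : RAnLE 𝕂 r a n l m}
    (h : IsHomogE 𝕂 r a n l m d y) (c : 𝕂) :
    IsHomogE 𝕂 r a n l m d (algebraMap 𝕂 (RAnLE 𝕂 r a n l m) c * y) := by
  obtain ⟨p, hp, rfl⟩ := h
  exact ⟨C c * p, isWeightedHomogeneous_C_mul hp c, map_mul _ _ _⟩

/-- The grading is pointed. -/
lemma isHomogE_zero_iff (hn : ∀ i, 0 < n i) (hl : ∀ i j, 0 < l i j)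
    (y : RAnLE 𝕂 r a n l m) :
    IsHomogE 𝕂 r a n l m 0 y ↔ ∃ c : 𝕂, y = algebraMap 𝕂 (RAnLE 𝕂 r a n l m) c := by
  constructor
  · rintro ⟨p, hp, rfl⟩
    refine ⟨coeff 0 p, congrArg (Ideal.Quotient.mk _) (?_ : p = C (coeff 0 p))⟩
    ext e
    rw [coeff_C]
    split_ifs with h
    · rw [h]
    · by_contra h0
      exact h (eq_zero_of_weight_eq_zero hn hl (hp h0)).symm
  · rintro ⟨c, rfl⟩
    exact ⟨C c, isWeightedHomogeneous_C _ c, rfl⟩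

lemma IsHomogE.mem_factored [IsAlgClosed 𝕂] (hn : ∀ i, 0 < n i) (hl : ∀ i j, 0 < l i j)
    (ha : ∀ i k, i ≠ k → det2 (a i) (a k) ≠ 0) (ha0 : ∀ i, a i ≠ 0)
    {i₁ : Fin (r+1)} (h1 : (i₁ : ℕ) = 1) {d : KgrpE r n l m} {y : RAnLE 𝕂 r a n l m}
    (h : IsHomogE 𝕂 r a n l m d y) (h0 : y ≠ 0) :
    y ∈ (trinomialPresentation (l := l) (m := m) ha h1).factored := by
  obtain ⟨p, hp, rfl⟩ := h
  rw [← trinomialPresentation_eval ha h1] at h0 ⊢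
  exact TrinomialPresentation.eval_mem_factored _ hn hl ha0 hp h0

/-- Nonzero scalar multiples of the labelled elements are graded primes. -/
lemma kPrimeE_algebraMap_mul_primeElem [IsAlgClosed 𝕂] (hn : ∀ i, 0 < n i)
    (hl : ∀ i j, 0 < l i j) (ha : ∀ i k, i ≠ k → det2 (a i) (a k) ≠ 0) (ha0 : ∀ i, a i ≠ 0)
    {i₁ : Fin (r+1)} (h1 : (i₁ : ℕ) = 1) {c : 𝕂} (hc : c ≠ 0) (g : TrinomialPresentation.PrimeLabel a n m) :
    KPrimeE 𝕂 r a n l m (algebraMap 𝕂 (RAnLE 𝕂 r a n l m) c *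
      (trinomialPresentation ha h1).primeElem g) := by
  set D := trinomialPresentation (l := l) (m := m) ha h1
  have hu : IsUnit (algebraMap 𝕂 (RAnLE 𝕂 r a n l m) c) := (IsUnit.mk0 c hc).map _
  refine ⟨?_, ?_, ?_, ?_⟩
  · obtain ⟨d, hd⟩ := exists_isHomogE_primeElem (l := l) ha h1 g
    exact ⟨d, hd.algebraMap_mul c⟩
  · obtain ⟨φ, hφ⟩ := D.exists_point_primeElem_ne_zero hn hl ha0 g
    rw [Ne, hu.mul_right_eq_zero]
    intro h
    exact hφ (by rw [h, map_zero])
  · obtain ⟨φ, hφ, -⟩ := D.exists_point_of_not_dvd hn hl ha ha0 g 0 (by simp)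
    intro h
    have h2 := h.map φ
    rw [map_mul, hφ, mul_zero] at h2
    exact not_isUnit_zero h2
  · rintro x y ⟨dx, hx⟩ ⟨dy, hy⟩ hxy
    rw [hu.mul_left_dvd] at hxy ⊢
    rw [hu.mul_left_dvd]
    by_contra! hcon
    have hx0 : x ≠ 0 := fun h => hcon.1 (h ▸ dvd_zero _)
    have hy0 : y ≠ 0 := fun h => hcon.2 (h ▸ dvd_zero _)
    obtain ⟨cx, hcx, ms, rfl⟩ := hx.mem_factored hn hl ha ha0 h1 hx0
    obtain ⟨cy, hcy, ms', rfl⟩ := hy.mem_factored hn hl ha ha0 h1 hy0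
    obtain ⟨φ, h0, hne⟩ := D.exists_point_of_not_dvd hn hl ha ha0 g (ms + ms') (by
      intro g' hg' hdvd
      rcases Multiset.mem_add.1 hg' with h | h
      · exact hcon.1 ((hdvd.trans
          (Multiset.dvd_prod (Multiset.mem_map_of_mem _ h))).mul_left _)
      · exact hcon.2 ((hdvd.trans
          (Multiset.dvd_prod (Multiset.mem_map_of_mem _ h))).mul_left _))
    have hprod : ∀ {c' : 𝕂} {s : Multiset (TrinomialPresentation.PrimeLabel a n m)}, c' ≠ 0 → s ≤ ms + ms' →
        φ (algebraMap 𝕂 _ c' * (s.map D.primeElem).prod) ≠ 0 := by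
      intro c' s hc' hs
      rw [map_mul, map_multiset_prod, AlgHom.commutes, Multiset.map_map]
      refine mul_ne_zero hc' (Multiset.prod_ne_zero fun h => ?_)
      obtain ⟨g', hg', h⟩ := Multiset.mem_map.1 h
      exact hne g' (Multiset.mem_of_le hs hg') h
    obtain ⟨z, hz⟩ := hxy
    have h2 := congrArg φ hz
    rw [map_mul, map_mul φ (D.primeElem g), h0, zero_mul] at h2
    exact mul_ne_zero (hprod hcx (Multiset.le_add_right _ _))
      (hprod hcy (Multiset.le_add_left _ _)) h2

/-- The grading is factorial. -/
lemma exists_kPrimeE_factorization [IsAlgClosed 𝕂] (hn : ∀ i, 0 < n i)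
    (hl : ∀ i j, 0 < l i j) (ha : ∀ i k, i ≠ k → det2 (a i) (a k) ≠ 0) (ha0 : ∀ i, a i ≠ 0)
    {i₁ : Fin (r+1)} (h1 : (i₁ : ℕ) = 1) {d : KgrpE r n l m} {f : RAnLE 𝕂 r a n l m}
    (hf : IsHomogE 𝕂 r a n l m d f) (h0 : f ≠ 0) (hu : ¬ IsUnit f) :
    ∃ ms : Multiset (RAnLE 𝕂 r a n l m), (∀ p ∈ ms, KPrimeE 𝕂 r a n l m p) ∧ ms.prod = f := by
  obtain ⟨c, hc, ms, rfl⟩ := hf.mem_factored hn hl ha ha0 h1 h0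
  set D := trinomialPresentation (l := l) (m := m) ha h1
  induction ms using Multiset.induction_on with
  | empty => exact absurd (by simpa using (IsUnit.mk0 c hc).map (algebraMap 𝕂 _)) hu
  | cons g ms =>
    refine ⟨(algebraMap 𝕂 _ c * D.primeElem g) ::ₘ ms.map D.primeElem, ?_, ?_⟩
    · intro p hp
      rcases Multiset.mem_cons.1 hp with rfl | hp
      · exact kPrimeE_algebraMap_mul_primeElem hn hl ha ha0 h1 hc g
      · obtain ⟨g', -, rfl⟩ := Multiset.mem_map.1 hp
        simpa using kPrimeE_algebraMap_mul_primeElem hn hl ha ha0 h1 one_ne_zero g'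
    · rw [Multiset.prod_cons, Multiset.map_cons, Multiset.prod_cons, mul_assoc]

end Homogeneity

section Statement12

/-- The `K × ℤ^m`-grading of `R(A,𝔫,L)[S_1, …, S_m]` is effective, pointed, factorial
and of complexity one. -/
theorem statement12 (𝕂 : Type) [Field 𝕂] [IsAlgClosed 𝕂] [CharZero 𝕂]
    (r : ℕ) (hr : 1 ≤ r) (a : Fin (r+1) → 𝕂 × 𝕂)
    (ha : ∀ i k : Fin (r+1), i ≠ k → LinearIndependent 𝕂 ![a i, a k])
    (n : Fin (r+1) → ℕ) (hn : ∀ i, 0 < n i)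
    (l : ∀ i : Fin (r+1), Fin (n i) → ℕ) (hl : ∀ i j, 0 < l i j) (m : ℕ) :
    AddSubgroup.closure (Set.range (wKE r n l m)) = ⊤ ∧
    (∀ y : RAnLE 𝕂 r a n l m, IsHomogE 𝕂 r a n l m 0 y ↔
      ∃ c : 𝕂, y = algebraMap 𝕂 (RAnLE 𝕂 r a n l m) c) ∧
    (∀ f : RAnLE 𝕂 r a n l m, (∃ d, IsHomogE 𝕂 r a n l m d f) → f ≠ 0 → ¬ IsUnit f →
      ∃ ms : Multiset (RAnLE 𝕂 r a n l m), (∀ p ∈ ms, KPrimeE 𝕂 r a n l m p) ∧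
        ms.prod = f) ∧
    (∃ d : ℕ, Module.rank ℤ (KgrpE r n l m) = (d : Cardinal) ∧
      ringKrullDim (RAnLE 𝕂 r a n l m) = ((d + 1 : ℕ) : WithBot ℕ∞)) := by
  have ha' : ∀ i k, i ≠ k → det2 (a i) (a k) ≠ 0 := fun i k h => det2_ne_zero (ha i k h)
  set i₁ : Fin (r+1) := ⟨1, by omega⟩
  have ha0 : ∀ i, a i ≠ 0 := by
    intro i h
    obtain ⟨k, hk⟩ : ∃ k, i ≠ k :=
      ⟨if i = 0 then i₁ else 0, by split_ifs with h <;> simp [h, i₁, Fin.ext_iff]⟩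
    exact ha' i k hk (by simp [det2, h])
  refine ⟨closure_range_wKE, isHomogE_zero_iff hn hl, fun f ⟨d, hd⟩ h0 hu =>
    exists_kPrimeE_factorization hn hl ha' ha0 (i₁ := i₁) rfl hd h0 hu,
    Fintype.card (FreeIdx r n) + 1 + m, rank_KgrpE hn hl, ?_⟩
  refine (trinomialPresentation (l := l) (m := m) ha' (i₁ := i₁) rfl).ringKrullDim_eq hn hl
    fun b => ?_
  obtain ⟨p, rfl⟩ := Ideal.Quotient.mk_surjective b
  exact ⟨p, trinomialPresentation_eval _ _ p⟩

end Statement12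
end

section
/- Let 0 < s < n + m − r, let d be an integral s × n matrix and d' an integral s × m matrix, and let Ṗ be the (r+s) × (n+m) block matrix with blocks P, 0 in the first r rows and d, d' in the last s rows. Assume the columns of Ṗ are pairwise different primitive vectors of ℤ^{r+s} whose nonnegative rational combinations exhaust all of ℚ^{r+s}. Let K̇ := ℤ^{n+m}/(subgroup generated by the rows of Ṗ) with projection Q̇, and grade R(A,𝔫,L)[S_1,…,S_m] by K̇ via deg T_{ij} := Q̇(e_{ij}) and deg S_k := Q̇(e_k). Then this K̇-grading is effective, pointed (degree-zero component 𝕂·1) and factorial (every homogeneous nonzero nonunit is a product of K̇-primes), and the classes of the generators T_{ij} and S_k are pairwise nonassociated K̇-prime elements. -/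
open MvPolynomial

section Statement13

variable (r : ℕ) (n : Fin (r+1) → ℕ) (l : ∀ i : Fin (r+1), Fin (n i) → ℕ)
variable (m s : ℕ) (d : Fin s → Idx r n → ℤ) (d' : Fin s → Fin m → ℤ)

/-- The rows of the `(r+s) × (n+m)` block matrix `Ṗ = (P 0 // d d')`. -/
def PdotRow : Fin r ⊕ Fin s → IdxE r n m → ℤ := fun rw x =>
  match rw, x with
  | Sum.inl i, Sum.inl x => Prow r n l i x
  | Sum.inl _, Sum.inr _ => 0
  | Sum.inr t, Sum.inl x => d t x
  | Sum.inr t, Sum.inr k => d' t k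

/-- The columns of `Ṗ`, i.e. the images of the basis vectors in `ℤ^{r+s}`. -/
def PdotCol : IdxE r n m → (Fin r ⊕ Fin s) → ℤ := fun x rw => PdotRow r n l m s d d' rw x

/-- The grading group `K̇ = ℤ^{n+m} / (row span of Ṗ)`. -/
abbrev KdotGrp := (IdxE r n m → ℤ) ⧸
  AddSubgroup.closure (Set.range (PdotRow r n l m s d d'))

/-- The projection `Q̇ : ℤ^{n+m} → K̇`. -/
noncomputable def Qdot : (IdxE r n m → ℤ) →+ KdotGrp r n l m s d d' :=
  QuotientAddGroup.mk' _

/-- The `K̇`-grading: `deg T_{ij} = Q̇(e_{ij})`, `deg S_k = Q̇(e_k)`. -/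
noncomputable def wKdot : IdxE r n m → KdotGrp r n l m s d d' := fun x =>
  Qdot r n l m s d d' (Pi.single x (1 : ℤ))

variable (𝕂 : Type) [Field 𝕂] [IsAlgClosed 𝕂] [CharZero 𝕂] (a : Fin (r+1) → 𝕂 × 𝕂)

/-- Homogeneity of degree `δ ∈ K̇` in `R(A,𝔫,L)[S_1, …, S_m]`. -/
def IsHomogDot (δ : KdotGrp r n l m s d d') (y : RAnLE 𝕂 r a n l m) : Prop :=
  ∃ p : MvPolynomial (IdxE r n m) 𝕂, p.IsWeightedHomogeneous (wKdot r n l m s d d') δ ∧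
    Ideal.Quotient.mk (relIdealE 𝕂 r a n l m) p = y

/-- `K̇`-prime elements of `R(A,𝔫,L)[S_1, …, S_m]`. -/
def KPrimeDot (f : RAnLE 𝕂 r a n l m) : Prop :=
  (∃ δ, IsHomogDot r n l m s d d' 𝕂 a δ f) ∧ f ≠ 0 ∧ ¬ IsUnit f ∧
    ∀ x y : RAnLE 𝕂 r a n l m, (∃ δ, IsHomogDot r n l m s d d' 𝕂 a δ x) →
      (∃ δ, IsHomogDot r n l m s d d' 𝕂 a δ y) → f ∣ x * y → f ∣ x ∨ f ∣ y

end Statement13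

section Abstract

/-- Prescribed nonzero values on `ℤ`-linearly independent vectors extend to a character with values
in an algebraically closed field. -/
theorem exists_addChar_extension {ι N Ω : Type*} [Fintype ι] [Field Ω] [IsAlgClosed Ω]
    (R : ι → N → ℤ) (hR : ∀ w : ι → ℤ, ∑ i, w i • R i = 0 → w = 0)
    (u : ι → Ω) (hu : ∀ i, u i ≠ 0) [CharZero Ω] :
    ∃ χ : AddChar (N → ℤ) Ω, ∀ i, χ (R i) = u i := by
  classical
  let _ : RootableBy Ωˣ ℕ := rootableByOfPowLeftSurj Ωˣ ℕ fun {k} hk x => by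
    obtain ⟨z, hz⟩ := IsAlgClosed.exists_pow_nat_eq (x : Ω) (Nat.pos_of_ne_zero hk)
    have hz0 : z ≠ 0 := by
      rintro rfl
      rw [zero_pow hk] at hz
      exact x.ne_zero hz.symm
    exact ⟨Units.mk0 z hz0, Units.ext (by simpa using hz)⟩
  let _ : RootableBy Ωˣ ℤ := Group.rootableByIntOfRootableByNat Ωˣ
  let _ : DivisibleBy (Additive Ωˣ) ℤ :=
    { div := fun x k => Additive.ofMul (RootableBy.root x.toMul k)
      div_zero := fun x => congrArg Additive.ofMul (RootableBy.root_zero x.toMul)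
      div_cancel := fun x hk => congrArg Additive.ofMul (RootableBy.root_cancel x.toMul hk) }
  let F : (ι → ℤ) →+ (N → ℤ) := (Fintype.linearCombination ℤ R).toAddMonoidHom
  have hF : Function.Injective F := (injective_iff_map_eq_zero F).2 fun w hw =>
    hR w (by simpa [F, Fintype.linearCombination_apply] using hw)
  let U : (ι → ℤ) →+ Additive Ωˣ := (Fintype.linearCombination ℤ
    (fun i => Additive.ofMul (Units.mk0 (u i) (hu i)))).toAddMonoidHom
  obtain ⟨h, hh⟩ := (Module.Baer.of_divisible (Additive Ωˣ)).extension_property_addMonoidHom F hF U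
  refine ⟨⟨fun x => ((h x).toMul : Ωˣ), by simp, fun a b => by simp⟩, fun i => ?_⟩
  have h1 := DFunLike.congr_fun hh (Pi.single i 1)
  have h2 : F (Pi.single i 1) = R i := by simp [F]
  have h3 : U (Pi.single i 1) = Additive.ofMul (Units.mk0 (u i) (hu i)) := by simp [U]
  rw [AddMonoidHom.comp_apply, h2, h3] at h1
  change ((h (R i)).toMul : Ω) = u i
  rw [h1]
  rfl

theorem dvd_of_dvd_closure_mul {H : Type*} [CommMonoidWithZero H] [IsCancelMulZero H] {T : Set H}
    (hT : ∀ t ∈ T, Prime t) {P : H} (hP : ∀ t ∈ T, ¬ t ∣ P) {b : H}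
    (hb : b ∈ Submonoid.closure T) : ∀ y, P ∣ b * y → P ∣ y := by
  induction hb using Submonoid.closure_induction with
  | mem t ht =>
    rintro y ⟨z, hz⟩
    rcases (hT t ht).dvd_or_dvd ⟨y, hz.symm⟩ with h | ⟨z', rfl⟩
    · exact absurd h (hP t ht)
    · refine ⟨z', mul_left_cancel₀ (hT t ht).ne_zero ?_⟩
      rw [hz, mul_left_comm]
  | one => intro y h; simpa using h
  | mul a b _ _ iha ihb => intro y h; exact ihb y (iha _ (by rwa [← mul_assoc]))

theorem exists_eq_closure_mul_not_dvd {H : Type*} [CommMonoidWithZero H] [IsCancelMulZero H]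
    [WfDvdMonoid H] {T : Set H} (hT : ∀ t ∈ T, Prime t) {f : H} (hf : f ≠ 0) :
    ∃ a ∈ Submonoid.closure T, ∃ P, f = a * P ∧ ∀ t ∈ T, ¬ t ∣ P := by
  induction f using (wellFounded_dvdNotUnit (α := H)).induction with
  | _ f ih =>
    by_cases h : ∃ t ∈ T, t ∣ f
    · obtain ⟨t, ht, f', rfl⟩ := h
      have hf' : f' ≠ 0 := right_ne_zero_of_mul hf
      obtain ⟨a, ha, P, rfl, hP⟩ := ih f' ⟨hf', t, (hT t ht).not_isUnit, mul_comm _ _⟩ hf'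
      exact ⟨t * a, mul_mem (Submonoid.subset_closure ht) ha, P, (mul_assoc _ _ _).symm, hP⟩
    · push Not at h
      exact ⟨1, one_mem _, f, (one_mul f).symm, h⟩

/-- A Nagata type criterion: `rel f g` says that `f` agrees with `g` once the primes in `T` and the
elements of `W` are inverted. -/
theorem mem_closure_isUnit_or_prime_of_rel {H R : Type*} [CommMonoidWithZero H] [IsCancelMulZero H]
    [WfDvdMonoid H] [CommRing R] [IsDomain R] [UniqueFactorizationMonoid R]
    {T : Set H} (hT : ∀ t ∈ T, Prime t) {W : Set R} (hW : ∀ w ∈ W, w ≠ 0)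
    (rel : H → R → Prop) (hleft : ∀ f, ∃ g, rel f g) (hright : ∀ g, ∃ f, rel f g)
    (hmul : ∀ {f₁ f₂ g₁ g₂}, rel f₁ g₁ → rel f₂ g₂ → rel (f₁ * f₂) (g₁ * g₂))
    (hdetH : ∀ {f₁ f₂ g}, rel f₁ g → rel f₂ g →
      ∃ a ∈ Submonoid.closure T, ∃ b ∈ Submonoid.closure T, a * f₁ = b * f₂)
    (hdetR : ∀ {f g₁ g₂}, rel f g₁ → rel f g₂ → ∃ w₁ ∈ W, ∃ w₂ ∈ W, w₁ * g₁ = w₂ * g₂)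
    (hWone : ∀ w ∈ W, rel 1 w) (hone : rel 1 1) (hTone : ∀ a ∈ Submonoid.closure T, rel a 1)
    (hzero : ∀ {f}, rel f 0 → f = 0) {f : H} (hf : f ≠ 0) :
    f ∈ Submonoid.closure {x : H | IsUnit x ∨ Prime x} := by
  set S := Submonoid.closure {x : H | IsUnit x ∨ Prime x} with hS
  have hTS : Submonoid.closure T ≤ S := Submonoid.closure_mono fun t ht => Or.inr (hT t ht)
  have hzero' : ∀ {g}, rel 0 g → g = 0 := by
    intro g hg
    obtain ⟨f', hf'⟩ := hright 0
    obtain rfl := hzero hf'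
    obtain ⟨w₁, h₁, w₂, -, h⟩ := hdetR hg hf'
    rw [mul_zero] at h
    exact (mul_eq_zero.1 h).resolve_left (hW _ h₁)
  have hsmul : ∀ {f g w}, rel f g → w ∈ W → rel f (w * g) := by
    intro f g w h hw
    simpa using hmul (hWone w hw) h
  have hprime : ∀ p : R, Prime p → ∃ P ∈ S, ∃ w ∈ W, rel P (w * p) := by
    intro p hp
    obtain ⟨f₀, hf₀⟩ := hright p
    have hf₀0 : f₀ ≠ 0 := by rintro rfl; exact hp.ne_zero (hzero' hf₀)
    obtain ⟨a, ha, P, rfl, hP⟩ := exists_eq_closure_mul_not_dvd hT hf₀0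
    obtain ⟨g', hg'⟩ := hleft P
    have h1 := hmul (hTone a ha) hg'
    rw [one_mul] at h1
    obtain ⟨w₁, hw₁, w₂, hw₂, h12⟩ := hdetR h1 hf₀
    have hPrel : rel P (w₂ * p) := h12 ▸ hsmul hg' hw₁
    have hP0 : P ≠ 0 := right_ne_zero_of_mul hf₀0
    refine ⟨P, ?_, w₂, hw₂, hPrel⟩
    by_cases hpW : ∃ w ∈ W, p ∣ w
    · obtain ⟨w, hw, p', rfl⟩ := hpW
      obtain ⟨P', hP'⟩ := hright p'
      have h2 : rel (P * P') (w₂ * (p * p')) := by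
        simpa [mul_assoc] using hmul hPrel hP'
      have h3 : rel 1 (w₂ * (p * p')) := hsmul (hWone _ hw) hw₂
      obtain ⟨a, ha, b, hb, hab⟩ := hdetH h2 h3
      refine divisor_closure_eq_closure P (a * P') ?_
      rw [show P * (a * P') = b by rw [← mul_one b, ← hab]; ac_rfl]
      exact hTS hb
    · push Not at hpW
      refine Submonoid.subset_closure (Or.inr ⟨hP0, ?_, ?_⟩)
      · intro hu
        obtain ⟨Q, hQ⟩ := hu.exists_right_inv
        obtain ⟨q, hq⟩ := hleft Q
        have h2 := hmul hPrel hq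
        rw [hQ] at h2
        obtain ⟨v₁, hv₁, v₂, hv₂, hv⟩ := hdetR h2 hone
        exact hpW v₂ hv₂ ⟨v₁ * (w₂ * q), by rw [← mul_one v₂, ← hv]; ring⟩
      · rintro y z ⟨q, hq⟩
        obtain ⟨g₁, hg₁⟩ := hleft y
        obtain ⟨g₂, hg₂⟩ := hleft z
        obtain ⟨g₃, hg₃⟩ := hleft q
        have h2 := hmul hg₁ hg₂
        rw [hq] at h2
        obtain ⟨v₁, hv₁, v₂, hv₂, hv⟩ := hdetR h2 (hmul hPrel hg₃)
        have key : ∀ {y g}, rel y g → p ∣ g → P ∣ y := by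
          rintro y _ hy ⟨g, rfl⟩
          obtain ⟨q', hq'⟩ := hright g
          have h4 : rel (P * q') (w₂ * (p * g)) := by
            simpa [mul_assoc] using hmul hPrel hq'
          obtain ⟨a, ha, b, hb, hab⟩ := hdetH h4 (hsmul hy hw₂)
          exact dvd_of_dvd_closure_mul hT hP hb y ⟨a * q', by rw [← hab]; ac_rfl⟩
        have h5 : p ∣ v₁ * (g₁ * g₂) := ⟨v₂ * w₂ * g₃, by rw [hv]; ring⟩
        rcases hp.dvd_or_dvd ((hp.dvd_or_dvd h5).resolve_left (hpW v₁ hv₁)) with h | h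
        · exact Or.inl (key hg₁ h)
        · exact Or.inr (key hg₂ h)
  have main : ∀ g : R, ∀ f, f ≠ 0 → rel f g → f ∈ S := by
    intro g
    induction g using UniqueFactorizationMonoid.induction_on_prime with
    | h₁ => intro f hf h; exact absurd (hzero h) hf
    | h₂ g hg =>
      intro f hf h
      obtain ⟨g', hg'⟩ := hg.exists_right_inv
      obtain ⟨f', hf'⟩ := hright g'
      have h2 := hmul h hf'
      rw [hg'] at h2
      obtain ⟨a, ha, b, hb, hab⟩ := hdetH h2 hone
      refine divisor_closure_eq_closure f (a * f') ?_
      rw [show f * (a * f') = b by rw [← mul_one b, ← hab]; ac_rfl]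
      exact hTS hb
    | h₃ g p hg hp ih =>
      intro f hf h
      obtain ⟨P, hPS, w, hw, hP⟩ := hprime p hp
      obtain ⟨f', hf'⟩ := hright g
      have hf'0 : f' ≠ 0 := by rintro rfl; exact hg (hzero' hf')
      have h2 : rel (P * f') (w * (p * g)) := by simpa [mul_assoc] using hmul hP hf'
      obtain ⟨a, ha, b, hb, hab⟩ := hdetH (hsmul h hw) h2
      refine divisor_closure_eq_closure f a ?_
      rw [mul_comm, hab]
      exact mul_mem (hTS hb) (mul_mem hPS (ih f' hf'0 hf'))
  obtain ⟨g, hg⟩ := hleft f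
  exact main g f hf hg

end Abstract

section Exponents

variable {r : ℕ} {n : Fin (r+1) → ℕ} {l : ∀ i : Fin (r+1), Fin (n i) → ℕ}
variable {m s : ℕ} {d : Fin s → Idx r n → ℤ} {d' : Fin s → Fin m → ℤ}

/-- An exponent vector, viewed as an integral vector. -/
def expZ (e : IdxE r n m →₀ ℕ) : IdxE r n m → ℤ := fun x => e x

@[simp] theorem expZ_zero : expZ (0 : IdxE r n m →₀ ℕ) = 0 := by ext; simp [expZ]

@[simp] theorem expZ_add (e f : IdxE r n m →₀ ℕ) : expZ (e + f) = expZ e + expZ f := by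
  ext; simp [expZ]

@[simp] theorem expZ_single (x : IdxE r n m) (k : ℕ) :
    expZ (Finsupp.single x k) = Pi.single x (k : ℤ) := by
  ext y
  rcases eq_or_ne x y with rfl | h
  · simp [expZ]
  · simp [expZ, h.symm]

theorem expZ_injective : Function.Injective (expZ : (IdxE r n m →₀ ℕ) → IdxE r n m → ℤ) := by
  intro e f h
  ext x
  simpa [expZ] using congrFun h x

theorem exists_expZ_of_nonneg (v : IdxE r n m → ℤ) (hv : 0 ≤ v) :
    ∃ e : IdxE r n m →₀ ℕ, expZ e = v :=
  ⟨Finsupp.equivFunOnFinite.symm fun x => (v x).toNat, by ext x; simpa [expZ] using hv x⟩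

/-- Every integral vector is a difference of two exponent vectors. -/
theorem exists_add_expZ_eq (v : IdxE r n m → ℤ) :
    ∃ e f : IdxE r n m →₀ ℕ, v + expZ e = expZ f := by
  obtain ⟨e, he⟩ := exists_expZ_of_nonneg (fun x => (-v x) ⊔ 0) fun x => le_sup_right
  obtain ⟨f, hf⟩ := exists_expZ_of_nonneg (fun x => v x ⊔ 0) fun x => le_sup_right
  refine ⟨e, f, ?_⟩
  rw [he, hf]
  ext x
  simp only [Pi.add_apply]
  omega

theorem weight_wKdot (e : IdxE r n m →₀ ℕ) :
    Finsupp.weight (wKdot r n l m s d d') e = Qdot r n l m s d d' (expZ e) := by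
  induction e using Finsupp.induction_linear with
  | zero => simp
  | add e f he hf => rw [map_add, he, hf, expZ_add, map_add]
  | single x k =>
    rw [Finsupp.weight_single, expZ_single, wKdot, ← map_nsmul]
    congr 1
    ext y
    rcases eq_or_ne x y with rfl | h
    · simp
    · simp [h.symm]

variable (r n l m s d d') in
/-- The integral combination of the rows of `Ṗ` with coefficients `w`. -/
def rowComb : (Fin r ⊕ Fin s → ℤ) →ₗ[ℤ] IdxE r n m → ℤ :=
  Fintype.linearCombination ℤ (PdotRow r n l m s d d')

theorem rowComb_apply (w : Fin r ⊕ Fin s → ℤ) (x : IdxE r n m) :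
    rowComb r n l m s d d' w x = ∑ rw, w rw * PdotRow r n l m s d d' rw x := by
  simp [rowComb, Fintype.linearCombination_apply]

theorem rowComb_single (rw : Fin r ⊕ Fin s) :
    rowComb r n l m s d d' (Pi.single rw 1) = PdotRow r n l m s d d' rw := by
  simp [rowComb]

theorem Qdot_eq_iff (u v : IdxE r n m → ℤ) :
    Qdot r n l m s d d' u = Qdot r n l m s d d' v ↔
      ∃ w, u = v + rowComb r n l m s d d' w := by
  have hmem : ∀ z, z ∈ AddSubgroup.closure (Set.range (PdotRow r n l m s d d')) ↔
      ∃ w, rowComb r n l m s d d' w = z := by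
    intro z
    have : AddSubgroup.closure (Set.range (PdotRow r n l m s d d')) =
        (LinearMap.range (rowComb r n l m s d d')).toAddSubgroup := by
      rw [rowComb, Fintype.range_linearCombination, Submodule.span_int_eq_addSubgroupClosure]
    rw [this]
    rfl
  rw [Qdot, QuotientAddGroup.mk'_eq_mk']
  constructor
  · rintro ⟨z, hz, hzu⟩
    obtain ⟨w, rfl⟩ := (hmem z).1 hz
    exact ⟨-w, by rw [map_neg, ← hzu]; abel⟩
  · rintro ⟨w, rfl⟩
    exact ⟨-rowComb r n l m s d d' w, neg_mem ((hmem _).2 ⟨w, rfl⟩), by abel⟩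

theorem Qdot_add_rowComb (u : IdxE r n m → ℤ) (w : Fin r ⊕ Fin s → ℤ) :
    Qdot r n l m s d d' (u + rowComb r n l m s d d' w) = Qdot r n l m s d d' u :=
  (Qdot_eq_iff _ _).2 ⟨w, rfl⟩

/-- If the columns of `Ṗ` generate `ℚ^{r+s}` as a cone, a combination of rows with nonnegative
entries is trivial. -/
theorem eq_zero_of_rowComb_nonneg
    (hcone : ∀ v : Fin r ⊕ Fin s → ℚ, ∃ c : IdxE r n m → ℚ, (∀ x, 0 ≤ c x) ∧
      ∀ rw, v rw = ∑ x : IdxE r n m, c x * (PdotCol r n l m s d d' x rw : ℚ))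
    (w : Fin r ⊕ Fin s → ℤ) (hw : 0 ≤ rowComb r n l m s d d' w) : w = 0 := by
  obtain ⟨c, hc, hv⟩ := hcone fun rw => -(w rw : ℚ)
  have h1 : -∑ rw, (w rw : ℚ) * w rw = ∑ x, c x * (rowComb r n l m s d d' w x : ℚ) := by
    calc -∑ rw, (w rw : ℚ) * w rw = ∑ rw, (w rw : ℚ) * -(w rw : ℚ) := by
          simp [Finset.sum_neg_distrib]
      _ = ∑ rw, ∑ x, (w rw : ℚ) * (c x * (PdotRow r n l m s d d' rw x : ℚ)) := by
          refine Finset.sum_congr rfl fun rw _ => ?_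
          rw [hv rw, Finset.mul_sum]
          rfl
      _ = ∑ x, c x * (rowComb r n l m s d d' w x : ℚ) := by
          rw [Finset.sum_comm]
          refine Finset.sum_congr rfl fun x _ => ?_
          rw [rowComb_apply]
          push_cast
          rw [Finset.mul_sum]
          exact Finset.sum_congr rfl fun rw _ => by ring
  have h2 : 0 ≤ ∑ x, c x * (rowComb r n l m s d d' w x : ℚ) :=
    Finset.sum_nonneg fun x _ => mul_nonneg (hc x) (by exact_mod_cast hw x)
  have h3 : ∑ rw, (w rw : ℚ) * w rw = 0 :=
    le_antisymm (by linarith) (Finset.sum_nonneg fun rw _ => mul_self_nonneg _)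
  ext rw
  have h4 := (Finset.sum_eq_zero_iff_of_nonneg fun rw _ => mul_self_nonneg (w rw : ℚ)).1 h3 rw
    (Finset.mem_univ _)
  exact_mod_cast mul_self_eq_zero.1 h4

variable (l m) in
/-- The exponent vector of `T_i^{l_i}`. -/
noncomputable def blockExp (i : Fin (r+1)) : IdxE r n m →₀ ℕ :=
  Finsupp.equivFunOnFinite.symm (Sum.elim (fun x => if x.1 = i then l x.1 x.2 else 0) fun _ => 0)

theorem blockExp_inl (i : Fin (r+1)) (x : Idx r n) :
    blockExp l m i (Sum.inl x) = if x.1 = i then l x.1 x.2 else 0 := rfl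

theorem blockExp_inr (i : Fin (r+1)) (k : Fin m) : blockExp l m i (Sum.inr k) = 0 := rfl

theorem expZ_blockExp_succ (i : Fin r) :
    expZ (blockExp l m i.succ) = expZ (blockExp l m 0) + PdotRow r n l m s d d' (Sum.inl i) := by
  ext x
  rcases x with x | k
  · simp only [expZ, blockExp_inl, Pi.add_apply, PdotRow, Prow]
    split_ifs with h1 h2 h3
    · exact absurd (h1.symm.trans h2) (Fin.succ_ne_zero i)
    all_goals simp
  · simp [expZ, blockExp_inr, PdotRow]

theorem weight_blockExp (i : Fin (r+1)) :
    Finsupp.weight (wKdot r n l m s d d') (blockExp l m i) =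
      Finsupp.weight (wKdot r n l m s d d') (blockExp l m 0) := by
  induction i using Fin.cases with
  | zero => rfl
  | succ i =>
    rw [weight_wKdot, weight_wKdot, expZ_blockExp_succ (d := d) (d' := d'), ← rowComb_single,
      Qdot_add_rowComb]

/-- The multiple of `l_i` that a combination of the rows of `P` has in the `i`-th block. -/
def blockCoeff (w : Fin r ⊕ Fin s → ℤ) : Fin (r+1) → ℤ :=
  Fin.cons (-∑ i, w (Sum.inl i)) fun i => w (Sum.inl i)

theorem sum_blockCoeff (w : Fin r ⊕ Fin s → ℤ) : ∑ i, blockCoeff w i = 0 := by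
  simp [blockCoeff, Fin.sum_univ_succ]

theorem rowComb_inl {w : Fin r ⊕ Fin s → ℤ} (hw : ∀ k, w (Sum.inr k) = 0) (x : Idx r n) :
    rowComb r n l m s d d' w (Sum.inl x) = blockCoeff w x.1 * l x.1 x.2 := by
  obtain ⟨i, j⟩ := x
  rw [rowComb_apply, Fintype.sum_sum_type]
  simp only [hw, zero_mul, Finset.sum_const_zero, add_zero, PdotRow, Prow]
  induction i using Fin.cases with
  | zero => simp [blockCoeff, Finset.sum_mul]
  | succ i => simp [blockCoeff, Fin.succ_ne_zero]

/-- Normal exponents: the monomial is divisible by `T_i^{l_i}` at most for `i = p` and `i = q`. -/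
def IsNormalExp (l : ∀ i : Fin (r+1), Fin (n i) → ℕ) (p q : Fin (r+1))
    (e : IdxE r n m →₀ ℕ) : Prop :=
  ∀ i, i ≠ p → i ≠ q → ∃ j, e (Sum.inl ⟨i, j⟩) < l i j

theorem blockCoeff_eq_zero_of_isNormalExp {p q : Fin (r+1)} {e f : IdxE r n m →₀ ℕ}
    (he : IsNormalExp l p q e) (hf : IsNormalExp l p q f) {w : Fin r ⊕ Fin s → ℤ}
    (hw : ∀ k, w (Sum.inr k) = 0) (hef : expZ e = expZ f + rowComb r n l m s d d' w)
    {i : Fin (r+1)} (hp : i ≠ p) (hq : i ≠ q) : blockCoeff w i = 0 := by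
  have key : ∀ j, (e (Sum.inl ⟨i, j⟩) : ℤ) = f (Sum.inl ⟨i, j⟩) + blockCoeff w i * l i j := by
    intro j
    have := congrFun hef (Sum.inl ⟨i, j⟩)
    rwa [Pi.add_apply, rowComb_inl hw] at this
  obtain ⟨j, hj⟩ := he i hp hq
  obtain ⟨j', hj'⟩ := hf i hp hq
  have h1 := key j
  have h2 := key j'
  rcases lt_trichotomy (blockCoeff w i) 0 with h | h | h
  · nlinarith
  · exact h
  · nlinarith

end Exponents

section Relations

variable {r : ℕ} {n : Fin (r+1) → ℕ} {l : ∀ i : Fin (r+1), Fin (n i) → ℕ}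
variable {m s : ℕ} {d : Fin s → Idx r n → ℤ} {d' : Fin s → Fin m → ℤ}
variable {𝕂 : Type} [Field 𝕂] {a : Fin (r+1) → 𝕂 × 𝕂}

theorem alpha_ne_zero (ha : ∀ i k : Fin (r+1), i ≠ k → LinearIndependent 𝕂 ![a i, a k])
    {i k : Fin (r+1)} (h : i ≠ k) : alpha 𝕂 r a i k ≠ 0 := by
  intro h0
  have hli := LinearIndependent.pair_iff.1 (ha i k h)
  rw [alpha, sub_eq_zero] at h0
  have h1 := hli (a k).2 (-(a i).2) (by
    ext
    · simp only [Prod.fst_add, Prod.smul_fst, smul_eq_mul, Prod.fst_zero]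
      linear_combination h0
    · simp only [Prod.snd_add, Prod.smul_snd, smul_eq_mul, Prod.snd_zero]
      ring)
  have h2 := hli (a k).1 (-(a i).1) (by
    ext
    · simp only [Prod.fst_add, Prod.smul_fst, smul_eq_mul, Prod.fst_zero]
      ring
    · simp only [Prod.snd_add, Prod.smul_snd, smul_eq_mul, Prod.snd_zero]
      linear_combination -h0)
  have h3 := hli 0 1 (by
    ext
    · simp [h2.1]
    · simp [h1.1])
  exact one_ne_zero h3.2

theorem rename_mono (i : Fin (r+1)) :
    rename Sum.inl (mono 𝕂 r n l i) =
      (monomial (blockExp l m i) 1 : MvPolynomial (IdxE r n m) 𝕂) := by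
  rw [mono, map_prod, monomial_eq, C_1, one_mul, Finsupp.prod_fintype _ _ (by simp),
    Fintype.prod_sum_type, Fintype.prod_sigma]
  simp only [blockExp_inr, pow_zero, Finset.prod_const_one, mul_one, blockExp_inl, map_pow,
    rename_X]
  rw [Finset.prod_eq_single i]
  · simp
  · intro b _ hb
    simp [hb]
  · simp

/-- If the values `y_0, …, y_r` satisfy the consecutive trinomial relations, then they are given by
the linear forms `a_0, …, a_r` in two elements. -/
theorem exists_linear_forms {B : Type*} [CommRing B] [Algebra 𝕂 B]
    (ha : ∀ i k : Fin (r+1), i ≠ k → LinearIndependent 𝕂 ![a i, a k]) (hr : 1 ≤ r)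
    (y : Fin (r+1) → B)
    (hy : ∀ i j k : Fin (r+1), (j : ℕ) = i + 1 → (k : ℕ) = i + 2 →
      alpha 𝕂 r a j k • y i + alpha 𝕂 r a k i • y j + alpha 𝕂 r a i j • y k = 0) :
    ∃ u v : B, ∀ i, y i = (a i).1 • u + (a i).2 • v := by
  let i₀ : Fin (r+1) := ⟨0, by omega⟩
  let i₁ : Fin (r+1) := ⟨1, by omega⟩
  have h01 : alpha 𝕂 r a i₀ i₁ ≠ 0 := alpha_ne_zero ha (by simp [i₀, i₁])
  let u : B := (alpha 𝕂 r a i₀ i₁)⁻¹ • ((a i₁).2 • y i₀ - (a i₀).2 • y i₁)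
  let v : B := (alpha 𝕂 r a i₀ i₁)⁻¹ • ((a i₀).1 • y i₁ - (a i₁).1 • y i₀)
  have hu : alpha 𝕂 r a i₀ i₁ • u = (a i₁).2 • y i₀ - (a i₀).2 • y i₁ := smul_inv_smul₀ h01 _
  have hv : alpha 𝕂 r a i₀ i₁ • v = (a i₀).1 • y i₁ - (a i₁).1 • y i₀ := smul_inv_smul₀ h01 _
  have key : ∀ k : ℕ, ∀ hk : k < r + 1,
      y ⟨k, hk⟩ = (a ⟨k, hk⟩).1 • u + (a ⟨k, hk⟩).2 • v := by
    intro k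
    induction k using Nat.strong_induction_on with
    | _ k ih =>
      intro hk
      rcases k with _ | _ | k
      · refine smul_right_injective B h01 ?_
        change alpha 𝕂 r a i₀ i₁ • y i₀ =
          alpha 𝕂 r a i₀ i₁ • ((a i₀).1 • u + (a i₀).2 • v)
        rw [smul_add, smul_comm _ (a i₀).1, smul_comm _ (a i₀).2, hu, hv, alpha]
        module
      · refine smul_right_injective B h01 ?_
        change alpha 𝕂 r a i₀ i₁ • y i₁ =
          alpha 𝕂 r a i₀ i₁ • ((a i₁).1 • u + (a i₁).2 • v)
        rw [smul_add, smul_comm _ (a i₁).1, smul_comm _ (a i₁).2, hu, hv, alpha]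
        module
      · have e0 := ih k (by omega) (by omega)
        have e1 := ih (k+1) (by omega) (by omega)
        have hrel := hy ⟨k, by omega⟩ ⟨k+1, by omega⟩ ⟨k+2, hk⟩ rfl rfl
        rw [e0, e1] at hrel
        refine smul_right_injective B (alpha_ne_zero ha
          (i := ⟨k, by omega⟩) (k := ⟨k+1, by omega⟩) (by simp)) ?_
        change alpha 𝕂 r a ⟨k, by omega⟩ ⟨k+1, by omega⟩ • y ⟨k+2, hk⟩ = _ • (_ + _)
        rw [eq_neg_of_add_eq_zero_right hrel]
        simp only [alpha]
        module
  exact ⟨u, v, fun i => key i i.2⟩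

theorem trinomial_of_linear_forms {B : Type*} [CommRing B] [Algebra 𝕂 B] {y : Fin (r+1) → B}
    {u v : B} (h : ∀ i, y i = (a i).1 • u + (a i).2 • v) (i j k : Fin (r+1)) :
    alpha 𝕂 r a j k • y i + alpha 𝕂 r a k i • y j + alpha 𝕂 r a i j • y k = 0 := by
  rw [h i, h j, h k]
  simp only [alpha]
  module

theorem map_rename_gPoly {B : Type*} [CommRing B] [Algebra 𝕂 B]
    (φ : MvPolynomial (IdxE r n m) 𝕂 →ₐ[𝕂] B) (i j k : Fin (r+1)) :
    φ (rename Sum.inl (gPoly 𝕂 r a n l i j k)) =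
      alpha 𝕂 r a j k • φ (monomial (blockExp l m i) 1) +
      alpha 𝕂 r a k i • φ (monomial (blockExp l m j) 1) +
      alpha 𝕂 r a i j • φ (monomial (blockExp l m k) 1) := by
  simp only [gPoly, map_add, map_mul, ← rename_mono, ← algebraMap_eq, AlgHom.commutes,
    Algebra.smul_def]

/-- All trinomials `g_{i,j,k}` lie in the ideal generated by the consecutive ones. -/
theorem rename_gPoly_mem (ha : ∀ i k : Fin (r+1), i ≠ k → LinearIndependent 𝕂 ![a i, a k])
    (hr : 1 ≤ r) (i j k : Fin (r+1)) :
    rename Sum.inl (gPoly 𝕂 r a n l i j k) ∈ relIdealE 𝕂 r a n l m := by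
  let φ := Ideal.Quotient.mkₐ 𝕂 (relIdealE 𝕂 r a n l m)
  obtain ⟨u, v, huv⟩ := exists_linear_forms ha hr
    (fun i => φ (monomial (blockExp l m i) 1)) fun i j k hj hk => by
      rw [← map_rename_gPoly]
      exact Ideal.Quotient.eq_zero_iff_mem.2 (Ideal.subset_span ⟨i, j, k, hj, hk, rfl⟩)
  refine Ideal.Quotient.eq_zero_iff_mem.1 ?_
  change φ _ = 0
  rw [map_rename_gPoly]
  exact trinomial_of_linear_forms huv i j k

theorem map_eq_zero_of_linear_forms {B : Type*} [CommRing B] [Algebra 𝕂 B]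
    (φ : MvPolynomial (IdxE r n m) 𝕂 →ₐ[𝕂] B)
    (h : ∃ u v : B, ∀ i, φ (monomial (blockExp l m i) 1) = (a i).1 • u + (a i).2 • v)
    {p : MvPolynomial (IdxE r n m) 𝕂} (hp : p ∈ relIdealE 𝕂 r a n l m) : φ p = 0 := by
  obtain ⟨u, v, huv⟩ := h
  have hle : relIdealE 𝕂 r a n l m ≤ RingHom.ker φ := by
    rw [relIdealE, Ideal.span_le]
    rintro _ ⟨i, j, k, -, -, rfl⟩
    rw [SetLike.mem_coe, RingHom.mem_ker, map_rename_gPoly]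
    exact trinomial_of_linear_forms huv i j k
  exact hle hp

theorem isWeightedHomogeneous_rename_gPoly (i j k : Fin (r+1)) :
    (rename Sum.inl (gPoly 𝕂 r a n l i j k)).IsWeightedHomogeneous (wKdot r n l m s d d')
      (Finsupp.weight (wKdot r n l m s d d') (blockExp l m 0)) := by
  have hm : ∀ i, (monomial (blockExp l m i) (1 : 𝕂)).IsWeightedHomogeneous (wKdot r n l m s d d')
      (Finsupp.weight (wKdot r n l m s d d') (blockExp l m 0)) := fun i =>
    isWeightedHomogeneous_monomial _ _ _ (weight_blockExp i)
  simp only [gPoly, map_add, map_mul, rename_C, rename_mono]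
  exact (((hm i).C_mul _).add ((hm j).C_mul _)).add ((hm k).C_mul _)

/-- The weighted homogeneous components of an element of the relation ideal lie in it. -/
theorem weightedHomogeneousComponent_mem_relIdealE {p : MvPolynomial (IdxE r n m) 𝕂}
    (hp : p ∈ relIdealE 𝕂 r a n l m) (δ : KdotGrp r n l m s d d') :
    weightedHomogeneousComponent (wKdot r n l m s d d') δ p ∈ relIdealE 𝕂 r a n l m := by
  classical
  let _ := weightedGradedAlgebra 𝕂 (wKdot r n l m s d d')
  refine weightedHomogeneousComponent_mem_of_mem 𝕂 (wKdot r n l m s d d') ?_ hp δ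
  refine Ideal.homogeneous_span _ _ ?_
  rintro _ ⟨i, j, k, -, -, rfl⟩
  exact ⟨_, isWeightedHomogeneous_rename_gPoly i j k⟩

end Relations

section NormalForm

variable {r : ℕ} {n : Fin (r+1) → ℕ} {l : ∀ i : Fin (r+1), Fin (n i) → ℕ}
variable {m s : ℕ} {d : Fin s → Idx r n → ℤ} {d' : Fin s → Fin m → ℤ}
variable {𝕂 : Type} [Field 𝕂] {a : Fin (r+1) → 𝕂 × 𝕂}

variable (l d d' 𝕂) in
/-- The homogeneous polynomials of degree `δ` with normal exponents. -/
noncomputable def normalSubmodule (p q : Fin (r+1)) (δ : KdotGrp r n l m s d d') :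
    Submodule 𝕂 (MvPolynomial (IdxE r n m) 𝕂) :=
  weightedHomogeneousSubmodule 𝕂 (wKdot r n l m s d d') δ ⊓
    restrictSupport 𝕂 {e | IsNormalExp l p q e}

theorem monomial_mem_normalSubmodule_sup
    (ha : ∀ i k : Fin (r+1), i ≠ k → LinearIndependent 𝕂 ![a i, a k]) (hr : 1 ≤ r)
    (hn : ∀ i, 0 < n i) (hl : ∀ i j, 0 < l i j) {p q : Fin (r+1)} (hpq : p ≠ q)
    (δ : KdotGrp r n l m s d d') (e : IdxE r n m →₀ ℕ)
    (he : Finsupp.weight (wKdot r n l m s d d') e = δ) :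
    monomial e (1 : 𝕂) ∈
      normalSubmodule l d d' 𝕂 p q δ ⊔ (relIdealE 𝕂 r a n l m).restrictScalars 𝕂 := by
  let μ : (IdxE r n m →₀ ℕ) → ℕ := fun e =>
    ∑ x : Idx r n, if x.1 = p ∨ x.1 = q then 0 else e (Sum.inl x)
  have hμ : ∀ e f, μ (e + f) = μ e + μ f := by
    intro e f
    simp only [μ, ← Finset.sum_add_distrib]
    refine Finset.sum_congr rfl fun x _ => ?_
    split_ifs <;> simp
  have hμ0 : ∀ i, i = p ∨ i = q → μ (blockExp l m i) = 0 := by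
    intro i hi
    refine Finset.sum_eq_zero fun x _ => ?_
    split_ifs with h
    · rfl
    · rw [blockExp_inl, if_neg]
      rintro rfl
      exact h hi
  induction hk : μ e using Nat.strong_induction_on generalizing e with
  | _ k ih =>
    by_cases hne : IsNormalExp l p q e
    · refine Submodule.mem_sup_left ⟨isWeightedHomogeneous_monomial _ _ _ he, ?_⟩
      refine (mem_restrictSupport_iff 𝕂).2 fun e' he' => ?_
      rwa [Finset.mem_singleton.1 (support_monomial_subset he')]
    · simp only [IsNormalExp, not_forall, not_exists, not_lt] at hne
      obtain ⟨i, hip, hiq, hi⟩ := hne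
      obtain ⟨f, rfl⟩ : ∃ f, e = f + blockExp l m i := by
        refine ⟨e - blockExp l m i, (tsub_add_cancel_of_le ?_).symm⟩
        rintro (⟨i', j⟩ | k)
        · rw [blockExp_inl]
          split_ifs with h
          · obtain rfl : i' = i := h
            exact hi j
          · exact Nat.zero_le _
        · exact Nat.zero_le _
      have hpos : 0 < μ (blockExp l m i) := by
        refine lt_of_lt_of_le (hl i ⟨0, hn i⟩) (le_trans ?_ (Finset.single_le_sum
          (fun _ _ => Nat.zero_le _) (Finset.mem_univ (⟨i, ⟨0, hn i⟩⟩ : Idx r n))))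
        simp [hip, hiq, blockExp_inl]
      have hlow : ∀ i', i' = p ∨ i' = q → monomial (f + blockExp l m i') (1 : 𝕂) ∈
          normalSubmodule l d d' 𝕂 p q δ ⊔ (relIdealE 𝕂 r a n l m).restrictScalars 𝕂 := by
        intro i' hi'
        refine ih _ ?_ _ ?_ rfl
        · rw [← hk, hμ, hμ, hμ0 i' hi']
          omega
        · rw [← he, map_add, map_add, weight_blockExp, weight_blockExp i]
      have hmul : ∀ i', monomial (f + blockExp l m i') (1 : 𝕂) =
          monomial f 1 * monomial (blockExp l m i') 1 := fun i' => by
        rw [monomial_mul, one_mul]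
      have hα : alpha 𝕂 r a p q ≠ 0 := alpha_ne_zero ha hpq
      have hrel : monomial f 1 * rename Sum.inl (gPoly 𝕂 r a n l p q i) ∈
          relIdealE 𝕂 r a n l m := Ideal.mul_mem_left _ _ (rename_gPoly_mem ha hr p q i)
      have hid := map_rename_gPoly (a := a) (l := l) (AlgHom.id 𝕂 (MvPolynomial (IdxE r n m) 𝕂))
        p q i
      simp only [AlgHom.id_apply] at hid
      rw [hid, mul_add, mul_add, mul_smul_comm, mul_smul_comm, mul_smul_comm, ← hmul, ← hmul,
        ← hmul] at hrel
      refine (Submodule.smul_mem_iff _ hα).1 ?_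
      refine (Submodule.add_mem_iff_right _ (add_mem (Submodule.smul_mem _ _ (hlow p (Or.inl rfl)))
        (Submodule.smul_mem _ _ (hlow q (Or.inr rfl))))).1 (Submodule.mem_sup_right hrel)

/-- Modulo the relation ideal, every homogeneous polynomial is homogeneous with normal exponents. -/
theorem exists_normal_form
    (ha : ∀ i k : Fin (r+1), i ≠ k → LinearIndependent 𝕂 ![a i, a k]) (hr : 1 ≤ r)
    (hn : ∀ i, 0 < n i) (hl : ∀ i j, 0 < l i j) {p q : Fin (r+1)} (hpq : p ≠ q)
    {δ : KdotGrp r n l m s d d'} {P : MvPolynomial (IdxE r n m) 𝕂}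
    (hP : P.IsWeightedHomogeneous (wKdot r n l m s d d') δ) :
    ∃ P', P - P' ∈ relIdealE 𝕂 r a n l m ∧
      P'.IsWeightedHomogeneous (wKdot r n l m s d d') δ ∧
      ∀ e ∈ P'.support, IsNormalExp l p q e := by
  have hmem : P ∈
      normalSubmodule l d d' 𝕂 p q δ ⊔ (relIdealE 𝕂 r a n l m).restrictScalars 𝕂 := by
    rw [P.as_sum]
    refine sum_mem fun e he => ?_
    rw [← mul_one (coeff e P), ← smul_eq_mul, ← smul_monomial]
    exact Submodule.smul_mem _ _ (monomial_mem_normalSubmodule_sup ha hr hn hl hpq δ e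
      (hP (mem_support_iff.1 he)))
  obtain ⟨P', ⟨h1, h2⟩, z, hz, rfl⟩ := Submodule.mem_sup.1 hmem
  exact ⟨P', by simpa using hz, h1, fun e he => by simpa using h2 he⟩

end NormalForm

section LaurentSums

variable {r s : ℕ} {𝕂 Ω : Type*} [Field 𝕂] [Field Ω] [Algebra 𝕂 Ω]
  [Algebra (MvPolynomial (Fin s) (Polynomial 𝕂)) Ω]
  [IsScalarTower 𝕂 (MvPolynomial (Fin s) (Polynomial 𝕂)) Ω]

variable (s) in
/-- The values of a character on the rows of `Ṗ`. -/
noncomputable def rowVal (ρ : Fin r → Polynomial 𝕂) :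
    Fin r ⊕ Fin s → MvPolynomial (Fin s) (Polynomial 𝕂) :=
  Sum.elim (fun i => C (ρ i)) X

theorem rowVal_ne_zero {ρ : Fin r → Polynomial 𝕂} (hρ : ∀ i, ρ i ≠ 0) (i : Fin r ⊕ Fin s) :
    rowVal s ρ i ≠ 0 := by
  rcases i with i | k
  · simpa [rowVal] using hρ i
  · exact X_ne_zero k

theorem exists_nat_shift {ι κ : Type*} [Fintype κ] (E : Finset ι) (w : ι → κ → ℤ) :
    ∃ (B : ℕ) (v : ι → κ → ℕ), ∀ e ∈ E, ∀ i, (v e i : ℤ) = w e i + B := by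
  refine ⟨∑ e ∈ E, ∑ i, (w e i).natAbs,
    fun e i => (w e i + (∑ e ∈ E, ∑ i, (w e i).natAbs : ℕ)).toNat, fun e he i => ?_⟩
  have h1 : (w e i).natAbs ≤ ∑ i, (w e i).natAbs :=
    Finset.single_le_sum (f := fun i => (w e i).natAbs) (fun _ _ => Nat.zero_le _)
      (Finset.mem_univ i)
  have h2 : ∑ i, (w e i).natAbs ≤ ∑ e ∈ E, ∑ i, (w e i).natAbs :=
    Finset.single_le_sum (f := fun e => ∑ i, (w e i).natAbs) (fun _ _ => Nat.zero_le _) he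
  dsimp only
  omega

theorem prod_zpow_add_eq {κ : Type*} [Fintype κ] {u : κ → Ω} (hu : ∀ i, u i ≠ 0) {w : κ → ℤ}
    {v : κ → ℕ} {B : ℕ} (h : ∀ i, (v i : ℤ) = w i + B) :
    ∏ i, u i ^ v i = (∏ i, u i ^ w i) * ∏ i, u i ^ B := by
  rw [← Finset.prod_mul_distrib]
  refine Finset.prod_congr rfl fun i _ => ?_
  rw [← zpow_natCast, h i, zpow_add₀ (hu i), zpow_natCast]

theorem sum_filter_prod_zpow_eq_zero
    (hinj : Function.Injective (algebraMap (MvPolynomial (Fin s) (Polynomial 𝕂)) Ω))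
    {ρ : Fin r → Polynomial 𝕂} (hρ : ∀ i, ρ i ≠ 0) {ι : Type*} (E : Finset ι)
    (w : ι → Fin r ⊕ Fin s → ℤ) (c : ι → 𝕂)
    (h : ∑ e ∈ E, c e • ∏ i, (algebraMap _ Ω (rowVal s ρ i)) ^ w e i = 0) :
    ∑ e ∈ E with ∀ k, w e (Sum.inr k) = 0,
      c e • ∏ i, (algebraMap _ Ω (rowVal s ρ (Sum.inl i))) ^ w e (Sum.inl i) = 0 := by
  classical
  obtain ⟨B, v, hv⟩ := exists_nat_shift E w
  have hne : ∀ i, algebraMap _ Ω (rowVal s ρ i) ≠ 0 := fun i =>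
    (map_ne_zero_iff _ hinj).2 (rowVal_ne_zero hρ i)
  have h1 : ∑ e ∈ E, c e • ∏ i, rowVal s ρ i ^ v e i = 0 := by
    apply hinj
    rw [map_zero, map_sum, ← zero_mul (∏ i, (algebraMap _ Ω (rowVal s ρ i)) ^ B), ← h,
      Finset.sum_mul]
    refine Finset.sum_congr rfl fun e he => ?_
    rw [algebraMap.smul, map_prod, smul_mul_assoc, ← prod_zpow_add_eq hne (hv e he)]
    simp only [map_pow]
  let b : Fin s →₀ ℕ := Finsupp.equivFunOnFinite.symm fun _ => B
  have h2 : ∀ e ∈ E, coeff b (c e • ∏ i, rowVal s ρ i ^ v e i) =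
      if ∀ k, w e (Sum.inr k) = 0 then c e • ∏ i, ρ i ^ v e (Sum.inl i) else 0 := by
    intro e he
    have h3 : ∏ i, rowVal s ρ i ^ v e i = monomial
        (Finsupp.equivFunOnFinite.symm fun k => v e (Sum.inr k)) (∏ i, ρ i ^ v e (Sum.inl i)) := by
      rw [monomial_eq, Fintype.prod_sum_type, Finsupp.prod_fintype _ _ (by simp)]
      simp [rowVal]
    rw [h3, coeff_smul, coeff_monomial, smul_ite, smul_zero]
    refine if_congr ?_ rfl rfl
    rw [Equiv.apply_eq_iff_eq, funext_iff]
    refine forall_congr' fun k => ?_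
    have := hv e he (Sum.inr k)
    omega
  have h4 := congrArg (coeff b) h1
  rw [coeff_sum, Finset.sum_congr rfl h2, ← Finset.sum_filter, coeff_zero] at h4
  have h5 := congrArg (fun z => algebraMap _ Ω (C z : MvPolynomial (Fin s) (Polynomial 𝕂))) h4
  simp only [map_sum, map_zero] at h5
  have h6 : (∏ i, (algebraMap _ Ω (rowVal s ρ (Sum.inl i))) ^ B) ≠ 0 :=
    Finset.prod_ne_zero_iff.2 fun i _ => pow_ne_zero _ (hne _)
  refine (mul_eq_zero.1 ?_).resolve_right h6
  rw [Finset.sum_mul, ← h5]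
  refine Finset.sum_congr rfl fun e he => ?_
  rw [smul_mul_assoc, ← prod_zpow_add_eq (fun i => hne (Sum.inl i))
    fun i => hv e (Finset.mem_filter.1 he).1 (Sum.inl i)]
  rw [C_eq_smul_one, smul_assoc, algebraMap.smul, ← C_eq_smul_one]
  simp only [map_prod, map_pow]
  rfl

theorem coeff_eq_zero_of_sum_zpow_eq_zero
    (hinj : Function.Injective (algebraMap (MvPolynomial (Fin s) (Polynomial 𝕂)) Ω))
    {ι : Type*} (E : Finset ι) (k : ι → ℤ) (c : ι → 𝕂)
    (h : ∑ e ∈ E, c e • (algebraMap (MvPolynomial (Fin s) (Polynomial 𝕂)) Ω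
      (C Polynomial.X)) ^ k e = 0) {e₀ : ι} (he₀ : e₀ ∈ E)
    (hk₀ : k e₀ = 0) (hk : ∀ e ∈ E, k e = 0 → e = e₀) : c e₀ = 0 := by
  classical
  obtain ⟨B, v, hv⟩ := exists_nat_shift E fun e (_ : Unit) => k e
  have hne : algebraMap (MvPolynomial (Fin s) (Polynomial 𝕂)) Ω (C Polynomial.X) ≠ 0 :=
    (map_ne_zero_iff _ hinj).2 (by simp)
  have h1 : ∑ e ∈ E, c e • (Polynomial.X : Polynomial 𝕂) ^ v e () = 0 := by
    apply C_injective (Fin s) (Polynomial 𝕂)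
    apply hinj
    rw [map_zero, map_zero, map_sum, map_sum, ← zero_mul ((algebraMap
      (MvPolynomial (Fin s) (Polynomial 𝕂)) Ω (C Polynomial.X)) ^ B), ← h, Finset.sum_mul]
    refine Finset.sum_congr rfl fun e he => ?_
    rw [C_eq_smul_one, smul_assoc, algebraMap.smul, ← C_eq_smul_one, map_pow, map_pow,
      smul_mul_assoc, ← zpow_natCast, ← zpow_natCast, ← zpow_add₀ hne, hv e he]
  have h2 := congrArg (Polynomial.coeff · B) h1
  simp only [Polynomial.finsetSum_coeff, Polynomial.coeff_smul, Polynomial.coeff_X_pow,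
    Polynomial.coeff_zero] at h2
  rw [Finset.sum_eq_single e₀] at h2
  · have := hv e₀ he₀ ()
    rw [hk₀, zero_add, Nat.cast_inj] at this
    simpa [this] using h2
  · intro e he hne'
    have h3 : B ≠ v e () := fun h3 => hne' (hk e he (by have := hv e he (); omega))
    simp [h3]
  · exact fun h3 => absurd he₀ h3

end LaurentSums

section Evaluation

variable {r : ℕ} {n : Fin (r+1) → ℕ} {l : ∀ i : Fin (r+1), Fin (n i) → ℕ}
variable {m s : ℕ} {d : Fin s → Idx r n → ℤ} {d' : Fin s → Fin m → ℤ}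
variable {𝕂 : Type} [Field 𝕂] {a : Fin (r+1) → 𝕂 × 𝕂}
variable {Ω : Type*} [Field Ω] [Algebra 𝕂 Ω]

theorem addChar_map_sum {A M κ : Type*} [AddCommMonoid A] [CommMonoid M] (ψ : AddChar A M)
    (E : Finset κ) (f : κ → A) : ψ (∑ i ∈ E, f i) = ∏ i ∈ E, ψ (f i) := by
  classical
  induction E using Finset.induction_on with
  | empty => simp
  | insert i E hi ih => rw [Finset.sum_insert hi, Finset.prod_insert hi, ψ.map_add_eq_mul, ih]

theorem addChar_rowComb (χ : AddChar (IdxE r n m → ℤ) Ω) (w : Fin r ⊕ Fin s → ℤ) :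
    χ (rowComb r n l m s d d' w) = ∏ i, χ (PdotRow r n l m s d d' i) ^ w i := by
  rw [rowComb, Fintype.linearCombination_apply, addChar_map_sum]
  simp only [AddChar.map_zsmul_eq_zpow]

variable (𝕂) in
open Classical in
/-- The evaluation at the point given by the character `χ`, with the coordinates in `Z` replaced
by zero. -/
noncomputable def evChar (Z : Set (IdxE r n m)) (χ : AddChar (IdxE r n m → ℤ) Ω) :
    MvPolynomial (IdxE r n m) 𝕂 →ₐ[𝕂] Ω :=
  aeval fun x => if x ∈ Z then 0 else χ (Pi.single x 1)

theorem evChar_monomial {Z : Set (IdxE r n m)} (χ : AddChar (IdxE r n m → ℤ) Ω)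
    {e : IdxE r n m →₀ ℕ} (he : ∀ x ∈ Z, e x = 0) (c : 𝕂) :
    evChar 𝕂 Z χ (monomial e c) = c • χ (expZ e) := by
  have h : expZ e = ∑ x, e x • (Pi.single x 1 : IdxE r n m → ℤ) := by
    ext y
    simp [expZ, Finset.sum_apply, Pi.single_apply]
  rw [evChar, aeval_monomial, ← Algebra.smul_def, h, addChar_map_sum,
    Finsupp.prod_fintype _ _ (by simp)]
  refine congrArg _ (Finset.prod_congr rfl fun x _ => ?_)
  rw [AddChar.map_nsmul_eq_pow]
  split_ifs with hx
  · simp [he x hx]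
  · rfl

theorem evChar_monomial_eq_zero {Z : Set (IdxE r n m)} (χ : AddChar (IdxE r n m → ℤ) Ω)
    {e : IdxE r n m →₀ ℕ} {x : IdxE r n m} (hx : x ∈ Z) (he : e x ≠ 0) (c : 𝕂) :
    evChar 𝕂 Z χ (monomial e c) = 0 := by
  rw [evChar, aeval_monomial, Finsupp.prod_fintype _ _ (by simp),
    Finset.prod_eq_zero (Finset.mem_univ x) (by simp [hx, he]), mul_zero]

variable [Algebra (MvPolynomial (Fin s) (Polynomial 𝕂)) Ω]
  [IsScalarTower 𝕂 (MvPolynomial (Fin s) (Polynomial 𝕂)) Ω]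

/-- A homogeneous polynomial that vanishes at a sufficiently general point lies in the ideal. -/
theorem mem_sup_of_evChar_eq_zero
    (ha : ∀ i k : Fin (r+1), i ≠ k → LinearIndependent 𝕂 ![a i, a k]) (hr : 1 ≤ r)
    (hn : ∀ i, 0 < n i) (hl : ∀ i j, 0 < l i j)
    (hinj : Function.Injective (algebraMap (MvPolynomial (Fin s) (Polynomial 𝕂)) Ω))
    {ρ : Fin r → Polynomial 𝕂} (hρ : ∀ i, ρ i ≠ 0) {χ : AddChar (IdxE r n m → ℤ) Ω}
    (hχ : ∀ i, χ (PdotRow r n l m s d d' i) = algebraMap _ Ω (rowVal s ρ i))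
    {Z : Set (IdxE r n m)} (hI : ∀ P ∈ relIdealE 𝕂 r a n l m, evChar 𝕂 Z χ P = 0)
    {p q : Fin (r+1)} (hpq : p ≠ q)
    (hZ : ∀ e e' : IdxE r n m →₀ ℕ, IsNormalExp l p q e → IsNormalExp l p q e' →
      (∀ x ∈ Z, e x = 0) → (∀ x ∈ Z, e' x = 0) → ∀ w, (∀ k, w (Sum.inr k) = 0) →
      expZ e = expZ e' + rowComb r n l m s d d' w →
      ∃ k : ℤ, ∏ i, algebraMap _ Ω (rowVal s ρ (Sum.inl i)) ^ w (Sum.inl i) =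
        (algebraMap (MvPolynomial (Fin s) (Polynomial 𝕂)) Ω (C Polynomial.X)) ^ k ∧
        (k = 0 → e = e'))
    {δ : KdotGrp r n l m s d d'} {P : MvPolynomial (IdxE r n m) 𝕂}
    (hP : P.IsWeightedHomogeneous (wKdot r n l m s d d') δ) (h0 : evChar 𝕂 Z χ P = 0) :
    P ∈ relIdealE 𝕂 r a n l m ⊔ Ideal.span (X '' Z) := by
  classical
  obtain ⟨P', hPP', hP', hnorm⟩ := exists_normal_form ha hr hn hl hpq hP
  rw [← sub_add_cancel P P']
  refine add_mem (Ideal.mem_sup_left hPP') (Ideal.mem_sup_right ?_)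
  have h0' : evChar 𝕂 Z χ P' = 0 := by
    rw [← h0, ← sub_eq_zero, ← map_sub, ← neg_sub, map_neg, hI _ hPP', neg_zero]
  refine mem_ideal_span_X_image.2 fun e₀ he₀ => ?_
  by_contra! hfree₀
  let E := P'.support.filter fun e => ∀ x ∈ Z, e x = 0
  have hE : ∀ e ∈ E, e ∈ P'.support ∧ ∀ x ∈ Z, e x = 0 := fun e he => Finset.mem_filter.1 he
  have he₀E : e₀ ∈ E := Finset.mem_filter.2 ⟨he₀, hfree₀⟩
  have h1 : ∑ e ∈ E, coeff e P' • χ (expZ e) = 0 := by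
    rw [← h0', P'.as_sum, map_sum, Finset.sum_filter, ← P'.as_sum]
    refine Finset.sum_congr rfl fun e _ => ?_
    split_ifs with h
    · exact (evChar_monomial χ h _).symm
    · push Not at h
      obtain ⟨x, hx, hex⟩ := h
      exact (evChar_monomial_eq_zero χ hx hex _).symm
  have hw : ∀ e, ∃ w, (e ∈ E → expZ e = expZ e₀ + rowComb r n l m s d d' w) ∧
      (e = e₀ → w = 0) := by
    intro e
    by_cases h : e = e₀
    · exact ⟨0, by simp [h], fun _ => rfl⟩
    by_cases heE : e ∈ E
    · obtain ⟨w, hw⟩ := (Qdot_eq_iff (expZ e) (expZ e₀)).1 (by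
        rw [← weight_wKdot, ← weight_wKdot, hP' (mem_support_iff.1 (hE e heE).1),
          hP' (mem_support_iff.1 he₀)])
      exact ⟨w, fun _ => hw, fun h' => absurd h' h⟩
    · exact ⟨0, fun h' => absurd h' heE, fun _ => rfl⟩
  choose w hw hw0 using hw
  have h2 : ∑ e ∈ E, coeff e P' • ∏ i, (algebraMap _ Ω (rowVal s ρ i)) ^ w e i = 0 := by
    refine (mul_eq_zero.1 ?_).resolve_left (χ.val_isUnit (expZ e₀)).ne_zero
    rw [← h1, Finset.mul_sum]
    refine Finset.sum_congr rfl fun e he => ?_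
    rw [hw e he, χ.map_add_eq_mul, addChar_rowComb, mul_smul_comm]
    simp only [hχ]
  have h3 := sum_filter_prod_zpow_eq_zero hinj hρ E w _ h2
  have hk : ∀ e, ∃ k : ℤ, (e ∈ E → (∀ i, w e (Sum.inr i) = 0) →
      ∏ i, algebraMap _ Ω (rowVal s ρ (Sum.inl i)) ^ w e (Sum.inl i) =
        (algebraMap (MvPolynomial (Fin s) (Polynomial 𝕂)) Ω (C Polynomial.X)) ^ k ∧
        (k = 0 → e = e₀)) ∧ (e = e₀ → k = 0) := by
    intro e
    by_cases h : e = e₀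
    · exact ⟨0, fun _ _ => ⟨by simp [hw0 e h], fun _ => h⟩, fun _ => rfl⟩
    by_cases heE : e ∈ E ∧ ∀ i, w e (Sum.inr i) = 0
    · obtain ⟨k, hk⟩ := hZ e e₀ (hnorm e (hE e heE.1).1) (hnorm e₀ he₀) (hE e heE.1).2 hfree₀
        (w e) heE.2 (hw e heE.1)
      exact ⟨k, fun _ _ => hk, fun h' => absurd h' h⟩
    · exact ⟨0, fun h1 h2 => absurd ⟨h1, h2⟩ heE, fun _ => rfl⟩
  choose k hk hk0 using hk
  refine mem_support_iff.1 he₀ (coeff_eq_zero_of_sum_zpow_eq_zero (s := s) hinj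
    (E.filter fun e => ∀ i, w e (Sum.inr i) = 0) k (fun e => coeff e P') ?_
    (Finset.mem_filter.2 ⟨he₀E, by simp [hw0 e₀ rfl]⟩) (hk0 _ rfl) fun e he hke => ?_)
  · rw [← h3]
    refine Finset.sum_congr rfl fun e he => ?_
    obtain ⟨h4, h5⟩ := Finset.mem_filter.1 he
    rw [(hk e h4 h5).1]
  · obtain ⟨h4, h5⟩ := Finset.mem_filter.1 he
    exact (hk e h4 h5).2 hke

end Evaluation

section TestPoints

variable {r : ℕ} {n : Fin (r+1) → ℕ} {l : ∀ i : Fin (r+1), Fin (n i) → ℕ}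
variable {m s : ℕ} {d : Fin s → Idx r n → ℤ} {d' : Fin s → Fin m → ℤ}
variable {𝕂 : Type} [Field 𝕂] {a : Fin (r+1) → 𝕂 × 𝕂}
variable {Ω : Type*} [Field Ω] [Algebra (MvPolynomial (Fin s) (Polynomial 𝕂)) Ω]

theorem exists_addChar_row_eq [IsAlgClosed Ω] [CharZero Ω]
    (hcone : ∀ v : Fin r ⊕ Fin s → ℚ, ∃ c : IdxE r n m → ℚ, (∀ x, 0 ≤ c x) ∧
      ∀ rw, v rw = ∑ x : IdxE r n m, c x * (PdotCol r n l m s d d' x rw : ℚ))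
    (hinj : Function.Injective (algebraMap (MvPolynomial (Fin s) (Polynomial 𝕂)) Ω))
    {ρ : Fin r → Polynomial 𝕂} (hρ : ∀ i, ρ i ≠ 0) :
    ∃ χ : AddChar (IdxE r n m → ℤ) Ω,
      ∀ i, χ (PdotRow r n l m s d d' i) = algebraMap _ Ω (rowVal s ρ i) := by
  refine exists_addChar_extension _ (fun w hw => eq_zero_of_rowComb_nonneg hcone w ?_) _
    fun i => (map_ne_zero_iff _ hinj).2 (rowVal_ne_zero hρ i)
  rw [rowComb, Fintype.linearCombination_apply, hw]

theorem addChar_expZ_blockExp {ρ : Fin r → Polynomial 𝕂} {χ : AddChar (IdxE r n m → ℤ) Ω}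
    (hχ : ∀ i, χ (PdotRow r n l m s d d' i) = algebraMap _ Ω (rowVal s ρ i)) (i : Fin (r+1)) :
    χ (expZ (blockExp l m i)) = χ (expZ (blockExp l m 0)) *
      algebraMap (MvPolynomial (Fin s) (Polynomial 𝕂)) Ω
        (C ((Fin.cons 1 ρ : Fin (r+1) → Polynomial 𝕂) i)) := by
  induction i using Fin.cases with
  | zero => simp
  | succ i =>
    rw [expZ_blockExp_succ (d := d) (d' := d'), χ.map_add_eq_mul, hχ]
    simp [rowVal]

theorem eq_zero_of_blockCoeff {w : Fin r ⊕ Fin s → ℤ} (hw : ∀ k, w (Sum.inr k) = 0)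
    (h : ∀ i : Fin r, blockCoeff w i.succ = 0) : w = 0 := by
  ext (i | k)
  · simpa [blockCoeff] using h i
  · exact hw k

variable (a) in
/-- The values on the rows of `P` of a general point: the values of the linear forms `a_1, …, a_r`
in coordinates where `a_0` has value `1` and `a_q` has value `t`. -/
noncomputable def genericRow (q : Fin (r+1)) (i : Fin r) : Polynomial 𝕂 :=
  Polynomial.C (alpha 𝕂 r a i.succ q / alpha 𝕂 r a 0 q) +
    Polynomial.C (alpha 𝕂 r a 0 i.succ / alpha 𝕂 r a 0 q) * Polynomial.X

theorem genericRow_ne_zero (ha : ∀ i k : Fin (r+1), i ≠ k → LinearIndependent 𝕂 ![a i, a k])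
    (q i : Fin r) : genericRow a q.succ i ≠ 0 := by
  intro h
  have h1 := congrArg (Polynomial.coeff · 1) h
  simp only [genericRow, Polynomial.coeff_add, Polynomial.coeff_C_mul, Polynomial.coeff_X_one,
    Polynomial.coeff_C_succ, Polynomial.coeff_zero, mul_one, zero_add] at h1
  exact div_ne_zero (alpha_ne_zero ha (Fin.succ_ne_zero _).symm)
    (alpha_ne_zero ha (Fin.succ_ne_zero _).symm) h1

theorem genericRow_self (ha : ∀ i k : Fin (r+1), i ≠ k → LinearIndependent 𝕂 ![a i, a k])
    (q : Fin r) : genericRow a q.succ q = Polynomial.X := by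
  have h0 : alpha 𝕂 r a q.succ q.succ = 0 := sub_self _
  rw [genericRow, h0, zero_div, map_zero, zero_add,
    div_self (alpha_ne_zero ha (Fin.succ_ne_zero _).symm), map_one, one_mul]

theorem genericRow_eq (ha : ∀ i k : Fin (r+1), i ≠ k → LinearIndependent 𝕂 ![a i, a k])
    (q : Fin r) : ∃ u v : Polynomial 𝕂, ∀ i,
      (Fin.cons 1 (genericRow a q.succ) : Fin (r+1) → Polynomial 𝕂) i =
        (a i).1 • u + (a i).2 • v := by
  have h0 : alpha 𝕂 r a 0 q.succ ≠ 0 := alpha_ne_zero ha (Fin.succ_ne_zero _).symm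
  refine ⟨Polynomial.C ((a q.succ).2 / alpha 𝕂 r a 0 q.succ) -
      Polynomial.C ((a 0).2 / alpha 𝕂 r a 0 q.succ) * Polynomial.X,
    -Polynomial.C ((a q.succ).1 / alpha 𝕂 r a 0 q.succ) +
      Polynomial.C ((a 0).1 / alpha 𝕂 r a 0 q.succ) * Polynomial.X, fun i => ?_⟩
  have h1 : (Fin.cons 1 (genericRow a q.succ) : Fin (r+1) → Polynomial 𝕂) i =
      Polynomial.C (alpha 𝕂 r a i q.succ / alpha 𝕂 r a 0 q.succ) +
      Polynomial.C (alpha 𝕂 r a 0 i / alpha 𝕂 r a 0 q.succ) * Polynomial.X := by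
    induction i using Fin.cases with
    | zero =>
      have h00 : alpha 𝕂 r a 0 0 = 0 := sub_self _
      rw [Fin.cons_zero, div_self h0, h00, zero_div, map_zero, map_one, zero_mul, add_zero]
    | succ i => rfl
  rw [h1, Polynomial.smul_eq_C_mul, Polynomial.smul_eq_C_mul]
  generalize alpha 𝕂 r a 0 q.succ = z
  simp only [alpha, div_eq_mul_inv, map_sub, map_mul]
  ring

variable [Algebra 𝕂 Ω]

theorem evChar_X {Z : Set (IdxE r n m)} (χ : AddChar (IdxE r n m → ℤ) Ω) {x : IdxE r n m}
    (hx : x ∉ Z) : evChar 𝕂 Z χ (X x) = χ (Pi.single x 1) := by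
  simp [evChar, hx]

theorem evChar_X_of_mem {Z : Set (IdxE r n m)} (χ : AddChar (IdxE r n m → ℤ) Ω) {x : IdxE r n m}
    (hx : x ∈ Z) : evChar 𝕂 Z χ (X x) = 0 := by
  simp [evChar, hx]

variable [IsScalarTower 𝕂 (MvPolynomial (Fin s) (Polynomial 𝕂)) Ω]

theorem evChar_inr_generic (ha : ∀ i k : Fin (r+1), i ≠ k → LinearIndependent 𝕂 ![a i, a k])
    (hr : 1 ≤ r) (hn : ∀ i, 0 < n i) (hl : ∀ i j, 0 < l i j)
    (hinj : Function.Injective (algebraMap (MvPolynomial (Fin s) (Polynomial 𝕂)) Ω))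
    {q : Fin r} {χ : AddChar (IdxE r n m → ℤ) Ω}
    (hχ : ∀ i, χ (PdotRow r n l m s d d' i) = algebraMap _ Ω (rowVal s (genericRow a q.succ) i))
    (S : Set (Fin m)) :
    (∀ P ∈ relIdealE 𝕂 r a n l m, evChar 𝕂 (Sum.inr '' S) χ P = 0) ∧
    ∀ (δ : KdotGrp r n l m s d d') (P : MvPolynomial (IdxE r n m) 𝕂),
      P.IsWeightedHomogeneous (wKdot r n l m s d d') δ → evChar 𝕂 (Sum.inr '' S) χ P = 0 →
      P ∈ relIdealE 𝕂 r a n l m ⊔ Ideal.span (X '' (Sum.inr '' S)) := by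
  have hI : ∀ P ∈ relIdealE 𝕂 r a n l m, evChar 𝕂 (Sum.inr '' S) χ P = 0 := by
    refine fun P => map_eq_zero_of_linear_forms _ ?_
    obtain ⟨u, v, huv⟩ := genericRow_eq ha q
    refine ⟨χ (expZ (blockExp l m 0)) * algebraMap _ Ω (C u : MvPolynomial (Fin s) (Polynomial 𝕂)),
      χ (expZ (blockExp l m 0)) * algebraMap _ Ω (C v : MvPolynomial (Fin s) (Polynomial 𝕂)),
      fun i => ?_⟩
    rw [evChar_monomial, one_smul, addChar_expZ_blockExp hχ, huv i, map_add, map_add, mul_add,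
      C_eq_smul_one, smul_assoc, algebraMap.smul, ← C_eq_smul_one, mul_smul_comm,
      C_eq_smul_one (a := (a i).2 • v), smul_assoc, algebraMap.smul, ← C_eq_smul_one,
      mul_smul_comm]
    rintro _ ⟨k, -, rfl⟩
    rfl
  refine ⟨hI, fun δ P hP h0 => mem_sup_of_evChar_eq_zero ha hr hn hl hinj
    (genericRow_ne_zero ha q) hχ hI (Fin.succ_ne_zero q).symm ?_ hP h0⟩
  intro e e' he he' _ _ w hw hee'
  have hb : ∀ i : Fin r, i ≠ q → w (Sum.inl i) = 0 := fun i hi =>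
    blockCoeff_eq_zero_of_isNormalExp he he' hw hee' (Fin.succ_ne_zero i)
      fun h => hi (Fin.succ_injective _ h)
  refine ⟨w (Sum.inl q), ?_, fun hk => ?_⟩
  · rw [Finset.prod_eq_single q (fun i _ hi => by rw [hb i hi, zpow_zero]) (by simp)]
    simp [rowVal, genericRow_self ha]
  · have hw0 : w = 0 := by
      ext (i | k)
      · rcases eq_or_ne i q with rfl | hi
        · exact hk
        · exact hb i hi
      · exact hw k
    rw [hw0, map_zero, add_zero] at hee'
    exact expZ_injective hee'

theorem exists_evChar_inl [IsAlgClosed Ω] [CharZero Ω]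
    (ha : ∀ i k : Fin (r+1), i ≠ k → LinearIndependent 𝕂 ![a i, a k])
    (hr : 1 ≤ r) (hn : ∀ i, 0 < n i) (hl : ∀ i j, 0 < l i j)
    (hcone : ∀ v : Fin r ⊕ Fin s → ℚ, ∃ c : IdxE r n m → ℚ, (∀ x, 0 ≤ c x) ∧
      ∀ rw, v rw = ∑ x : IdxE r n m, c x * (PdotCol r n l m s d d' x rw : ℚ))
    (hinj : Function.Injective (algebraMap (MvPolynomial (Fin s) (Polynomial 𝕂)) Ω))
    (x : Idx r n) :
    ∃ χ : AddChar (IdxE r n m → ℤ) Ω,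
    (∀ P ∈ relIdealE 𝕂 r a n l m, evChar 𝕂 {Sum.inl x} χ P = 0) ∧
    ∀ (δ : KdotGrp r n l m s d d') (P : MvPolynomial (IdxE r n m) 𝕂),
      P.IsWeightedHomogeneous (wKdot r n l m s d d') δ → evChar 𝕂 {Sum.inl x} χ P = 0 →
      P ∈ relIdealE 𝕂 r a n l m ⊔ Ideal.span (X '' {Sum.inl x}) := by
  obtain ⟨i₀, j₀⟩ := x
  let σ : Fin (r+1) → 𝕂 := fun i => if i = i₀ then 1 else alpha 𝕂 r a i₀ i
  have hσ : ∀ i, σ i ≠ 0 := by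
    intro i
    simp only [σ]
    split_ifs with h
    · exact one_ne_zero
    · exact alpha_ne_zero ha (Ne.symm h)
  let ρ : Fin r → Polynomial 𝕂 := fun i => Polynomial.C (σ i.succ / σ 0)
  have hρ : ∀ i, ρ i ≠ 0 := fun i => by simp [ρ, hσ]
  obtain ⟨χ, hχ⟩ := exists_addChar_row_eq hcone hinj hρ
  have hI : ∀ P ∈ relIdealE 𝕂 r a n l m, evChar 𝕂 {Sum.inl ⟨i₀, j₀⟩} χ P = 0 := by
    refine fun P => map_eq_zero_of_linear_forms _ ⟨(-(a i₀).2 / σ 0) • χ (expZ (blockExp l m 0)),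
      ((a i₀).1 / σ 0) • χ (expZ (blockExp l m 0)), fun i => ?_⟩
    rcases eq_or_ne i i₀ with rfl | hi
    · rw [evChar_monomial_eq_zero χ (Set.mem_singleton _) (by
        rw [blockExp_inl, if_pos rfl]
        exact (hl _ _).ne'), smul_smul, smul_smul, ← add_smul]
      rw [show (a i).1 * (-(a i).2 / σ 0) + (a i).2 * ((a i).1 / σ 0) = 0 by ring, zero_smul]
    · rw [evChar_monomial, one_smul, addChar_expZ_blockExp hχ]
      · have h1 : (Fin.cons 1 ρ : Fin (r+1) → Polynomial 𝕂) i = Polynomial.C (σ i / σ 0) := by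
          induction i using Fin.cases with
          | zero => simp [div_self (hσ 0)]
          | succ i => rfl
        have h2 : algebraMap (MvPolynomial (Fin s) (Polynomial 𝕂)) Ω
            (C (Polynomial.C (σ i / σ 0))) = algebraMap 𝕂 Ω (σ i / σ 0) :=
          (IsScalarTower.algebraMap_apply 𝕂 (MvPolynomial (Fin s) (Polynomial 𝕂)) Ω _).symm
        rw [h1, h2, mul_comm, ← Algebra.smul_def, smul_smul, smul_smul, ← add_smul]
        congr 1
        simp only [σ, if_neg hi, alpha]
        ring
      · rintro _ rfl
        rw [blockExp_inl, if_neg (Ne.symm hi)]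
  obtain ⟨i₁, hi₁⟩ : ∃ i₁, i₁ ≠ i₀ :=
    haveI : Nontrivial (Fin (r+1)) := Fin.nontrivial_iff_two_le.2 (by omega)
    exists_ne i₀
  refine ⟨χ, hI, fun δ P hP h0 => mem_sup_of_evChar_eq_zero ha hr hn hl hinj hρ hχ hI hi₁ ?_
    hP h0⟩
  intro e e' he he' hZ hZ' w hw hee'
  have hb : ∀ i, i ≠ i₁ → blockCoeff w i = 0 := by
    intro i hi
    rcases eq_or_ne i i₀ with rfl | hi'
    · have h1 := congrFun hee' (Sum.inl ⟨i, j₀⟩)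
      rw [Pi.add_apply, rowComb_inl hw, expZ, expZ, hZ _ rfl, hZ' _ rfl] at h1
      have h2 := hl i j₀
      have h3 : blockCoeff w i * (l i j₀ : ℤ) = 0 := by simpa using h1.symm
      exact (mul_eq_zero.1 h3).resolve_right (by exact_mod_cast h2.ne')
    · exact blockCoeff_eq_zero_of_isNormalExp he he' hw hee' hi hi'
  have hb₁ : blockCoeff w i₁ = 0 := by
    rw [← sum_blockCoeff w, Finset.sum_eq_single i₁ (fun i _ hi => hb i hi) (by simp)]
  obtain rfl : w = 0 := eq_zero_of_blockCoeff hw fun i => by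
    rcases eq_or_ne i.succ i₁ with h | h
    · rw [h, hb₁]
    · exact hb _ h
  rw [map_zero, add_zero] at hee'
  exact ⟨0, by simp, fun _ => expZ_injective hee'⟩

/-- For every variable there is a point where only this variable vanishes, and the homogeneous
polynomials vanishing there are multiples of the variable modulo the relations. -/
theorem exists_test_point [IsAlgClosed Ω] [CharZero Ω]
    (ha : ∀ i k : Fin (r+1), i ≠ k → LinearIndependent 𝕂 ![a i, a k])
    (hr : 1 ≤ r) (hn : ∀ i, 0 < n i) (hl : ∀ i j, 0 < l i j)
    (hcone : ∀ v : Fin r ⊕ Fin s → ℚ, ∃ c : IdxE r n m → ℚ, (∀ x, 0 ≤ c x) ∧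
      ∀ rw, v rw = ∑ x : IdxE r n m, c x * (PdotCol r n l m s d d' x rw : ℚ))
    (hinj : Function.Injective (algebraMap (MvPolynomial (Fin s) (Polynomial 𝕂)) Ω))
    (x : IdxE r n m) :
    ∃ φ : MvPolynomial (IdxE r n m) 𝕂 →ₐ[𝕂] Ω,
    (∀ P ∈ relIdealE 𝕂 r a n l m, φ P = 0) ∧ φ (X x) = 0 ∧ (∀ y, y ≠ x → φ (X y) ≠ 0) ∧
    ∀ (δ : KdotGrp r n l m s d d') (P : MvPolynomial (IdxE r n m) 𝕂),
      P.IsWeightedHomogeneous (wKdot r n l m s d d') δ → φ P = 0 →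
      P ∈ relIdealE 𝕂 r a n l m ⊔ Ideal.span {X x} := by
  have hX : ∀ χ : AddChar (IdxE r n m → ℤ) Ω, evChar 𝕂 {x} χ (X x) = 0 ∧
      ∀ y, y ≠ x → evChar 𝕂 {x} χ (X y) ≠ 0 := fun χ => by
    refine ⟨evChar_X_of_mem χ rfl, fun y hy => ?_⟩
    rw [evChar_X χ (Set.mem_singleton_iff.not.2 hy)]
    exact (χ.val_isUnit _).ne_zero
  rw [← Set.image_singleton (f := X)]
  rcases x with x | k
  · obtain ⟨χ, hI, hχ⟩ := exists_evChar_inl ha hr hn hl hcone hinj x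
    exact ⟨evChar 𝕂 {Sum.inl x} χ, hI, (hX χ).1, (hX χ).2, hχ⟩
  · obtain ⟨χ, hχ⟩ := exists_addChar_row_eq hcone hinj (genericRow_ne_zero ha ⟨0, hr⟩)
    obtain ⟨h1, h2⟩ := evChar_inr_generic ha hr hn hl hinj hχ {k}
    rw [Set.image_singleton] at h1 h2
    exact ⟨evChar 𝕂 {Sum.inr k} χ, h1, (hX χ).1, (hX χ).2, h2⟩

end TestPoints

section SubmonoidFactorization

theorem exists_isUnit_mul_prod_of_mem_closure {H : Type*} [CommMonoidWithZero H] {f : H}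
    (hf : f ∈ Submonoid.closure {x : H | IsUnit x ∨ Prime x}) :
    ∃ u : H, IsUnit u ∧ ∃ ms : Multiset H, (∀ p ∈ ms, Prime p) ∧ f = u * ms.prod := by
  induction hf using Submonoid.closure_induction with
  | mem x hx =>
    rcases hx with hx | hx
    · exact ⟨x, hx, 0, by simp, by simp⟩
    · exact ⟨1, isUnit_one, {x}, by simpa using hx, by simp⟩
  | one => exact ⟨1, isUnit_one, 0, by simp, by simp⟩
  | mul x y _ _ hx hy =>
    obtain ⟨u, hu, ms, hms, rfl⟩ := hx
    obtain ⟨v, hv, ns, hns, rfl⟩ := hy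
    refine ⟨u * v, hu.mul hv, ms + ns, fun p hp => ?_, ?_⟩
    · exact (Multiset.mem_add.1 hp).elim (hms p) (hns p)
    · rw [Multiset.prod_add, mul_mul_mul_comm]

theorem exists_multiset_prime_of_mem_closure {H : Type*} [CommMonoidWithZero H] {f : H}
    (hf : f ∈ Submonoid.closure {x : H | IsUnit x ∨ Prime x}) (hfu : ¬ IsUnit f) :
    ∃ ms : Multiset H, (∀ p ∈ ms, Prime p) ∧ ms.prod = f := by
  obtain ⟨u, hu, ms, hms, rfl⟩ := exists_isUnit_mul_prod_of_mem_closure hf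
  induction ms using Multiset.induction_on with
  | empty => exact absurd (by simpa using hu) hfu
  | cons p ms _ =>
    refine ⟨(u * p) ::ₘ ms, fun q hq => ?_, by simp [mul_assoc]⟩
    rcases Multiset.mem_cons.1 hq with rfl | hq
    · exact (associated_unit_mul_right p u hu).prime (hms p (Multiset.mem_cons_self p ms))
    · exact hms q (Multiset.mem_cons_of_mem hq)

/-- The version of `Prime` relative to a submonoid. -/
def IsPrimeIn {A : Type*} [CommRing A] (M : Submonoid A) (p : A) : Prop :=
  p ∈ M ∧ p ≠ 0 ∧ ¬ IsUnit p ∧ ∀ x ∈ M, ∀ y ∈ M, p ∣ x * y → p ∣ x ∨ p ∣ y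

/-- The Nagata type criterion for a submonoid closed under division in a noetherian ring. -/
theorem exists_multiset_isPrimeIn {A R : Type*} [CommRing A] [IsNoetherianRing A]
    (M : Submonoid A) (hM0 : (0 : A) ∈ M)
    (hcancel : ∀ f ∈ M, ∀ g ∈ M, ∀ h ∈ M, f ≠ 0 → f * g = f * h → g = h)
    (hdvd : ∀ f ∈ M, ∀ x ∈ M, f ∣ x → ∃ z ∈ M, x = f * z)
    [CommRing R] [IsDomain R] [UniqueFactorizationMonoid R]
    {T : Set A} (hT : ∀ t ∈ T, IsPrimeIn M t) {W : Set R} (hW : ∀ w ∈ W, w ≠ 0)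
    (rel : A → R → Prop) (hleft : ∀ f ∈ M, ∃ g, rel f g) (hright : ∀ g, ∃ f ∈ M, rel f g)
    (hmul : ∀ {f₁ f₂ g₁ g₂}, rel f₁ g₁ → rel f₂ g₂ → rel (f₁ * f₂) (g₁ * g₂))
    (hdetH : ∀ {f₁ f₂ g}, rel f₁ g → rel f₂ g →
      ∃ a ∈ Submonoid.closure T, ∃ b ∈ Submonoid.closure T, a * f₁ = b * f₂)
    (hdetR : ∀ {f g₁ g₂}, rel f g₁ → rel f g₂ → ∃ w₁ ∈ W, ∃ w₂ ∈ W, w₁ * g₁ = w₂ * g₂)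
    (hWone : ∀ w ∈ W, rel 1 w) (hone : rel 1 1) (hTone : ∀ a ∈ Submonoid.closure T, rel a 1)
    (hzero : ∀ {f}, rel f 0 → f = 0) {f : A} (hfM : f ∈ M) (hf : f ≠ 0) (hfu : ¬ IsUnit f) :
    ∃ ms : Multiset A, (∀ p ∈ ms, IsPrimeIn M p) ∧ ms.prod = f := by
  let _ : CommMonoidWithZero M :=
    { (inferInstance : CommMonoid M) with
      zero := ⟨0, hM0⟩
      zero_mul := fun x => Subtype.ext (zero_mul (x : A))
      mul_zero := fun x => Subtype.ext (mul_zero (x : A)) }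
  have hne : ∀ x : M, x ≠ 0 ↔ (x : A) ≠ 0 := fun x => Subtype.coe_injective.ne_iff.symm
  have hdvd' : ∀ x y : M, x ∣ y ↔ (x : A) ∣ y := by
    refine fun x y => ⟨fun ⟨z, hz⟩ => ⟨z, by rw [hz]; rfl⟩, fun h => ?_⟩
    obtain ⟨z, hz, hxz⟩ := hdvd x x.2 y y.2 h
    exact ⟨⟨z, hz⟩, Subtype.ext hxz⟩
  have hunit : ∀ x : M, IsUnit x ↔ IsUnit (x : A) := fun x => by
    rw [isUnit_iff_dvd_one, isUnit_iff_dvd_one, hdvd', Submonoid.coe_one]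
  have hprime : ∀ x : M, Prime x ↔ IsPrimeIn M (x : A) := by
    intro x
    rw [Prime, hunit]
    refine ⟨fun ⟨h1, h2, h3⟩ => ⟨x.2, (hne x).1 h1, h2, fun y hy z hz h => ?_⟩,
      fun ⟨_, h1, h2, h3⟩ => ⟨(hne x).2 h1, h2, fun y z h => ?_⟩⟩
    · simpa only [hdvd'] using h3 ⟨y, hy⟩ ⟨z, hz⟩ ((hdvd' _ _).2 h)
    · simpa only [hdvd'] using h3 y y.2 z z.2 ((hdvd' _ _).1 h)
  have : IsLeftCancelMulZero M := ⟨@fun x hx y z h => Subtype.ext <|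
    hcancel x x.2 y y.2 z z.2 ((hne x).1 hx) (congrArg Subtype.val h)⟩
  have : IsCancelMulZero M := IsLeftCancelMulZero.to_isCancelMulZero
  have : WfDvdMonoid M := by
    refine ⟨Subrelation.wf (r := InvImage (· > ·) fun x : M => Ideal.span {(x : A)}) ?_
      (InvImage.wf _ wellFounded_gt)⟩
    rintro x _ ⟨hx, z, hz, rfl⟩
    refine lt_of_le_of_ne (Ideal.span_singleton_le_span_singleton.2 ⟨z, rfl⟩) fun h => hz ?_
    have h1 : ((x * z : M) : A) ∣ x := Ideal.span_singleton_le_span_singleton.1 h.ge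
    obtain ⟨y, hy⟩ := (hdvd' _ _).2 h1
    refine IsUnit.of_mul_eq_one y (mul_left_cancel₀ hx ?_)
    rw [← mul_assoc, ← hy, mul_one]
  have hTM : T ⊆ M := fun t ht => (hT t ht).1
  have hcl : Submonoid.closure (M.subtype ⁻¹' T) = (Submonoid.closure T).comap M.subtype := by
    refine Submonoid.map_injective_of_injective (f := M.subtype) Subtype.coe_injective ?_
    rw [Submonoid.map_comap_eq_self (by simpa using Submonoid.closure_le.2 hTM),
      MonoidHom.map_mclosure]
    congr 1
    exact Set.image_preimage_eq_of_subset (by simpa using hTM)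
  have hmem := mem_closure_isUnit_or_prime_of_rel (H := M) (T := M.subtype ⁻¹' T)
    (fun t ht => (hprime t).2 (hT t ht)) hW (fun f g => rel f g) (fun f => hleft f f.2)
    (fun g => by
      obtain ⟨f, hf, h⟩ := hright g
      exact ⟨⟨f, hf⟩, h⟩)
    hmul (fun h1 h2 => by
      obtain ⟨a, ha, b, hb, hab⟩ := hdetH h1 h2
      have hcM := Submonoid.closure_le.2 hTM
      refine ⟨⟨a, hcM ha⟩, ?_, ⟨b, hcM hb⟩, ?_, Subtype.ext hab⟩
      · rw [hcl]; exact ha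
      · rw [hcl]; exact hb)
    hdetR hWone hone (fun a ha => hTone a (by rw [hcl] at ha; exact ha))
    (fun h => Subtype.ext (hzero h)) (f := ⟨f, hfM⟩) ((hne _).2 hf)
  obtain ⟨ms, hms, hprod⟩ := exists_multiset_prime_of_mem_closure hmem
    (fun h => hfu ((hunit _).1 h))
  refine ⟨ms.map M.subtype, fun p hp => ?_, ?_⟩
  · obtain ⟨q, hq, rfl⟩ := Multiset.mem_map.1 hp
    exact (hprime q).1 (hms q hq)
  · rw [← map_multiset_prod]
    exact congrArg Subtype.val hprod

end SubmonoidFactorization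

theorem MvPolynomial.IsWeightedHomogeneous.weightedHomogeneousComponent_mul {R σ Γ : Type*}
    [CommSemiring R] [AddCancelCommMonoid Γ] {w : σ → Γ} {p : MvPolynomial σ R} {δ : Γ}
    (hp : p.IsWeightedHomogeneous w δ) (ε : Γ) (q : MvPolynomial σ R) :
    weightedHomogeneousComponent w (δ + ε) (p * q) = p * weightedHomogeneousComponent w ε q := by
  classical
  ext e
  rw [coeff_weightedHomogeneousComponent, coeff_mul, coeff_mul, Finset.ite_sum_zero]
  refine Finset.sum_congr rfl fun x hx => ?_
  rw [coeff_weightedHomogeneousComponent]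
  by_cases hc : coeff x.1 p = 0
  · simp [hc]
  · rw [← Finset.HasAntidiagonal.mem_antidiagonal.1 hx, map_add, hp hc, mul_ite, mul_zero]
    simp only [add_right_inj]

section Homogeneous

variable {r : ℕ} {n : Fin (r+1) → ℕ} {l : ∀ i : Fin (r+1), Fin (n i) → ℕ}
variable {m s : ℕ} {d : Fin s → Idx r n → ℤ} {d' : Fin s → Fin m → ℤ}
variable {𝕂 : Type} [Field 𝕂] {a : Fin (r+1) → 𝕂 × 𝕂}

theorem IsHomogDot.mul {δ ε : KdotGrp r n l m s d d'} {x y : RAnLE 𝕂 r a n l m}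
    (hx : IsHomogDot r n l m s d d' 𝕂 a δ x) (hy : IsHomogDot r n l m s d d' 𝕂 a ε y) :
    IsHomogDot r n l m s d d' 𝕂 a (δ + ε) (x * y) := by
  obtain ⟨p, hp, rfl⟩ := hx
  obtain ⟨q, hq, rfl⟩ := hy
  exact ⟨p * q, hp.mul hq, map_mul _ _ _⟩

theorem IsHomogDot.add {δ : KdotGrp r n l m s d d'} {x y : RAnLE 𝕂 r a n l m}
    (hx : IsHomogDot r n l m s d d' 𝕂 a δ x) (hy : IsHomogDot r n l m s d d' 𝕂 a δ y) :
    IsHomogDot r n l m s d d' 𝕂 a δ (x + y) := by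
  obtain ⟨p, hp, rfl⟩ := hx
  obtain ⟨q, hq, rfl⟩ := hy
  exact ⟨p + q, hp.add hq, map_add _ _ _⟩

theorem IsHomogDot.sub {δ : KdotGrp r n l m s d d'} {x y : RAnLE 𝕂 r a n l m}
    (hx : IsHomogDot r n l m s d d' 𝕂 a δ x) (hy : IsHomogDot r n l m s d d' 𝕂 a δ y) :
    IsHomogDot r n l m s d d' 𝕂 a δ (x - y) := by
  obtain ⟨p, hp, rfl⟩ := hx
  obtain ⟨q, hq, rfl⟩ := hy
  exact ⟨p - q, (weightedHomogeneousSubmodule 𝕂 (wKdot r n l m s d d') δ).sub_mem hp hq,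
    map_sub _ _ _⟩

theorem isHomogDot_zero (δ : KdotGrp r n l m s d d') : IsHomogDot r n l m s d d' 𝕂 a δ 0 :=
  ⟨0, isWeightedHomogeneous_zero _ _ _, map_zero _⟩

theorem isHomogDot_algebraMap (c : 𝕂) :
    IsHomogDot r n l m s d d' 𝕂 a 0 (algebraMap 𝕂 (RAnLE 𝕂 r a n l m) c) :=
  ⟨C c, isWeightedHomogeneous_C _ _, rfl⟩

theorem isHomogDot_one : IsHomogDot r n l m s d d' 𝕂 a 0 1 :=
  ⟨1, isWeightedHomogeneous_one _ _, map_one _⟩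

theorem isHomogDot_monomial (e : IdxE r n m →₀ ℕ) :
    IsHomogDot r n l m s d d' 𝕂 a (Qdot r n l m s d d' (expZ e))
      (Ideal.Quotient.mk (relIdealE 𝕂 r a n l m) (monomial e 1)) :=
  ⟨_, isWeightedHomogeneous_monomial _ _ _ (weight_wKdot e), rfl⟩

theorem isHomogDot_X (x : IdxE r n m) :
    IsHomogDot r n l m s d d' 𝕂 a (Qdot r n l m s d d' (Pi.single x 1))
      (Ideal.Quotient.mk (relIdealE 𝕂 r a n l m) (X x)) :=
  ⟨_, isWeightedHomogeneous_X _ _ _, rfl⟩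

/-- A nonzero homogeneous element has only one degree. -/
theorem IsHomogDot.eq_of_ne_zero {δ ε : KdotGrp r n l m s d d'}
    {x : RAnLE 𝕂 r a n l m}
    (hx : IsHomogDot r n l m s d d' 𝕂 a δ x) (hx' : IsHomogDot r n l m s d d' 𝕂 a ε x)
    (h0 : x ≠ 0) : δ = ε := by
  by_contra hne
  obtain ⟨p, hp, rfl⟩ := hx
  obtain ⟨q, hq, hpq⟩ := hx'
  have h1 := weightedHomogeneousComponent_mem_relIdealE (Ideal.Quotient.eq.1 hpq) δ
  rw [map_sub, hp.weightedHomogeneousComponent_same,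
    hq.weightedHomogeneousComponent_ne _ hne, zero_sub,
    neg_mem_iff] at h1
  exact h0 (Ideal.Quotient.eq_zero_iff_mem.2 h1)

/-- Quotients of homogeneous elements can be chosen to be homogeneous. -/
theorem IsHomogDot.exists_eq_mul_of_dvd {δ ε : KdotGrp r n l m s d d'}
    {f x : RAnLE 𝕂 r a n l m} (hf : IsHomogDot r n l m s d d' 𝕂 a δ f)
    (hx : IsHomogDot r n l m s d d' 𝕂 a ε x) (hfx : f ∣ x) :
    ∃ z, IsHomogDot r n l m s d d' 𝕂 a (ε - δ) z ∧ x = f * z := by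
  obtain ⟨p, hp, rfl⟩ := hf
  obtain ⟨q, hq, rfl⟩ := hx
  obtain ⟨z, hz⟩ := hfx
  obtain ⟨z, rfl⟩ := Ideal.Quotient.mk_surjective z
  rw [← map_mul] at hz
  have h1 := weightedHomogeneousComponent_mem_relIdealE (Ideal.Quotient.eq.1 hz) ε
  rw [map_sub, hq.weightedHomogeneousComponent_same,
    ← add_sub_cancel δ ε, hp.weightedHomogeneousComponent_mul] at h1
  exact ⟨_, ⟨_, weightedHomogeneousComponent_isWeightedHomogeneous _ _, rfl⟩, by
    rw [← map_mul]; exact Ideal.Quotient.eq.2 h1⟩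

theorem IsHomogDot.eq_of_mul_eq_mul {Ω : Type*} [Field Ω] [Algebra 𝕂 Ω]
    {φ : RAnLE 𝕂 r a n l m →ₐ[𝕂] Ω}
    (hφ0 : ∀ δ x, IsHomogDot r n l m s d d' 𝕂 a δ x → φ x = 0 → x = 0)
    {δ ε γ : KdotGrp r n l m s d d'} {f g h : RAnLE 𝕂 r a n l m}
    (hf : IsHomogDot r n l m s d d' 𝕂 a δ f) (hg : IsHomogDot r n l m s d d' 𝕂 a ε g)
    (hh : IsHomogDot r n l m s d d' 𝕂 a γ h) (hf0 : f ≠ 0) (hfg : f * g = f * h) : g = h := by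
  have h1 : φ f ≠ 0 := fun h => hf0 (hφ0 _ _ hf h)
  have h2 : φ g = φ h := mul_left_cancel₀ h1 (by rw [← map_mul, hfg, map_mul])
  by_cases h0 : f * g = 0
  · have h3 : φ g = 0 := (mul_eq_zero.1 (by rw [← map_mul, h0, map_zero])).resolve_left h1
    rw [hφ0 _ _ hg h3, hφ0 _ _ hh (h2 ▸ h3)]
  · obtain rfl := add_left_cancel ((hf.mul hg).eq_of_ne_zero (hfg ▸ hf.mul hh) h0)
    exact sub_eq_zero.1 (hφ0 _ _ (hg.sub hh) (by rw [map_sub, h2, sub_self]))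

variable (l d d' 𝕂 a) in
/-- The submonoid of homogeneous elements. -/
def homogSubmonoid : Submonoid (RAnLE 𝕂 r a n l m) where
  carrier := {x | ∃ δ, IsHomogDot r n l m s d d' 𝕂 a δ x}
  one_mem' := ⟨0, isHomogDot_one⟩
  mul_mem' := fun ⟨δ, hx⟩ ⟨ε, hy⟩ => ⟨δ + ε, hx.mul hy⟩

end Homogeneous

section Dehomogenization

variable {r : ℕ} {n : Fin (r+1) → ℕ} {l : ∀ i : Fin (r+1), Fin (n i) → ℕ}
variable {m s : ℕ} {d : Fin s → Idx r n → ℤ} {d' : Fin s → Fin m → ℤ}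
variable {𝕂 : Type} [Field 𝕂] {a : Fin (r+1) → 𝕂 × 𝕂}
variable {Ω : Type*} [Field Ω]

theorem addChar_ne_zero (χ : AddChar (IdxE r n m → ℤ) Ω) (e : IdxE r n m → ℤ) : χ e ≠ 0 := by
  intro h
  have h1 := χ.map_add_eq_mul e (-e)
  rw [add_neg_cancel, AddChar.map_zero_eq_one, h, zero_mul] at h1
  exact one_ne_zero h1

variable [Algebra 𝕂 Ω] [Algebra (MvPolynomial (Fin s) (Polynomial 𝕂)) Ω]
variable {χ : AddChar (IdxE r n m → ℤ) Ω} {φ : RAnLE 𝕂 r a n l m →ₐ[𝕂] Ω}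
variable {ρ : Fin r → Polynomial 𝕂}

variable (l d d' χ φ) in
/-- The homogeneous element `f` equals `g` up to a character value at the general point `φ`. -/
def IsDehomogenization (f : RAnLE 𝕂 r a n l m) (g : MvPolynomial (Fin s) (Polynomial 𝕂)) : Prop :=
  ∃ e : IdxE r n m → ℤ, IsHomogDot r n l m s d d' 𝕂 a (Qdot r n l m s d d' e) f ∧
    φ f = χ e * algebraMap _ Ω g

theorem IsDehomogenization.mul {f₁ f₂ : RAnLE 𝕂 r a n l m}
    {g₁ g₂ : MvPolynomial (Fin s) (Polynomial 𝕂)} (h₁ : IsDehomogenization l d d' χ φ f₁ g₁)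
    (h₂ : IsDehomogenization l d d' χ φ f₂ g₂) :
    IsDehomogenization l d d' χ φ (f₁ * f₂) (g₁ * g₂) := by
  obtain ⟨e₁, hf₁, h₁⟩ := h₁
  obtain ⟨e₂, hf₂, h₂⟩ := h₂
  refine ⟨e₁ + e₂, by rw [map_add]; exact hf₁.mul hf₂, ?_⟩
  rw [map_mul, h₁, h₂, χ.map_add_eq_mul, map_mul, mul_mul_mul_comm]

theorem isDehomogenization_one : IsDehomogenization l d d' χ φ 1 1 :=
  ⟨0, by rw [map_zero]; exact isHomogDot_one, by simp⟩

theorem isDehomogenization_monomial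
    (hφ : ∀ e, φ (Ideal.Quotient.mk _ (monomial e 1)) = χ (expZ e)) (e : IdxE r n m →₀ ℕ) :
    IsDehomogenization l d d' χ φ (Ideal.Quotient.mk _ (monomial e 1)) 1 :=
  ⟨expZ e, isHomogDot_monomial e, by rw [hφ, map_one, mul_one]⟩

theorem IsDehomogenization.exists_add
    (hφ : ∀ e, φ (Ideal.Quotient.mk _ (monomial e 1)) = χ (expZ e)) {f₁ f₂ : RAnLE 𝕂 r a n l m}
    {g₁ g₂ : MvPolynomial (Fin s) (Polynomial 𝕂)} (h₁ : IsDehomogenization l d d' χ φ f₁ g₁)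
    (h₂ : IsDehomogenization l d d' χ φ f₂ g₂) :
    ∃ f, IsDehomogenization l d d' χ φ f (g₁ + g₂) := by
  obtain ⟨e₁, hf₁, h₁⟩ := h₁
  obtain ⟨e₂, hf₂, h₂⟩ := h₂
  obtain ⟨b₁, b₂, hb⟩ := exists_add_expZ_eq (e₁ - e₂)
  have hb' : e₁ + expZ b₁ = e₂ + expZ b₂ := by rw [← hb]; abel
  refine ⟨f₁ * Ideal.Quotient.mk _ (monomial b₁ 1) + f₂ * Ideal.Quotient.mk _ (monomial b₂ 1),
    e₁ + expZ b₁, ?_, ?_⟩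
  · refine IsHomogDot.add ?_ ?_
    · rw [map_add]
      exact hf₁.mul (isHomogDot_monomial b₁)
    · rw [hb', map_add]
      exact hf₂.mul (isHomogDot_monomial b₂)
  · rw [map_add, map_mul, map_mul, hφ, hφ, h₁, h₂, map_add (algebraMap _ Ω), mul_add, mul_right_comm,
      ← χ.map_add_eq_mul, mul_right_comm (χ e₂), ← χ.map_add_eq_mul, hb']

theorem exists_isDehomogenization_rowVal
    (hφ : ∀ e, φ (Ideal.Quotient.mk _ (monomial e 1)) = χ (expZ e))
    (hχ : ∀ i, χ (PdotRow r n l m s d d' i) = algebraMap _ Ω (rowVal s ρ i))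
    (i : Fin r ⊕ Fin s) : ∃ f, IsDehomogenization l d d' χ φ f (rowVal s ρ i) := by
  obtain ⟨e, f, h⟩ := exists_add_expZ_eq (PdotRow r n l m s d d' i)
  refine ⟨Ideal.Quotient.mk _ (monomial f 1), expZ e, ?_, ?_⟩
  · rw [(Qdot_eq_iff (expZ e) (expZ f)).2 ⟨-Pi.single i 1, by
      rw [map_neg, rowComb_single, ← h]; abel⟩]
    exact isHomogDot_monomial f
  · rw [hφ, ← h, χ.map_add_eq_mul, hχ, mul_comm]

variable [IsScalarTower 𝕂 (MvPolynomial (Fin s) (Polynomial 𝕂)) Ω]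

theorem isDehomogenization_algebraMap (c : 𝕂) :
    IsDehomogenization l d d' χ φ (algebraMap 𝕂 _ c) (C (Polynomial.C c)) := by
  refine ⟨0, by rw [map_zero]; exact isHomogDot_algebraMap c, ?_⟩
  rw [AddChar.map_zero_eq_one, one_mul, AlgHom.commutes,
    IsScalarTower.algebraMap_apply 𝕂 (MvPolynomial (Fin s) (Polynomial 𝕂)) Ω]
  rfl

theorem exists_isDehomogenization
    (hφ : ∀ e, φ (Ideal.Quotient.mk _ (monomial e 1)) = χ (expZ e))
    (hχ : ∀ i, χ (PdotRow r n l m s d d' i) = algebraMap _ Ω (rowVal s ρ i))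
    {q : Fin r} (hq : ρ q = Polynomial.X) (g : MvPolynomial (Fin s) (Polynomial 𝕂)) :
    ∃ f, IsDehomogenization l d d' χ φ f g := by
  have hmul : ∀ {g₁ g₂}, (∃ f, IsDehomogenization l d d' χ φ f g₁) →
      (∃ f, IsDehomogenization l d d' χ φ f g₂) → ∃ f, IsDehomogenization l d d' χ φ f (g₁ * g₂) :=
    fun ⟨_, h₁⟩ ⟨_, h₂⟩ => ⟨_, h₁.mul h₂⟩
  induction g using MvPolynomial.induction_on with
  | C p =>
    induction p using Polynomial.induction_on with
    | C c => exact ⟨_, isDehomogenization_algebraMap c⟩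
    | add p₁ p₂ h₁ h₂ =>
      obtain ⟨f₁, h₁⟩ := h₁
      obtain ⟨f₂, h₂⟩ := h₂
      rw [map_add]
      exact h₁.exists_add hφ h₂
    | monomial k c h =>
      rw [pow_succ, ← mul_assoc, map_mul]
      refine hmul h ?_
      rw [← hq]
      exact exists_isDehomogenization_rowVal hφ hχ (Sum.inl q)
  | add g₁ g₂ h₁ h₂ =>
    obtain ⟨f₁, h₁⟩ := h₁
    obtain ⟨f₂, h₂⟩ := h₂
    exact h₁.exists_add hφ h₂
  | mul_X g k h => exact hmul h (exists_isDehomogenization_rowVal hφ hχ (Sum.inr k))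

theorem IsHomogDot.exists_isDehomogenization {δ : KdotGrp r n l m s d d'}
    {f : RAnLE 𝕂 r a n l m} (hf : IsHomogDot r n l m s d d' 𝕂 a δ f)
    (hφ : ∀ e, φ (Ideal.Quotient.mk _ (monomial e 1)) = χ (expZ e))
    (hχ : ∀ i, χ (PdotRow r n l m s d d' i) = algebraMap _ Ω (rowVal s ρ i)) :
    ∃ g, IsDehomogenization l d d' χ φ f g := by
  obtain ⟨u, rfl⟩ := QuotientAddGroup.mk'_surjective _ δ
  obtain ⟨p, hp, rfl⟩ := hf
  have h1 : ∀ e : p.support, ∃ w, expZ e = u + rowComb r n l m s d d' w := fun e =>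
    (Qdot_eq_iff _ _).1 ((weight_wKdot _).symm.trans (hp (mem_support_iff.1 e.2)))
  choose w hw using h1
  obtain ⟨B, v, hv⟩ := exists_nat_shift p.support.attach w
  have hne : ∀ i, χ (PdotRow r n l m s d d' i) ≠ 0 := fun i => addChar_ne_zero χ _
  refine ⟨∑ e ∈ p.support.attach, coeff e p • ∏ i, rowVal s ρ i ^ v e i,
    u - rowComb r n l m s d d' fun _ => B, ?_, ?_⟩
  · rw [sub_eq_add_neg, ← map_neg, Qdot_add_rowComb]
    exact ⟨p, hp, rfl⟩
  · conv_lhs => rw [p.as_sum, ← Finset.sum_attach, map_sum, map_sum]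
    rw [map_sum, Finset.mul_sum]
    refine Finset.sum_congr rfl fun e he => ?_
    have h2 : (monomial (e : IdxE r n m →₀ ℕ)) (coeff e p) = coeff e p • monomial e 1 := by
      rw [smul_monomial, smul_eq_mul, mul_one]
    have h3 : Ideal.Quotient.mk (relIdealE 𝕂 r a n l m) (coeff (e : IdxE r n m →₀ ℕ) p •
        monomial e 1) = coeff (e : IdxE r n m →₀ ℕ) p • Ideal.Quotient.mk _ (monomial e 1) := rfl
    rw [h2, h3, map_smul, hφ, hw, algebraMap.smul, mul_smul_comm, χ.map_add_eq_mul,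
      addChar_rowComb, map_prod]
    simp only [map_pow, ← hχ]
    rw [prod_zpow_add_eq hne fun i => hv e he i, sub_eq_add_neg, ← map_neg, χ.map_add_eq_mul,
      addChar_rowComb, mul_assoc,
      mul_left_comm (∏ i, _ ^ (-fun _ => (B : ℤ) : Fin r ⊕ Fin s → ℤ) i)]
    have h4 : (∏ i, χ (PdotRow r n l m s d d' i) ^ (-fun _ => (B : ℤ) : Fin r ⊕ Fin s → ℤ) i) *
        ∏ i, χ (PdotRow r n l m s d d' i) ^ B = 1 := by
      rw [← Finset.prod_mul_distrib]
      refine Finset.prod_eq_one fun i _ => ?_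
      rw [Pi.neg_apply, zpow_neg, zpow_natCast, inv_mul_cancel₀ (pow_ne_zero _ (hne i))]
    rw [h4, mul_one]

end Dehomogenization

section DehomogenizationUnique

variable {r : ℕ} {n : Fin (r+1) → ℕ} {l : ∀ i : Fin (r+1), Fin (n i) → ℕ}
variable {m s : ℕ} {d : Fin s → Idx r n → ℤ} {d' : Fin s → Fin m → ℤ}
variable {𝕂 : Type} [Field 𝕂] {a : Fin (r+1) → 𝕂 × 𝕂}
variable {Ω : Type*} [Field Ω] [Algebra (MvPolynomial (Fin s) (Polynomial 𝕂)) Ω]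
variable {χ : AddChar (IdxE r n m → ℤ) Ω} {ρ : Fin r → Polynomial 𝕂}

theorem monomial_mem_closure (e : IdxE r n m →₀ ℕ) :
    Ideal.Quotient.mk (relIdealE 𝕂 r a n l m) (monomial e 1) ∈ Submonoid.closure
      (Set.range fun x => Ideal.Quotient.mk (relIdealE 𝕂 r a n l m) (X x)) := by
  rw [monomial_eq, map_one, one_mul, Finsupp.prod, map_prod]
  refine prod_mem fun x _ => ?_
  rw [map_pow]
  exact pow_mem (Submonoid.subset_closure (Set.mem_range_self x)) _

theorem ne_zero_of_mem_closure_rowVal (hρ : ∀ i, ρ i ≠ 0) {w : MvPolynomial (Fin s) (Polynomial 𝕂)}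
    (hw : w ∈ Submonoid.closure (Set.range (rowVal s ρ))) : w ≠ 0 := by
  induction hw using Submonoid.closure_induction with
  | mem _ h =>
    obtain ⟨i, rfl⟩ := h
    exact rowVal_ne_zero hρ i
  | one => exact one_ne_zero
  | mul _ _ _ _ h₁ h₂ => exact mul_ne_zero h₁ h₂

/-- Values of characters on combinations of rows are fractions of products of row values. -/
theorem exists_addChar_rowComb_mul_eq
    (hχ : ∀ i, χ (PdotRow r n l m s d d' i) = algebraMap _ Ω (rowVal s ρ i))
    (w : Fin r ⊕ Fin s → ℤ) :
    ∃ w₁ ∈ Submonoid.closure (Set.range (rowVal s ρ)),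
      ∃ w₂ ∈ Submonoid.closure (Set.range (rowVal s ρ)),
        χ (rowComb r n l m s d d' w) * algebraMap _ Ω w₂ = algebraMap _ Ω w₁ := by
  refine ⟨∏ i, rowVal s ρ i ^ (w i).toNat,
    prod_mem fun i _ => pow_mem (Submonoid.subset_closure (Set.mem_range_self i)) _,
    ∏ i, rowVal s ρ i ^ (-w i).toNat,
    prod_mem fun i _ => pow_mem (Submonoid.subset_closure (Set.mem_range_self i)) _, ?_⟩
  rw [addChar_rowComb, map_prod, map_prod, ← Finset.prod_mul_distrib]
  refine Finset.prod_congr rfl fun i _ => ?_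
  rw [map_pow, map_pow, ← hχ, ← zpow_natCast, ← zpow_natCast, ← zpow_add₀ (addChar_ne_zero χ _)]
  congr 1
  omega

variable [Algebra 𝕂 Ω] {φ : RAnLE 𝕂 r a n l m →ₐ[𝕂] Ω}

theorem IsDehomogenization.exists_mul_eq_mul_right
    (hinj : Function.Injective (algebraMap (MvPolynomial (Fin s) (Polynomial 𝕂)) Ω))
    (hχ : ∀ i, χ (PdotRow r n l m s d d' i) = algebraMap _ Ω (rowVal s ρ i))
    {f : RAnLE 𝕂 r a n l m} {g₁ g₂ : MvPolynomial (Fin s) (Polynomial 𝕂)}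
    (h₁ : IsDehomogenization l d d' χ φ f g₁) (h₂ : IsDehomogenization l d d' χ φ f g₂) :
    ∃ w₁ ∈ Submonoid.closure (Set.range (rowVal s ρ)),
      ∃ w₂ ∈ Submonoid.closure (Set.range (rowVal s ρ)), w₁ * g₁ = w₂ * g₂ := by
  obtain ⟨e₁, hf₁, h₁⟩ := h₁
  obtain ⟨e₂, hf₂, h₂⟩ := h₂
  rcases eq_or_ne f 0 with rfl | hf
  · have hz : ∀ {e} {g : MvPolynomial (Fin s) (Polynomial 𝕂)}, φ 0 = χ e * algebraMap _ Ω g →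
        g = 0 := by
      intro e g h
      rw [map_zero, eq_comm, mul_eq_zero, or_iff_right (addChar_ne_zero χ e),
        map_eq_zero_iff _ hinj] at h
      exact h
    exact ⟨1, one_mem _, 1, one_mem _, by rw [hz h₁, hz h₂]⟩
  · obtain ⟨w, rfl⟩ := (Qdot_eq_iff _ _).1 (hf₁.eq_of_ne_zero hf₂ hf)
    obtain ⟨w₁, hw₁, w₂, hw₂, hw⟩ := exists_addChar_rowComb_mul_eq hχ w
    refine ⟨w₁, hw₁, w₂, hw₂, hinj ?_⟩
    rw [h₁, χ.map_add_eq_mul, mul_assoc, mul_right_inj' (addChar_ne_zero χ _)] at h₂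
    rw [map_mul, map_mul, ← hw, ← h₂]
    ring

theorem IsDehomogenization.exists_mul_eq_mul_left
    (hφ : ∀ e, φ (Ideal.Quotient.mk _ (monomial e 1)) = χ (expZ e))
    (hφ0 : ∀ δ x, IsHomogDot r n l m s d d' 𝕂 a δ x → φ x = 0 → x = 0)
    {f₁ f₂ : RAnLE 𝕂 r a n l m} {g : MvPolynomial (Fin s) (Polynomial 𝕂)}
    (h₁ : IsDehomogenization l d d' χ φ f₁ g) (h₂ : IsDehomogenization l d d' χ φ f₂ g) :
    ∃ p ∈ Submonoid.closure (Set.range fun x => Ideal.Quotient.mk (relIdealE 𝕂 r a n l m) (X x)),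
      ∃ q ∈ Submonoid.closure (Set.range fun x => Ideal.Quotient.mk (relIdealE 𝕂 r a n l m) (X x)),
        p * f₁ = q * f₂ := by
  obtain ⟨e₁, hf₁, h₁⟩ := h₁
  obtain ⟨e₂, hf₂, h₂⟩ := h₂
  obtain ⟨b₁, b₂, hb⟩ := exists_add_expZ_eq (e₁ - e₂)
  have hb' : expZ b₁ + e₁ = expZ b₂ + e₂ := by rw [← hb]; abel
  refine ⟨_, monomial_mem_closure b₁, _, monomial_mem_closure b₂, sub_eq_zero.1 ?_⟩
  refine hφ0 (Qdot r n l m s d d' (expZ b₁ + e₁)) _ (IsHomogDot.sub ?_ ?_) ?_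
  · rw [map_add]
    exact (isHomogDot_monomial b₁).mul hf₁
  · rw [hb', map_add]
    exact (isHomogDot_monomial b₂).mul hf₂
  · rw [map_sub, map_mul, map_mul, hφ, hφ, h₁, h₂, ← mul_assoc, ← mul_assoc, ← χ.map_add_eq_mul,
      ← χ.map_add_eq_mul, hb', sub_self]

theorem isDehomogenization_one_of_mem_closure
    (hχ : ∀ i, χ (PdotRow r n l m s d d' i) = algebraMap _ Ω (rowVal s ρ i))
    {w : MvPolynomial (Fin s) (Polynomial 𝕂)}
    (hw : w ∈ Submonoid.closure (Set.range (rowVal s ρ))) :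
    IsDehomogenization l d d' χ φ 1 w := by
  induction hw using Submonoid.closure_induction with
  | mem _ h =>
    obtain ⟨i, rfl⟩ := h
    refine ⟨-PdotRow r n l m s d d' i, ?_, ?_⟩
    · rw [(Qdot_eq_iff _ 0).2 ⟨-Pi.single i 1, by rw [map_neg, rowComb_single, zero_add]⟩, map_zero]
      exact isHomogDot_one
    · rw [← hχ, ← χ.map_add_eq_mul, neg_add_cancel, AddChar.map_zero_eq_one, map_one]
  | one => exact isDehomogenization_one
  | mul _ _ _ _ h₁ h₂ => simpa using h₁.mul h₂

theorem isDehomogenization_of_mem_closure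
    (hφ : ∀ e, φ (Ideal.Quotient.mk _ (monomial e 1)) = χ (expZ e)) {p : RAnLE 𝕂 r a n l m}
    (hp : p ∈ Submonoid.closure
      (Set.range fun x => Ideal.Quotient.mk (relIdealE 𝕂 r a n l m) (X x))) :
    IsDehomogenization l d d' χ φ p 1 := by
  induction hp using Submonoid.closure_induction with
  | mem _ h =>
    obtain ⟨x, rfl⟩ := h
    exact isDehomogenization_monomial hφ (Finsupp.single x 1)
  | one => exact isDehomogenization_one
  | mul _ _ _ _ h₁ h₂ => simpa using h₁.mul h₂

variable [IsScalarTower 𝕂 (MvPolynomial (Fin s) (Polynomial 𝕂)) Ω]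

theorem exists_multiset_isPrimeIn_of_isHomogDot
    (hinj : Function.Injective (algebraMap (MvPolynomial (Fin s) (Polynomial 𝕂)) Ω))
    (hφ : ∀ e, φ (Ideal.Quotient.mk _ (monomial e 1)) = χ (expZ e))
    (hφ0 : ∀ δ x, IsHomogDot r n l m s d d' 𝕂 a δ x → φ x = 0 → x = 0) (hρ : ∀ i, ρ i ≠ 0)
    {q : Fin r} (hq : ρ q = Polynomial.X)
    (hχ : ∀ i, χ (PdotRow r n l m s d d' i) = algebraMap _ Ω (rowVal s ρ i))
    (hT : ∀ x, IsPrimeIn (homogSubmonoid l d d' 𝕂 a)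
      (Ideal.Quotient.mk (relIdealE 𝕂 r a n l m) (X x)))
    {δ : KdotGrp r n l m s d d'} {f : RAnLE 𝕂 r a n l m}
    (hfM : IsHomogDot r n l m s d d' 𝕂 a δ f) (hf : f ≠ 0) (hfu : ¬ IsUnit f) :
    ∃ ms : Multiset (RAnLE 𝕂 r a n l m),
      (∀ p ∈ ms, IsPrimeIn (homogSubmonoid l d d' 𝕂 a) p) ∧ ms.prod = f := by
  refine exists_multiset_isPrimeIn (homogSubmonoid l d d' 𝕂 a) ⟨0, isHomogDot_zero 0⟩
    (fun f ⟨_, hf⟩ g ⟨_, hg⟩ h ⟨_, hh⟩ => hf.eq_of_mul_eq_mul hφ0 hg hh)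
    (fun f ⟨_, hf⟩ x ⟨_, hx⟩ h => ?_)
    (T := Set.range fun x => Ideal.Quotient.mk (relIdealE 𝕂 r a n l m) (X x))
    (by rintro _ ⟨x, rfl⟩; exact hT x)
    (W := (Submonoid.closure (Set.range (rowVal s ρ)) : Set _))
    (fun w hw => ne_zero_of_mem_closure_rowVal hρ hw) (IsDehomogenization l d d' χ φ)
    (fun f ⟨_, hf⟩ => hf.exists_isDehomogenization hφ hχ) (fun g => ?_) IsDehomogenization.mul
    (fun h₁ h₂ => h₁.exists_mul_eq_mul_left hφ hφ0 h₂)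
    (fun h₁ h₂ => h₁.exists_mul_eq_mul_right hinj hχ h₂)
    (fun w hw => isDehomogenization_one_of_mem_closure hχ hw) isDehomogenization_one
    (fun p hp => isDehomogenization_of_mem_closure hφ hp) ?_ ⟨δ, hfM⟩ hf hfu
  · obtain ⟨z, hz, h⟩ := hf.exists_eq_mul_of_dvd hx h
    exact ⟨z, ⟨_, hz⟩, h⟩
  · obtain ⟨f, hf⟩ := exists_isDehomogenization hφ hχ hq g
    exact ⟨f, ⟨_, hf.choose_spec.1⟩, hf⟩
  · rintro f ⟨e, hf, h⟩
    rw [map_zero, mul_zero] at h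
    exact hφ0 _ _ hf h

end DehomogenizationUnique

section Main

variable {r : ℕ} {n : Fin (r+1) → ℕ} {l : ∀ i : Fin (r+1), Fin (n i) → ℕ}
variable {m s : ℕ} {d : Fin s → Idx r n → ℤ} {d' : Fin s → Fin m → ℤ}
variable {𝕂 : Type} [Field 𝕂] {a : Fin (r+1) → 𝕂 × 𝕂}

theorem closure_range_wKdot :
    AddSubgroup.closure (Set.range (wKdot r n l m s d d')) = ⊤ := by
  refine eq_top_iff.2 fun δ _ => ?_
  obtain ⟨u, rfl⟩ := QuotientAddGroup.mk'_surjective _ δ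
  have h : u = ∑ x, u x • (Pi.single x 1 : IdxE r n m → ℤ) := by
    ext y
    simp [Finset.sum_apply, Pi.single_apply]
  rw [h, map_sum]
  refine sum_mem fun x _ => ?_
  rw [map_zsmul]
  exact zsmul_mem (AddSubgroup.subset_closure (Set.mem_range_self x)) _

theorem isHomogDot_zero_iff
    (hcone : ∀ v : Fin r ⊕ Fin s → ℚ, ∃ c : IdxE r n m → ℚ, (∀ x, 0 ≤ c x) ∧
      ∀ rw, v rw = ∑ x : IdxE r n m, c x * (PdotCol r n l m s d d' x rw : ℚ))
    (y : RAnLE 𝕂 r a n l m) :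
    IsHomogDot r n l m s d d' 𝕂 a 0 y ↔ ∃ c : 𝕂, y = algebraMap 𝕂 (RAnLE 𝕂 r a n l m) c := by
  refine ⟨?_, ?_⟩
  · rintro ⟨p, hp, rfl⟩
    have h : p = C (coeff 0 p) := by
      ext e
      rw [coeff_C]
      split_ifs with he
      · rw [he]
      · by_contra hc
        have h1 := hp hc
        rw [weight_wKdot, ← map_zero (Qdot r n l m s d d'), Qdot_eq_iff] at h1
        obtain ⟨w, hw⟩ := h1
        rw [zero_add] at hw
        have h2 := eq_zero_of_rowComb_nonneg hcone w (hw ▸ fun x => Int.natCast_nonneg _)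
        rw [h2, map_zero, ← expZ_zero] at hw
        exact he (expZ_injective hw).symm
    exact ⟨coeff 0 p, congrArg _ h⟩
  · rintro ⟨c, rfl⟩
    exact isHomogDot_algebraMap c

variable {Ω : Type*} [Field Ω] [Algebra 𝕂 Ω] [Algebra (MvPolynomial (Fin s) (Polynomial 𝕂)) Ω]
variable [IsScalarTower 𝕂 (MvPolynomial (Fin s) (Polynomial 𝕂)) Ω]

/-- A homomorphism to a field that is injective on homogeneous elements. -/
theorem exists_algHom_injective_on_homogeneous
    (ha : ∀ i k : Fin (r+1), i ≠ k → LinearIndependent 𝕂 ![a i, a k])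
    (hr : 1 ≤ r) (hn : ∀ i, 0 < n i) (hl : ∀ i j, 0 < l i j)
    (hinj : Function.Injective (algebraMap (MvPolynomial (Fin s) (Polynomial 𝕂)) Ω))
    {q : Fin r} {χ : AddChar (IdxE r n m → ℤ) Ω}
    (hχ : ∀ i, χ (PdotRow r n l m s d d' i) = algebraMap _ Ω (rowVal s (genericRow a q.succ) i)) :
    ∃ φ : RAnLE 𝕂 r a n l m →ₐ[𝕂] Ω, (∀ e, φ (Ideal.Quotient.mk _ (monomial e 1)) = χ (expZ e)) ∧
      ∀ δ x, IsHomogDot r n l m s d d' 𝕂 a δ x → φ x = 0 → x = 0 := by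
  obtain ⟨h1, h2⟩ := evChar_inr_generic ha hr hn hl hinj hχ ∅
  refine ⟨Ideal.Quotient.liftₐ _ _ h1, fun e => ?_, ?_⟩
  · refine (evChar_monomial χ (by simp) 1).trans (one_smul _ _)
  · rintro δ _ ⟨p, hp, rfl⟩ h0
    have h3 := h2 δ p hp h0
    rw [Set.image_empty, Set.image_empty, Ideal.span_empty, sup_bot_eq] at h3
    exact Ideal.Quotient.eq_zero_iff_mem.2 h3

theorem dvd_of_mem_relIdealE_sup {p q : MvPolynomial (IdxE r n m) 𝕂}
    (h : p ∈ relIdealE 𝕂 r a n l m ⊔ Ideal.span {q}) :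
    Ideal.Quotient.mk (relIdealE 𝕂 r a n l m) q ∣ Ideal.Quotient.mk (relIdealE 𝕂 r a n l m) p := by
  obtain ⟨u, hu, v, hv, rfl⟩ := Submodule.mem_sup.1 h
  rw [map_add, Ideal.Quotient.eq_zero_iff_mem.2 hu, zero_add]
  exact map_dvd _ (Ideal.mem_span_singleton.1 hv)

/-- A homomorphism to a field that detects divisibility of homogeneous elements by `x`. -/
theorem exists_algHom_dvd_iff [IsAlgClosed Ω] [CharZero Ω]
    (ha : ∀ i k : Fin (r+1), i ≠ k → LinearIndependent 𝕂 ![a i, a k])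
    (hr : 1 ≤ r) (hn : ∀ i, 0 < n i) (hl : ∀ i j, 0 < l i j)
    (hcone : ∀ v : Fin r ⊕ Fin s → ℚ, ∃ c : IdxE r n m → ℚ, (∀ x, 0 ≤ c x) ∧
      ∀ rw, v rw = ∑ x : IdxE r n m, c x * (PdotCol r n l m s d d' x rw : ℚ))
    (hinj : Function.Injective (algebraMap (MvPolynomial (Fin s) (Polynomial 𝕂)) Ω))
    (x : IdxE r n m) :
    ∃ φ : RAnLE 𝕂 r a n l m →ₐ[𝕂] Ω, (∀ y ≠ x, φ (Ideal.Quotient.mk _ (X y)) ≠ 0) ∧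
      ∀ δ y, IsHomogDot r n l m s d d' 𝕂 a δ y →
        (φ y = 0 ↔ Ideal.Quotient.mk (relIdealE 𝕂 r a n l m) (X x) ∣ y) := by
  obtain ⟨φ, hI, hx, hy, h⟩ := exists_test_point ha hr hn hl hcone hinj x
  refine ⟨Ideal.Quotient.liftₐ _ φ hI, hy, ?_⟩
  rintro δ _ ⟨p, hp, rfl⟩
  refine ⟨fun h0 => dvd_of_mem_relIdealE_sup (h δ p hp h0), ?_⟩
  rintro ⟨z, hz⟩
  have hx' : Ideal.Quotient.liftₐ _ φ hI (Ideal.Quotient.mk _ (X x)) = 0 := hx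
  rw [hz, map_mul, hx', zero_mul]

theorem kPrimeDot_iff_isPrimeIn {f : RAnLE 𝕂 r a n l m} :
    KPrimeDot r n l m s d d' 𝕂 a f ↔ IsPrimeIn (homogSubmonoid l d d' 𝕂 a) f :=
  ⟨fun ⟨h1, h2, h3, h4⟩ => ⟨h1, h2, h3, fun x hx y hy => h4 x y hx hy⟩,
    fun ⟨h1, h2, h3, h4⟩ => ⟨h1, h2, h3, fun x y hx hy => h4 x hx y hy⟩⟩

theorem kPrimeDot_X [IsAlgClosed Ω] [CharZero Ω]
    (ha : ∀ i k : Fin (r+1), i ≠ k → LinearIndependent 𝕂 ![a i, a k])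
    (hr : 1 ≤ r) (hn : ∀ i, 0 < n i) (hl : ∀ i j, 0 < l i j)
    (hcone : ∀ v : Fin r ⊕ Fin s → ℚ, ∃ c : IdxE r n m → ℚ, (∀ x, 0 ≤ c x) ∧
      ∀ rw, v rw = ∑ x : IdxE r n m, c x * (PdotCol r n l m s d d' x rw : ℚ))
    (hinj : Function.Injective (algebraMap (MvPolynomial (Fin s) (Polynomial 𝕂)) Ω))
    {χ : AddChar (IdxE r n m → ℤ) Ω} {φ : RAnLE 𝕂 r a n l m →ₐ[𝕂] Ω}
    (hφ : ∀ e, φ (Ideal.Quotient.mk _ (monomial e 1)) = χ (expZ e)) (x : IdxE r n m) :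
    KPrimeDot r n l m s d d' 𝕂 a (Ideal.Quotient.mk (relIdealE 𝕂 r a n l m) (X x)) := by
  obtain ⟨ψ, -, hψ⟩ := exists_algHom_dvd_iff ha hr hn hl hcone hinj x
  refine ⟨⟨_, isHomogDot_X x⟩, fun h => ?_, fun h => ?_, ?_⟩
  · refine addChar_ne_zero χ (expZ (Finsupp.single x 1)) ?_
    rw [← hφ]
    exact (congrArg φ h).trans (map_zero φ)
  · exact (h.map ψ).ne_zero ((hψ _ _ (isHomogDot_X x)).2 dvd_rfl)
  · rintro y z ⟨δ, hy⟩ ⟨ε, hz⟩ h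
    rw [← hψ _ _ (hy.mul hz), map_mul, mul_eq_zero, hψ _ _ hy, hψ _ _ hz] at h
    exact h

theorem not_associated_X [IsAlgClosed Ω] [CharZero Ω]
    (ha : ∀ i k : Fin (r+1), i ≠ k → LinearIndependent 𝕂 ![a i, a k])
    (hr : 1 ≤ r) (hn : ∀ i, 0 < n i) (hl : ∀ i j, 0 < l i j)
    (hcone : ∀ v : Fin r ⊕ Fin s → ℚ, ∃ c : IdxE r n m → ℚ, (∀ x, 0 ≤ c x) ∧
      ∀ rw, v rw = ∑ x : IdxE r n m, c x * (PdotCol r n l m s d d' x rw : ℚ))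
    (hinj : Function.Injective (algebraMap (MvPolynomial (Fin s) (Polynomial 𝕂)) Ω))
    {x y : IdxE r n m} (hxy : x ≠ y) :
    ¬ Associated (Ideal.Quotient.mk (relIdealE 𝕂 r a n l m) (X x))
      (Ideal.Quotient.mk (relIdealE 𝕂 r a n l m) (X y)) := by
  obtain ⟨ψ, hψ, hψ'⟩ := exists_algHom_dvd_iff ha hr hn hl hcone hinj x
  exact fun h => hψ y hxy.symm ((hψ' _ _ (isHomogDot_X y)).2 h.dvd)

end Main

section Statement13

/-- If the columns of `Ṗ` are pairwise different primitive vectors of `ℤ^{r+s}`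
generating `ℚ^{r+s}` as a cone, then the `K̇`-grading of `R(A,𝔫,L)[S_1, …, S_m]` is
effective, pointed and factorial, and the classes of the generators `T_{ij}`, `S_k`
are pairwise nonassociated `K̇`-prime elements. -/
theorem statement13 (𝕂 : Type) [Field 𝕂] [IsAlgClosed 𝕂] [CharZero 𝕂]
    (r : ℕ) (hr : 1 ≤ r) (a : Fin (r+1) → 𝕂 × 𝕂)
    (ha : ∀ i k : Fin (r+1), i ≠ k → LinearIndependent 𝕂 ![a i, a k])
    (n : Fin (r+1) → ℕ) (hn : ∀ i, 0 < n i)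
    (l : ∀ i : Fin (r+1), Fin (n i) → ℕ) (hl : ∀ i j, 0 < l i j)
    (m s : ℕ) (hs : 0 < s) (hs' : r + s < (∑ i, n i) + m)
    (d : Fin s → Idx r n → ℤ) (d' : Fin s → Fin m → ℤ)
    (hdiff : ∀ x y : IdxE r n m, x ≠ y →
      PdotCol r n l m s d d' x ≠ PdotCol r n l m s d d' y)
    (hprim : ∀ x : IdxE r n m,
      Finset.univ.gcd (fun rw => (PdotCol r n l m s d d' x rw).natAbs) = 1)
    (hcone : ∀ v : Fin r ⊕ Fin s → ℚ, ∃ c : IdxE r n m → ℚ, (∀ x, 0 ≤ c x) ∧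
      ∀ rw, v rw = ∑ x : IdxE r n m, c x * (PdotCol r n l m s d d' x rw : ℚ)) :
    AddSubgroup.closure (Set.range (wKdot r n l m s d d')) = ⊤ ∧
    (∀ y : RAnLE 𝕂 r a n l m, IsHomogDot r n l m s d d' 𝕂 a 0 y ↔
      ∃ c : 𝕂, y = algebraMap 𝕂 (RAnLE 𝕂 r a n l m) c) ∧
    (∀ f : RAnLE 𝕂 r a n l m, (∃ δ, IsHomogDot r n l m s d d' 𝕂 a δ f) →
      f ≠ 0 → ¬ IsUnit f →
      ∃ ms : Multiset (RAnLE 𝕂 r a n l m),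
        (∀ p ∈ ms, KPrimeDot r n l m s d d' 𝕂 a p) ∧ ms.prod = f) ∧
    (∀ x : IdxE r n m,
      KPrimeDot r n l m s d d' 𝕂 a (Ideal.Quotient.mk (relIdealE 𝕂 r a n l m) (X x))) ∧
    (∀ x y : IdxE r n m, x ≠ y →
      ¬ Associated (Ideal.Quotient.mk (relIdealE 𝕂 r a n l m) (X x))
        (Ideal.Quotient.mk (relIdealE 𝕂 r a n l m) (X y))) := by
  let Ω := AlgebraicClosure (FractionRing (MvPolynomial (Fin s) (Polynomial 𝕂)))
  have hinj : Function.Injective (algebraMap (MvPolynomial (Fin s) (Polynomial 𝕂)) Ω) := by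
    rw [IsScalarTower.algebraMap_eq _
      (FractionRing (MvPolynomial (Fin s) (Polynomial 𝕂))) Ω]
    exact (algebraMap (FractionRing (MvPolynomial (Fin s) (Polynomial 𝕂))) Ω).injective.comp
      (IsFractionRing.injective _ _)
  have : CharZero Ω := charZero_of_injective_algebraMap hinj
  have hρ := genericRow_ne_zero ha ⟨0, hr⟩
  obtain ⟨χ, hχ⟩ := exists_addChar_row_eq (Ω := Ω) hcone hinj hρ
  obtain ⟨φ, hφ, hφ0⟩ := exists_algHom_injective_on_homogeneous ha hr hn hl hinj hχ
  have hX := kPrimeDot_X ha hr hn hl hcone hinj hφ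
  refine ⟨closure_range_wKdot, isHomogDot_zero_iff hcone, fun f ⟨δ, hf⟩ hf0 hfu => ?_, hX,
    fun x y hxy => not_associated_X ha hr hn hl hcone hinj hxy⟩
  simp only [kPrimeDot_iff_isPrimeIn] at hX ⊢
  exact exists_multiset_isPrimeIn_of_isHomogDot hinj hφ hφ0 hρ (genericRow_self ha _) hχ hX
    hf hf0 hfu

end Statement13
end
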